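/- arXiv:2507.14033 — 2 statements merged into one kernel-verified Lean document; each statement's English description precedes it below -/
import Mathlib

section
/- Let x ≤ y be dominant elements of W and let i ∈ {1,2}. Then the piecewise translation τ_i : W → W is injective, and τ_i([x,y]) ⊆ [x+ϖi, y+ϖi] (note that τ_i(x) = x+ϖi and τ_i(y) = y+ϖi since cen(x), cen(y) ∈ F_id). Moreover, if τ_i([x,y]) = [x+ϖi, y+ϖi], then τ_i restricts to an isomorphism of posets from [x,y] onto [x+ϖi, y+ϖi]. -/
noncomputable section

open scoped RealInnerProductSpace

/-- The Bruhat strict order on a Coxeter group: the transitive closure of the relation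
"multiply on the left by a reflection, increasing the length". -/
def bruhatLT {B : Type*} {W : Type*} [Group W] {M : CoxeterMatrix B}
    (cs : CoxeterSystem M W) : W → W → Prop :=
  Relation.TransGen (fun a b => (∃ t, cs.IsReflection t ∧ b = t * a) ∧ cs.length a < cs.length b)

/-- The Bruhat order on a Coxeter group. -/
def bruhatLE {B : Type*} {W : Type*} [Group W] {M : CoxeterMatrix B}
    (cs : CoxeterSystem M W) (x y : W) : Prop :=
  x = y ∨ bruhatLT cs x y

/-- The Bruhat interval `[x, y]` as a set. -/
def Iset {B : Type*} {W : Type*} [Group W] {M : CoxeterMatrix B}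
    (cs : CoxeterSystem M W) (x y : W) : Set W :=
  {z | bruhatLE cs x z ∧ bruhatLE cs z y}

/-- The Bruhat covers `U(x)` of an element `x`. -/
def Uset {B : Type*} {W : Type*} [Group W] {M : CoxeterMatrix B}
    (cs : CoxeterSystem M W) (x : W) : Set W :=
  {w | bruhatLT cs x w ∧ cs.length w = cs.length x + 1}

/-- The Bruhat cocovers `L(y)` of an element `y`. -/
def Lset {B : Type*} {W : Type*} [Group W] {M : CoxeterMatrix B}
    (cs : CoxeterSystem M W) (y : W) : Set W :=
  {w | bruhatLT cs w y ∧ cs.length y = cs.length w + 1}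

/-- An interval `[x, y]` is full if it contains all Bruhat covers of `x` and all
Bruhat cocovers of `y`. -/
def FullInt {B : Type*} {W : Type*} [Group W] {M : CoxeterMatrix B}
    (cs : CoxeterSystem M W) (x y : W) : Prop :=
  Uset cs x ⊆ Iset cs x y ∧ Lset cs y ⊆ Iset cs x y

/-- Two Bruhat intervals (possibly in different Coxeter groups) are isomorphic as posets. -/
def IntervalIso {B : Type*} {W : Type*} {B' : Type*} {W' : Type*} [Group W] [Group W']
    {M : CoxeterMatrix B} {M' : CoxeterMatrix B'}
    (cs : CoxeterSystem M W) (cs' : CoxeterSystem M' W') (x y : W) (x' y' : W') : Prop :=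
  ∃ f : {z : W // bruhatLE cs x z ∧ bruhatLE cs z y} ≃
        {z : W' // bruhatLE cs' x' z ∧ bruhatLE cs' z y'},
    ∀ u v, bruhatLE cs u.1 v.1 ↔ bruhatLE cs' (f u).1 (f v).1

/-- The group `G` of generic automorphisms: the subgroup of the permutation group of `W`
generated by the Dynkin diagram automorphisms `δ`, `σ` and inversion. -/
def Gsub {W : Type*} [Group W] (dl sg : W ≃* W) : Subgroup (Equiv.Perm W) :=
  Subgroup.closure {dl.toEquiv, sg.toEquiv, Equiv.inv W}

/-- The Euclidean plane, with coordinates taken in the basis of simple roots of `A₂`. -/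
abbrev E2 : Type := ℝ × ℝ

/-- The `A₂` inner product on the plane, in which `(αᵢ, αᵢ) = 2` and `(α₁, α₂) = -1`. -/
def B2 (u v : E2) : ℝ := 2*u.1*v.1 - u.1*v.2 - u.2*v.1 + 2*u.2*v.2

/-- The simple root `α₁`. -/
def a1 : E2 := (1, 0)
/-- The simple root `α₂`. -/
def a2 : E2 := (0, 1)
/-- The fundamental weight `ϖ₁`, satisfying `(αᵢ, ϖⱼ) = δᵢⱼ`. -/
def fw1 : E2 := (2/3, 1/3)
/-- The fundamental weight `ϖ₂`. -/
def fw2 : E2 := (1/3, 2/3)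
/-- `ρ = ϖ₁ + ϖ₂ = α₁ + α₂`. -/
def rho2 : E2 := (1, 1)

/-- The affine reflection `s_{α,k}` of the plane in the line `{v | (α, v) = k}`,
for a root `α` with `(α, α) = 2`. -/
def reflE (a : E2) (k : ℝ) (v : E2) : E2 := v - (B2 a v - k) • a

/-- The barycenter of the alcove of `z`, i.e. the image under the affine action of `z` of
the barycenter `-ρ/3` of the fundamental alcove (whose vertices are `0, -ϖ₁, -ϖ₂`). -/
def cen {W : Type*} [Group W] (act : W →* Equiv.Perm E2) (z : W) : E2 :=
  act z ((-(1/3 : ℝ)) • rho2)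

/-- The weight lattice `Λ = ℤϖ₁ ⊕ ℤϖ₂`. -/
def wLat : Set E2 := {v | ∃ a b : ℤ, v = (a : ℝ) • fw1 + (b : ℝ) • fw2}

/-- The fundamental alcove `A₊`. -/
def AlcoveFund : Set E2 :=
  {v | (-1 < B2 a1 v ∧ B2 a1 v < 0) ∧ (-1 < B2 a2 v ∧ B2 a2 v < 0) ∧
    (-1 < B2 rho2 v ∧ B2 rho2 v < 0)}

/-- The zone `F_id` of the plane. -/
def Fid : Set E2 := {v | -1 ≤ B2 a1 v ∧ -1 ≤ B2 a2 v ∧ -1 ≤ B2 rho2 v}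

/-- The cone `K` of nonnegative combinations of the simple roots. -/
def coneK : Set E2 := {v | ∃ a b : ℝ, 0 ≤ a ∧ 0 ≤ b ∧ v = a • a1 + b • a2}

/-- The set `D` of dominant elements, given functions `θ, θˢ` enumerating them. -/
def Dset {W : Type*} (th ths : ℕ → ℕ → W) : Set W :=
  {w | (∃ m n, w = th m n) ∨ (∃ m n, w = ths m n)}

/-- The polygon `Pgn_{x,y} = F_id ∩ (cen x + K) ∩ (cen y - K)`. -/
def Pgn {W : Type*} [Group W] (act : W →* Equiv.Perm E2) (x y : W) : Set E2 :=
  {v ∈ Fid | (∃ k ∈ coneK, v = cen act x + k) ∧ (∃ k ∈ coneK, v = cen act y - k)}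

/-- The element `x_k`: the product of the first `k` terms of `s₁, s₂, s₀, s₁, s₂, s₀, …`. -/
def xelt {W : Type*} [Group W] {M : CoxeterMatrix (Fin 3)} (cs : CoxeterSystem M W)
    (k : ℕ) : W :=
  ((List.range k).map (fun j => cs.simple (⟨(j + 1) % 3, Nat.mod_lt _ (by norm_num)⟩ : Fin 3))).prod

/-- `zoneOf cs w v` says that `w` is one of the six elements of `W_f` and `v` lies in the
corresponding zone `F_w` of the plane. -/
def zoneOf {W : Type*} [Group W] {M : CoxeterMatrix (Fin 3)} (cs : CoxeterSystem M W)
    (w : W) (v : E2) : Prop :=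
  (w = 1 ∧ v ∈ Fid) ∨
  (w = cs.simple 1 ∧ B2 a1 v ≤ -1 ∧ -1 ≤ B2 rho2 v) ∨
  (w = cs.simple 2 ∧ B2 a2 v ≤ -1 ∧ -1 ≤ B2 rho2 v) ∨
  (w = cs.simple 1 * cs.simple 2 ∧ B2 rho2 v ≤ -1 ∧ 0 ≤ B2 a2 v) ∨
  (w = cs.simple 2 * cs.simple 1 ∧ B2 rho2 v ≤ -1 ∧ 0 ≤ B2 a1 v) ∨
  (w = cs.simple 1 * cs.simple 2 * cs.simple 1 ∧ B2 a1 v ≤ 0 ∧ B2 a2 v ≤ 0)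

/-- Thickness of the interval `[x,y]`: `x + 2αᵢ` and `y - 2αᵢ` belong to `[x,y]` and their
barycenters lie in `F_id`, for `i = 1, 2`. -/
def Thick {W : Type*} [Group W] {M : CoxeterMatrix (Fin 3)} (cs : CoxeterSystem M W)
    (act : W →* Equiv.Perm E2) (Wadd : W → E2 → W) (x y : W) : Prop :=
  Wadd x ((2 : ℝ) • a1) ∈ Iset cs x y ∧ Wadd x ((2 : ℝ) • a2) ∈ Iset cs x y ∧
  Wadd y (-((2 : ℝ) • a1)) ∈ Iset cs x y ∧ Wadd y (-((2 : ℝ) • a2)) ∈ Iset cs x y ∧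
  cen act (Wadd x ((2 : ℝ) • a1)) ∈ Fid ∧ cen act (Wadd x ((2 : ℝ) • a2)) ∈ Fid ∧
  cen act (Wadd y (-((2 : ℝ) • a1))) ∈ Fid ∧ cen act (Wadd y (-((2 : ℝ) • a2))) ∈ Fid

/-- An alcove of type `A₂`, encoded by the integer parts of the pairings of its interior
points with `α₁`, `α₂` and `ρ`. -/
@[ext]
structure Alc where
  /-- Integer part of the pairing with `α₁`. -/
  p : ℤ
  /-- Integer part of the pairing with `α₂`. -/
  q : ℤ
  /-- Integer part of the pairing with `ρ`. -/
  r : ℤ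

namespace Alc

/-- The triples that come from alcoves. -/
def Valid (a : Alc) : Prop := a.r = a.p + a.q ∨ a.r = a.p + a.q + 1

/-- The number of hyperplanes separating an alcove from the fundamental alcove. -/
def len (a : Alc) : ℕ := (a.p + 1).natAbs + (a.q + 1).natAbs + (a.r + 1).natAbs

/-- The reflection in `H_{α₁,k}`. -/
def refl1 (k : ℤ) (a : Alc) : Alc := ⟨2 * k - 1 - a.p, a.r - k, a.q + k⟩

/-- The reflection in `H_{α₂,k}`. -/
def refl2 (k : ℤ) (a : Alc) : Alc := ⟨a.r - k, 2 * k - 1 - a.q, a.p + k⟩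

/-- The reflection in `H_{ρ,k}`. -/
def refl3 (k : ℤ) (a : Alc) : Alc := ⟨k - 1 - a.q, k - 1 - a.p, 2 * k - 1 - a.r⟩

/-- `Up n k` says that an alcove with integer part `n` along a root `α` lies on the same side of
`H_{α,k}` as the fundamental alcove. -/
def Up (n k : ℤ) : Prop := 0 ≤ k ∧ n < k ∨ k < 0 ∧ k ≤ n

/-- `b` is obtained from `a` by a reflection along `α₁` moving away from the fundamental alcove. -/
def Edge1 (a b : Alc) : Prop :=
  b.p = 2 * (a.r - b.q) - 1 - a.p ∧ b.r = a.q + (a.r - b.q) ∧ Up a.p (a.r - b.q)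

/-- `b` is obtained from `a` by a reflection along `α₂` moving away from the fundamental alcove. -/
def Edge2 (a b : Alc) : Prop :=
  b.q = 2 * (a.r - b.p) - 1 - a.q ∧ b.r = a.p + (a.r - b.p) ∧ Up a.q (a.r - b.p)

/-- `b` is obtained from `a` by a reflection along `ρ` moving away from the fundamental alcove. -/
def Edge3 (a b : Alc) : Prop :=
  b.q = b.p + a.q - a.p ∧ b.r = 2 * (b.p + 1 + a.q) - 1 - a.r ∧ Up a.r (b.p + 1 + a.q)

/-- `b` is obtained from `a` by a reflection moving away from the fundamental alcove. -/
def Edge (a b : Alc) : Prop := Edge1 a b ∨ Edge2 a b ∨ Edge3 a b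

/-- The Bruhat order on alcoves. -/
abbrev Le : Alc → Alc → Prop := Relation.ReflTransGen Edge

/-- The alcoves of the open dominant chamber. -/
def Dom (a : Alc) : Prop := 0 ≤ a.p ∧ 0 ≤ a.q

lemma edge_iff {a b : Alc} :
    Edge a b ↔ ∃ k, b = refl1 k a ∧ Up a.p k ∨ b = refl2 k a ∧ Up a.q k ∨
      b = refl3 k a ∧ Up a.r k := by
  simp only [Edge, Edge1, Edge2, Edge3, Up, refl1, refl2, refl3, Alc.ext_iff]
  constructor
  · rintro (h | h | h)
    · exact ⟨a.r - b.q, by omega⟩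
    · exact ⟨a.r - b.p, by omega⟩
    · exact ⟨b.p + 1 + a.q, by omega⟩
  · rintro ⟨k, h⟩
    omega

lemma len_refl1_lt_iff {a : Alc} (ha : a.Valid) (k : ℤ) : a.len < (refl1 k a).len ↔ Up a.p k := by
  simp only [Valid, len, refl1, Up] at *
  omega

lemma len_refl2_lt_iff {a : Alc} (ha : a.Valid) (k : ℤ) : a.len < (refl2 k a).len ↔ Up a.q k := by
  simp only [Valid, len, refl2, Up] at *
  omega

lemma len_refl3_lt_iff {a : Alc} (ha : a.Valid) (k : ℤ) : a.len < (refl3 k a).len ↔ Up a.r k := by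
  simp only [Valid, len, refl3, Up] at *
  omega

lemma Edge.valid {a b : Alc} (h : Edge a b) (ha : a.Valid) : b.Valid := by
  simp only [Valid, Edge, Edge1, Edge2, Edge3, Up] at *
  omega

lemma Edge.valid_left {a b : Alc} (h : Edge a b) (hb : b.Valid) : a.Valid := by
  simp only [Valid, Edge, Edge1, Edge2, Edge3, Up] at *
  omega

lemma Edge.len_lt {a b : Alc} (h : Edge a b) (ha : a.Valid) : a.len < b.len := by
  obtain ⟨k, ⟨rfl, hk⟩ | ⟨rfl, hk⟩ | ⟨rfl, hk⟩⟩ := edge_iff.1 h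
  · exact (len_refl1_lt_iff ha k).2 hk
  · exact (len_refl2_lt_iff ha k).2 hk
  · exact (len_refl3_lt_iff ha k).2 hk

/-- `z` lies in the convex hull of the finite Weyl group orbit of `y`, for `y` dominant with
`A = y.p + y.r` and `B = y.q + y.r`. -/
def Lower (A B : ℤ) (z : Alc) : Prop :=
  z.p + z.r ≤ A ∧ z.q - z.p - 1 ≤ A ∧ -z.q - z.r - 2 ≤ A ∧
  z.q + z.r ≤ B ∧ z.p - z.q - 1 ≤ B ∧ -z.p - z.r - 2 ≤ B

/-- `z` lies outside the star-shaped region below `x`, for `x` dominant with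
`A = x.p + x.r` and `B = x.q + x.r`. -/
def Upper (A B : ℤ) (z : Alc) : Prop :=
  (-1 ≤ z.p ∧ -1 ≤ z.q ∧ -1 ≤ z.r) ∧ A ≤ z.p + z.r ∧ B ≤ z.q + z.r ∨
  (z.p ≤ -2 ∧ -1 ≤ z.r) ∧ A ≤ z.q - z.p - 4 ∧ B ≤ z.q + z.r ∨
  (z.q ≤ -2 ∧ -1 ≤ z.r) ∧ A ≤ z.p + z.r ∧ B ≤ z.p - z.q - 4 ∨
  (z.r ≤ -2 ∧ 0 ≤ z.q) ∧ A ≤ z.q - z.p - 4 ∧ B ≤ -z.p - z.r - 5 ∨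
  (z.r ≤ -2 ∧ 0 ≤ z.p) ∧ A ≤ -z.q - z.r - 5 ∧ B ≤ z.p - z.q - 4 ∨
  (z.p ≤ -1 ∧ z.q ≤ -1 ∧ z.r ≤ -2) ∧ A ≤ -z.q - z.r - 5 ∧ B ≤ -z.p - z.r - 5

lemma Edge.lower {a b : Alc} {A B : ℤ} (h : Edge a b) (hb : Lower A B b) (ha : a.Valid) :
    Lower A B a := by
  simp only [Edge, Edge1, Edge2, Edge3, Up, Lower, Valid] at *
  omega

lemma Edge.upper {a b : Alc} {A B : ℤ} (h : Edge a b) (ha : Upper A B a) (hv : a.Valid)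
    (hA : 0 ≤ A) (hB : 0 ≤ B) : Upper A B b := by
  have hb := h.valid hv
  simp only [Edge, Edge1, Edge2, Edge3, Up, Valid, Upper] at *
  have hz : -1 ≤ b.p ∧ -1 ≤ b.q ∧ -1 ≤ b.r ∨ b.p ≤ -2 ∧ -1 ≤ b.r ∨ b.q ≤ -2 ∧ -1 ≤ b.r ∨
      b.r ≤ -2 ∧ 0 ≤ b.q ∨ b.r ≤ -2 ∧ 0 ≤ b.p ∨ b.p ≤ -1 ∧ b.q ≤ -1 ∧ b.r ≤ -2 := by omega
  rcases hz with hz | hz | hz | hz | hz | hz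
  · left; rcases ha with ha | ha | ha | ha | ha | ha <;> omega
  · right; left; rcases ha with ha | ha | ha | ha | ha | ha <;> omega
  · right; right; left; rcases ha with ha | ha | ha | ha | ha | ha <;> omega
  · right; right; right; left; rcases ha with ha | ha | ha | ha | ha | ha <;> omega
  · right; right; right; right; left; rcases ha with ha | ha | ha | ha | ha | ha <;> omega
  · right; right; right; right; right; rcases ha with ha | ha | ha | ha | ha | ha <;> omega

lemma exists_edge_lower {y z : Alc} (hy : y.Valid) (hd : y.Dom) (hz : z.Valid)
    (h : Lower (y.p + y.r) (y.q + y.r) z) (hne : z ≠ y) :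
    ∃ z', Edge z z' ∧ Lower (y.p + y.r) (y.q + y.r) z' := by
  simp only [Ne, Alc.ext_iff, Valid, Dom, Lower] at *
  simp only [edge_iff]
  by_cases hp : z.p < 0
  · exact ⟨_, ⟨0, Or.inl ⟨rfl, by simp only [Up]; omega⟩⟩, by simp only [refl1]; omega⟩
  by_cases hq : z.q < 0
  · exact ⟨_, ⟨0, Or.inr (Or.inl ⟨rfl, by simp only [Up]; omega⟩)⟩, by simp only [refl2]; omega⟩
  by_cases hA : z.p + z.r < y.p + y.r
  · by_cases hB : z.r = z.p + z.q ∧ z.q + z.r < y.q + y.r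
    · exact ⟨_, ⟨z.r + 1, Or.inr (Or.inr ⟨rfl, by simp only [Up]; omega⟩)⟩,
        by simp only [refl3]; omega⟩
    · exact ⟨_, ⟨z.p + 1, Or.inl ⟨rfl, by simp only [Up]; omega⟩⟩, by simp only [refl1]; omega⟩
  · exact ⟨_, ⟨z.q + 1, Or.inr (Or.inl ⟨rfl, by simp only [Up]; omega⟩)⟩,
      by simp only [refl2]; omega⟩

lemma le_of_lower {y z : Alc} (hy : y.Valid) (hd : y.Dom) (hz : z.Valid)
    (h : Lower (y.p + y.r) (y.q + y.r) z) : Le z y := by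
  obtain ⟨n, hn⟩ : ∃ n : ℕ, 4 * (y.p + y.r) + 4 * (y.q + y.r) + 10 - z.len ≤ n :=
    ⟨_, Int.self_le_toNat _⟩
  induction n generalizing z with
  | zero =>
    simp only [Lower, len, Valid, Dom] at *
    omega
  | succ n ih =>
    by_cases hne : z = y
    · exact hne ▸ .refl
    obtain ⟨z', he, hl⟩ := exists_edge_lower hy hd hz h hne
    have := he.len_lt hz
    exact .head he (ih (he.valid hz) hl (by omega))

lemma exists_edge_upper {x z : Alc} (hx : x.Valid) (hd : x.Dom) (hz : z.Valid)
    (h : Upper (x.p + x.r) (x.q + x.r) z) (hne : x ≠ z) :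
    ∃ z', Edge z' z ∧ Upper (x.p + x.r) (x.q + x.r) z' := by
  simp only [Ne, Alc.ext_iff, Valid, Dom] at *
  simp only [Edge, Edge1, Edge2, Edge3]
  by_cases hr : z.r ≤ -2
  · refine ⟨refl3 (-1) z, by simp only [Up, refl3]; omega, ?_⟩
    simp only [Upper] at *
    simp only [refl3]
    rcases h with h | h | h | h | h | h
    · omega
    · omega
    · omega
    · right; left; omega
    · right; right; left; omega
    · left; omega
  by_cases hp : z.p ≤ -2
  · refine ⟨refl1 (-1) z, by simp only [Up, refl1]; omega, Or.inl ?_⟩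
    simp only [Upper] at *
    simp only [refl1]
    omega
  by_cases hq : z.q ≤ -2
  · refine ⟨refl2 (-1) z, by simp only [Up, refl2]; omega, Or.inl ?_⟩
    simp only [Upper] at *
    simp only [refl2]
    omega
  have h' : x.p + x.r ≤ z.p + z.r ∧ x.q + x.r ≤ z.q + z.r := by
    simp only [Upper] at h
    omega
  by_cases hA : x.p + x.r < z.p + z.r ∧ x.q + x.r < z.q + z.r ∧ z.r = z.p + z.q + 1
  · exact ⟨refl3 z.r z, by simp only [Up, refl3]; omega,
      Or.inl (by simp only [refl3]; omega)⟩
  by_cases hB : x.p + x.r < z.p + z.r ∧ 0 ≤ z.p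
  · exact ⟨refl1 z.p z, by simp only [Up, refl1]; omega,
      Or.inl (by simp only [refl1]; omega)⟩
  · exact ⟨refl2 z.q z, by simp only [Up, refl2]; omega,
      Or.inl (by simp only [refl2]; omega)⟩

lemma le_of_upper {x z : Alc} (hx : x.Valid) (hd : x.Dom) (hz : z.Valid)
    (h : Upper (x.p + x.r) (x.q + x.r) z) : Le x z := by
  induction hn : z.len using Nat.strong_induction_on generalizing z with
  | _ n ih =>
    by_cases hne : x = z
    · exact hne ▸ .refl
    obtain ⟨z', he, hl⟩ := exists_edge_upper hx hd hz h hne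
    have hv := he.valid_left hz
    exact .tail (ih _ (hn ▸ he.len_lt hv) hv hl rfl) he

lemma Le.valid {a b : Alc} (h : Le a b) (ha : a.Valid) : b.Valid := by
  induction h with
  | refl => exact ha
  | tail _ he ih => exact he.valid ih

lemma le_iff_lower {y z : Alc} (hy : y.Valid) (hd : y.Dom) (hz : z.Valid) :
    Le z y ↔ Lower (y.p + y.r) (y.q + y.r) z := by
  refine ⟨fun h => ?_, le_of_lower hy hd hz⟩
  induction h using Relation.ReflTransGen.head_induction_on with
  | refl =>
    simp only [Lower, Valid, Dom] at *
    omega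
  | head he _ ih => exact he.lower (ih (he.valid hz)) hz

lemma le_iff_upper {x z : Alc} (hx : x.Valid) (hd : x.Dom) (hz : z.Valid) :
    Le x z ↔ Upper (x.p + x.r) (x.q + x.r) z := by
  refine ⟨fun h => ?_, le_of_upper hx hd hz⟩
  clear hz
  induction h with
  | refl =>
    simp only [Upper, Valid, Dom] at *
    omega
  | tail h he ih =>
    refine he.upper ih (Le.valid h hx) ?_ ?_ <;> (simp only [Valid, Dom] at *; omega)

/-- `t` is the image of `z` under the piecewise translation by `ϖ₁`. The fundamental alcove lies in
two of the six zones. -/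
def Shift1 (z t : Alc) : Prop :=
  (-1 ≤ z.p ∧ -1 ≤ z.q ∧ -1 ≤ z.r) ∧ t.p = z.p + 1 ∧ t.q = z.q ∧ t.r = z.r + 1 ∨
  (z.p ≤ -2 ∧ -1 ≤ z.r) ∧ t.p = z.p - 1 ∧ t.q = z.q + 1 ∧ t.r = z.r ∨
  (z.q ≤ -2 ∧ -1 ≤ z.r) ∧ t.p = z.p + 1 ∧ t.q = z.q ∧ t.r = z.r + 1 ∨
  (z.r ≤ -2 ∧ 0 ≤ z.q) ∧ t.p = z.p - 1 ∧ t.q = z.q + 1 ∧ t.r = z.r ∨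
  (z.r ≤ -2 ∧ 0 ≤ z.p) ∧ t.p = z.p ∧ t.q = z.q - 1 ∧ t.r = z.r - 1 ∨
  (z.p ≤ -1 ∧ z.q ≤ -1) ∧ t.p = z.p ∧ t.q = z.q - 1 ∧ t.r = z.r - 1

/-- `c` separates `a` from `b` outside the range of the relation `T`. -/
def Gap (T : Alc → Alc → Prop) (a b c : Alc) : Prop :=
  c.Valid ∧ (∀ z t, z.Valid → T z t → t ≠ c) ∧
    (∀ A B, Upper A B a → Upper A B c) ∧ ∀ A B, Lower A B b → Lower A B c

/-- The properties of the piecewise translations used in the comparison of Bruhat intervals. -/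
structure IsShift (T : Alc → Alc → Prop) : Prop where
  injective {z z' t : Alc} : z.Valid → z'.Valid → T z t → T z' t → z = z'
  valid {z t : Alc} : z.Valid → T z t → t.Valid
  dom {z t : Alc} : z.Valid → z.Dom → T z t → t.Dom
  lower {y z y' z' : Alc} : y.Valid → y.Dom → z.Valid → T y y' → T z z' →
    Lower (y.p + y.r) (y.q + y.r) z → Lower (y'.p + y'.r) (y'.q + y'.r) z'
  upper {x z x' z' : Alc} : x.Valid → x.Dom → z.Valid → T x x' → T z z' →
    Upper (x.p + x.r) (x.q + x.r) z → Upper (x'.p + x'.r) (x'.q + x'.r) z'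
  edge_iff_or_gap {a b a' b' : Alc} : a.Valid → b.Valid → a ≠ ⟨-1, -1, -1⟩ → b ≠ ⟨-1, -1, -1⟩ →
    T a a' → T b b' → (Edge a b ↔ Edge a' b') ∨ ∃ c, Gap T a' b' c

lemma Shift1.injective {z z' t : Alc} (hv' : z'.Valid) (h : Shift1 z t)
    (h' : Shift1 z' t) : z = z' := by
  simp only [Valid, Shift1, Alc.ext_iff] at *
  rcases h with h | h | h | h | h | h <;> omega

lemma Shift1.valid {z t : Alc} (hv : z.Valid) (h : Shift1 z t) : t.Valid := by
  simp only [Valid, Shift1] at *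
  omega

lemma Shift1.dom {z t : Alc} (hv : z.Valid) (hd : z.Dom) (h : Shift1 z t) : t.Dom := by
  simp only [Valid, Shift1, Dom] at *
  omega

lemma Shift1.of_dom {z t : Alc} (hv : z.Valid) (hd : z.Dom) (h : Shift1 z t) :
    t.p = z.p + 1 ∧ t.q = z.q ∧ t.r = z.r + 1 := by
  simp only [Valid, Shift1, Dom] at *
  omega

lemma Shift1.lower {y z y' z' : Alc} (hy : y.Valid) (hd : y.Dom)
    (hy' : Shift1 y y') (hz' : Shift1 z z') (h : Lower (y.p + y.r) (y.q + y.r) z) :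
    Lower (y'.p + y'.r) (y'.q + y'.r) z' := by
  have := hy'.of_dom hy hd
  clear hy'
  simp only [Valid, Shift1, Dom, Lower] at *
  rcases hz' with hz' | hz' | hz' | hz' | hz' | hz' <;> omega

lemma Shift1.upper {x z x' z' : Alc} (hx : x.Valid) (hd : x.Dom) (hz : z.Valid)
    (hx' : Shift1 x x') (hz' : Shift1 z z') (h : Upper (x.p + x.r) (x.q + x.r) z) :
    Upper (x'.p + x'.r) (x'.q + x'.r) z' := by
  have := hx'.of_dom hx hd
  clear hx'
  simp only [Valid, Shift1, Dom, Upper] at *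
  rcases hz' with hz' | hz' | hz' | hz' | hz' | hz'
  · left; omega
  · right; left; omega
  · right; right; left; omega
  · right; right; right; left; omega
  · right; right; right; right; left; omega
  · right; right; right; right; right; omega

section Gap

variable {a b a' b' : Alc}

lemma gap_refl1_of_edge2 (hvb : b.Valid)
    (ha : (-1 ≤ a.p ∧ -1 ≤ a.q ∨ a.q ≤ -2) ∧ -1 ≤ a.r)
    (ha' : a'.p = a.p + 1 ∧ a'.q = a.q ∧ a'.r = a.r + 1)
    (hb : b.p ≤ -2 ∧ -1 ≤ b.r)
    (hb' : b'.p = b.p - 1 ∧ b'.q = b.q + 1 ∧ b'.r = b.r)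
    (h : Edge2 a b ∨ Edge2 a' b') : Gap Shift1 a' b' (refl1 (b'.p / 2) b') := by
  generalize hk : b'.p / 2 = k
  simp only [Gap, Edge2, Up, Valid, refl1, Ne, Alc.ext_iff] at *
  replace hk : b'.p = 2 * k ∨ b'.p = 2 * k + 1 := by omega
  refine ⟨by omega, fun z t hz hT => ?_, fun A B hU => ?_, fun A B hL => ?_⟩
  · simp only [Shift1] at hT
    rcases h with h | h <;> rcases hT with hT | hT | hT | hT | hT | hT <;> omega
  · simp only [Upper] at *
    have hU : A ≤ a'.p + a'.r ∧ (-1 ≤ a.p ∧ -1 ≤ a.q ∧ B ≤ a'.q + a'.r ∨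
      a.q ≤ -2 ∧ B ≤ a'.p - a'.q - 4) := by omega
    rcases hk with hk | hk
    · left
      rcases h with h | h <;> omega
    · right; left
      rcases h with h | h <;> omega
  · simp only [Lower] at *
    rcases h with h | h <;> omega

lemma gap_refl3_of_edge2 (hvb : b.Valid)
    (ha : (-1 ≤ a.p ∧ -1 ≤ a.q ∨ a.q ≤ -2) ∧ -1 ≤ a.r)
    (ha' : a'.p = a.p + 1 ∧ a'.q = a.q ∧ a'.r = a.r + 1)
    (hb : b.r ≤ -2 ∧ 0 ≤ b.p)
    (hb' : b'.p = b.p ∧ b'.q = b.q - 1 ∧ b'.r = b.r - 1)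
    (h : Edge2 a b ∨ Edge2 a' b') : Gap Shift1 a' b' (refl3 (b'.r / 2) b') := by
  generalize hk : b'.r / 2 = k
  simp only [Gap, Edge2, Up, Valid, refl3, Ne, Alc.ext_iff] at *
  replace hk : b'.r = 2 * k ∨ b'.r = 2 * k + 1 := by omega
  refine ⟨by omega, fun z t hz hT => ?_, fun A B hU => ?_, fun A B hL => ?_⟩
  · simp only [Shift1] at hT
    rcases h with h | h <;> rcases hT with hT | hT | hT | hT | hT | hT <;> omega
  · simp only [Upper] at *
    have hU : A ≤ a'.p + a'.r ∧ (-1 ≤ a.p ∧ -1 ≤ a.q ∧ B ≤ a'.q + a'.r ∨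
      a.q ≤ -2 ∧ B ≤ a'.p - a'.q - 4) := by omega
    rcases hk with hk | hk
    · right; right; left
      rcases h with h | h <;> omega
    · right; right; right; right; left
      rcases h with h | h <;> omega
  · simp only [Lower] at *
    rcases h with h | h <;> omega

lemma gap_refl1_of_edge3 (hvb : b.Valid)
    (ha : a.p ≤ -2 ∧ -1 ≤ a.r ∨ a.r ≤ -2 ∧ 0 ≤ a.q)
    (ha' : a'.p = a.p - 1 ∧ a'.q = a.q + 1 ∧ a'.r = a.r)
    (hb : -1 ≤ b.p ∧ -1 ≤ b.q ∧ -1 ≤ b.r)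
    (hb' : b'.p = b.p + 1 ∧ b'.q = b.q ∧ b'.r = b.r + 1)
    (h : Edge3 a b ∨ Edge3 a' b') : Gap Shift1 a' b' (refl1 (b'.p / 2) b') := by
  generalize hk : b'.p / 2 = k
  simp only [Gap, Edge3, Up, Valid, refl1, Ne, Alc.ext_iff] at *
  replace hk : b'.p = 2 * k ∨ b'.p = 2 * k + 1 := by omega
  refine ⟨by omega, fun z t hz hT => ?_, fun A B hU => ?_, fun A B hL => ?_⟩
  · simp only [Shift1] at hT
    rcases h with h | h <;> rcases hT with hT | hT | hT | hT | hT | hT <;> omega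
  · simp only [Upper] at *
    have hU : A ≤ a'.q - a'.p - 4 ∧ (-1 ≤ a.r ∧ B ≤ a'.q + a'.r ∨
      a.r ≤ -2 ∧ B ≤ -a'.p - a'.r - 5) := by omega
    rcases hk with hk | hk
    · left
      rcases h with h | h <;> omega
    · right; left
      rcases h with h | h <;> omega
  · simp only [Lower] at *
    rcases h with h | h <;> omega

lemma gap_refl2_of_edge3 (hvb : b.Valid)
    (ha : a.p ≤ -2 ∧ -1 ≤ a.r ∨ a.r ≤ -2 ∧ 0 ≤ a.q)
    (ha' : a'.p = a.p - 1 ∧ a'.q = a.q + 1 ∧ a'.r = a.r)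
    (hb : b.p ≤ -1 ∧ b.q ≤ -1 ∧ b.r ≤ -2)
    (hb' : b'.p = b.p ∧ b'.q = b.q - 1 ∧ b'.r = b.r - 1)
    (h : Edge3 a b ∨ Edge3 a' b') : Gap Shift1 a' b' (refl2 ((b'.q + 1) / 2) b') := by
  generalize hk : (b'.q + 1) / 2 = k
  simp only [Gap, Edge3, Up, Valid, refl2, Ne, Alc.ext_iff] at *
  replace hk : b'.q + 1 = 2 * k ∨ b'.q = 2 * k := by omega
  refine ⟨by omega, fun z t hz hT => ?_, fun A B hU => ?_, fun A B hL => ?_⟩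
  · simp only [Shift1] at hT
    rcases h with h | h <;> rcases hT with hT | hT | hT | hT | hT | hT <;> omega
  · simp only [Upper] at *
    have hU : A ≤ a'.q - a'.p - 4 ∧ (-1 ≤ a.r ∧ B ≤ a'.q + a'.r ∨
      a.r ≤ -2 ∧ B ≤ -a'.p - a'.r - 5) := by omega
    rcases hk with hk | hk
    · right; right; right; left
      rcases h with h | h <;> omega
    · right; right; right; right; right
      rcases h with h | h <;> omega
  · simp only [Lower] at *
    rcases h with h | h <;> omega

lemma gap_refl3_of_edge1 (hvb : b.Valid)
    (ha : a.r ≤ -2 ∧ (a.p ≤ -1 ∧ a.q ≤ -1 ∨ 0 ≤ a.p))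
    (ha' : a'.p = a.p ∧ a'.q = a.q - 1 ∧ a'.r = a.r - 1)
    (hb : b.q ≤ -2 ∧ -1 ≤ b.r)
    (hb' : b'.p = b.p + 1 ∧ b'.q = b.q ∧ b'.r = b.r + 1)
    (h : Edge1 a b ∨ Edge1 a' b') : Gap Shift1 a' b' (refl3 (b'.r / 2) b') := by
  generalize hk : b'.r / 2 = k
  simp only [Gap, Edge1, Up, Valid, refl3, Ne, Alc.ext_iff] at *
  replace hk : b'.r = 2 * k ∨ b'.r = 2 * k + 1 := by omega
  refine ⟨by omega, fun z t hz hT => ?_, fun A B hU => ?_, fun A B hL => ?_⟩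
  · simp only [Shift1] at hT
    rcases h with h | h <;> rcases hT with hT | hT | hT | hT | hT | hT <;> omega
  · simp only [Upper] at *
    have hU : A ≤ -a'.q - a'.r - 5 ∧ (a.p ≤ -1 ∧ B ≤ -a'.p - a'.r - 5 ∨
      0 ≤ a.p ∧ B ≤ a'.p - a'.q - 4) := by omega
    rcases hk with hk | hk
    · right; right; left
      rcases h with h | h <;> omega
    · right; right; right; right; left
      rcases h with h | h <;> omega
  · simp only [Lower] at *
    rcases h with h | h <;> omega

lemma gap_refl2_of_edge1 (hvb : b.Valid)
    (ha : a.r ≤ -2 ∧ (a.p ≤ -1 ∧ a.q ≤ -1 ∨ 0 ≤ a.p))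
    (ha' : a'.p = a.p ∧ a'.q = a.q - 1 ∧ a'.r = a.r - 1)
    (hb : b.r ≤ -2 ∧ 0 ≤ b.q)
    (hb' : b'.p = b.p - 1 ∧ b'.q = b.q + 1 ∧ b'.r = b.r)
    (h : Edge1 a b ∨ Edge1 a' b') : Gap Shift1 a' b' (refl2 ((b'.q + 1) / 2) b') := by
  generalize hk : (b'.q + 1) / 2 = k
  simp only [Gap, Edge1, Up, Valid, refl2, Ne, Alc.ext_iff] at *
  replace hk : b'.q + 1 = 2 * k ∨ b'.q = 2 * k := by omega
  refine ⟨by omega, fun z t hz hT => ?_, fun A B hU => ?_, fun A B hL => ?_⟩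
  · simp only [Shift1] at hT
    rcases h with h | h <;> rcases hT with hT | hT | hT | hT | hT | hT <;> omega
  · simp only [Upper] at *
    have hU : A ≤ -a'.q - a'.r - 5 ∧ (a.p ≤ -1 ∧ B ≤ -a'.p - a'.r - 5 ∨
      0 ≤ a.p ∧ B ≤ a'.p - a'.q - 4) := by omega
    rcases hk with hk | hk
    · right; right; right; left
      rcases h with h | h <;> omega
    · right; right; right; right; right
      rcases h with h | h <;> omega
  · simp only [Lower] at *
    rcases h with h | h <;> omega

end Gap
lemma Shift1.cases {z t : Alc} (hv : z.Valid) (hz : z ≠ ⟨-1, -1, -1⟩) (h : Shift1 z t) :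
    ((-1 ≤ z.p ∧ -1 ≤ z.q ∨ z.q ≤ -2) ∧ -1 ≤ z.r) ∧ t.p = z.p + 1 ∧ t.q = z.q ∧ t.r = z.r + 1 ∨
    (z.p ≤ -2 ∧ -1 ≤ z.r ∨ z.r ≤ -2 ∧ 0 ≤ z.q) ∧ t.p = z.p - 1 ∧ t.q = z.q + 1 ∧ t.r = z.r ∨
    (z.r ≤ -2 ∧ (z.p ≤ -1 ∧ z.q ≤ -1 ∨ 0 ≤ z.p)) ∧ t.p = z.p ∧ t.q = z.q - 1 ∧ t.r = z.r - 1 := by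
  simp only [Shift1, Valid, Ne, Alc.ext_iff] at *
  rcases h with h | h | h | h | h | h <;> omega

set_option maxHeartbeats 2000000 in
lemma Shift1.edge_iff_or_gap {a b a' b' : Alc} (hva : a.Valid) (hvb : b.Valid)
    (hna : a ≠ ⟨-1, -1, -1⟩) (hnb : b ≠ ⟨-1, -1, -1⟩) (hTa : Shift1 a a') (hTb : Shift1 b b') :
    (Edge a b ↔ Edge a' b') ∨ ∃ c, Gap Shift1 a' b' c := by
  have key : (Edge1 a b ↔ Edge1 a' b') → (Edge2 a b ↔ Edge2 a' b') →
      (Edge3 a b ↔ Edge3 a' b') → (Edge a b ↔ Edge a' b') := by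
    unfold Edge; tauto
  rcases hTa.cases hva hna with ⟨ha, ha'⟩ | ⟨ha, ha'⟩ | ⟨ha, ha'⟩ <;>
    rcases hTb.cases hvb hnb with ⟨hb, hb'⟩ | ⟨hb, hb'⟩ | ⟨hb, hb'⟩
  · exact .inl (key (by simp only [Edge1, Up, Valid] at *; omega)
      (by simp only [Edge2, Up, Valid] at *; omega) (by simp only [Edge3, Up, Valid] at *; omega))
  · by_cases h : Edge2 a b ∨ Edge2 a' b'
    · exact .inr ⟨_, gap_refl1_of_edge2 hvb ha ha'
        (by simp only [Edge2, Up, Valid] at *; omega) hb' h⟩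
    · exact .inl (key (by simp only [Edge1, Up, Valid] at *; omega)
        (by tauto)
        (by simp only [Edge3, Up, Valid] at *; omega))
  · by_cases h : Edge2 a b ∨ Edge2 a' b'
    · exact .inr ⟨_, gap_refl3_of_edge2 hvb ha ha'
        (by simp only [Edge2, Up, Valid] at *; omega) hb' h⟩
    · exact .inl (key (by simp only [Edge1, Up, Valid] at *; omega)
        (by tauto)
        (by simp only [Edge3, Up, Valid] at *; omega))
  · by_cases h : Edge3 a b ∨ Edge3 a' b'
    · exact .inr ⟨_, gap_refl1_of_edge3 hvb ha ha'
        (by simp only [Edge3, Up, Valid] at *; omega) hb' h⟩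
    · exact .inl (key (by simp only [Edge1, Up, Valid] at *; omega)
        (by simp only [Edge2, Up, Valid] at *; omega)
        (by tauto))
  · exact .inl (key (by simp only [Edge1, Up, Valid] at *; omega)
      (by simp only [Edge2, Up, Valid] at *; omega) (by simp only [Edge3, Up, Valid] at *; omega))
  · by_cases h : Edge3 a b ∨ Edge3 a' b'
    · exact .inr ⟨_, gap_refl2_of_edge3 hvb ha ha'
        (by simp only [Edge3, Up, Valid] at *; omega) hb' h⟩
    · exact .inl (key (by simp only [Edge1, Up, Valid] at *; omega)
        (by simp only [Edge2, Up, Valid] at *; omega)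
        (by tauto))
  · by_cases h : Edge1 a b ∨ Edge1 a' b'
    · exact .inr ⟨_, gap_refl3_of_edge1 hvb ha ha'
        (by simp only [Edge1, Up, Valid] at *; omega) hb' h⟩
    · exact .inl (key (by tauto)
        (by simp only [Edge2, Up, Valid] at *; omega)
        (by simp only [Edge3, Up, Valid] at *; omega))
  · by_cases h : Edge1 a b ∨ Edge1 a' b'
    · exact .inr ⟨_, gap_refl2_of_edge1 hvb ha ha'
        (by simp only [Edge1, Up, Valid] at *; omega) hb' h⟩
    · exact .inl (key (by tauto)
        (by simp only [Edge2, Up, Valid] at *; omega)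
        (by simp only [Edge3, Up, Valid] at *; omega))
  · exact .inl (key (by simp only [Edge1, Up, Valid] at *; omega)
      (by simp only [Edge2, Up, Valid] at *; omega) (by simp only [Edge3, Up, Valid] at *; omega))

lemma isShift_shift1 : IsShift Shift1 where
  injective := fun _ => Shift1.injective
  valid := Shift1.valid
  dom := Shift1.dom
  lower := fun hy hd _ => Shift1.lower hy hd
  upper := Shift1.upper
  edge_iff_or_gap := Shift1.edge_iff_or_gap

/-- The involution exchanging `α₁` and `α₂`. -/
def swap (a : Alc) : Alc := ⟨a.q, a.p, a.r⟩

lemma swap_valid {a : Alc} : a.swap.Valid ↔ a.Valid := by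
  simp only [Valid, swap]
  omega

lemma swap_dom {a : Alc} : a.swap.Dom ↔ a.Dom := and_comm

lemma swap_edge {a b : Alc} : Edge a.swap b.swap ↔ Edge a b := by
  have h1 : Edge1 a.swap b.swap ↔ Edge2 a b := Iff.rfl
  have h2 : Edge2 a.swap b.swap ↔ Edge1 a b := Iff.rfl
  have h3 : Edge3 a.swap b.swap ↔ Edge3 a b := by
    simp only [Edge3, Up, swap]
    omega
  unfold Edge
  tauto

lemma swap_lower {A B : ℤ} {z : Alc} : Lower A B z.swap ↔ Lower B A z := by
  simp only [Lower, swap]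
  tauto

lemma swap_upper {A B : ℤ} {z : Alc} : Upper A B z.swap ↔ Upper B A z := by
  simp only [Upper, swap]
  constructor <;> rintro (h | h | h | h | h | h)
  all_goals first
    | exact .inl ⟨by omega, by omega⟩
    | exact .inr (.inl ⟨by omega, by omega⟩)
    | exact .inr (.inr (.inl ⟨by omega, by omega⟩))
    | exact .inr (.inr (.inr (.inl ⟨by omega, by omega⟩)))
    | exact .inr (.inr (.inr (.inr (.inl ⟨by omega, by omega⟩))))
    | exact .inr (.inr (.inr (.inr (.inr ⟨by omega, by omega⟩))))

lemma swap_ne {a : Alc} (h : a ≠ ⟨-1, -1, -1⟩) : a.swap ≠ ⟨-1, -1, -1⟩ :=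
  fun h' => h (congrArg swap h')

lemma Gap.swap {T : Alc → Alc → Prop} {a b c : Alc} (h : Gap T a.swap b.swap c) :
    Gap (fun z t => T z.swap t.swap) a b c.swap :=
  ⟨swap_valid.2 h.1,
    fun _ _ hz hT ht => h.2.1 _ _ (swap_valid.2 hz) hT (congrArg Alc.swap ht),
    fun _ _ hU => swap_upper.2 (h.2.2.1 _ _ (swap_upper.2 hU)),
    fun _ _ hL => swap_lower.2 (h.2.2.2 _ _ (swap_lower.2 hL))⟩

lemma IsShift.swap {T : Alc → Alc → Prop} (h : IsShift T) :
    IsShift (fun z t => T z.swap t.swap) where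
  injective hz hz' hT hT' := congrArg Alc.swap
    (h.injective (swap_valid.2 hz) (swap_valid.2 hz') hT hT')
  valid hz hT := swap_valid.1 (h.valid (swap_valid.2 hz) hT)
  dom hz hd hT := swap_dom.1 (h.dom (swap_valid.2 hz) (swap_dom.2 hd) hT)
  lower hy hd hz hT hT' hL := swap_lower.1 (h.lower (swap_valid.2 hy) (swap_dom.2 hd)
    (swap_valid.2 hz) hT hT' (swap_lower.2 hL))
  upper hx hd hz hT hT' hU := swap_upper.1 (h.upper (swap_valid.2 hx) (swap_dom.2 hd)
    (swap_valid.2 hz) hT hT' (swap_upper.2 hU))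
  edge_iff_or_gap ha hb hna hnb hTa hTb := by
    rcases h.edge_iff_or_gap (swap_valid.2 ha) (swap_valid.2 hb) (swap_ne hna) (swap_ne hnb)
      hTa hTb with h | ⟨c, hc⟩
    · exact .inl (by rwa [swap_edge, swap_edge] at h)
    · exact .inr ⟨_, hc.swap⟩

end Alc

/-- The barycenter of an alcove. -/
def Alc.bary (a : Alc) : E2 := ((a.p + a.r + 1) / 3, (a.q + a.r + 1) / 3)

lemma Alc.B2_a1_bary (a : Alc) : B2 a1 a.bary = (2 * a.p - a.q + a.r + 1) / 3 := by
  simp only [B2, a1, Alc.bary]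
  ring

lemma Alc.B2_a2_bary (a : Alc) : B2 a2 a.bary = (2 * a.q - a.p + a.r + 1) / 3 := by
  simp only [B2, a2, Alc.bary]
  ring

lemma Alc.B2_rho2_bary (a : Alc) : B2 rho2 a.bary = (a.p + a.q + 2 * a.r + 2) / 3 := by
  simp only [B2, rho2, Alc.bary]
  ring

lemma Alc.reflE_a1_bary (a : Alc) (k : ℤ) : reflE a1 k a.bary = (a.refl1 k).bary := by
  rw [reflE, a.B2_a1_bary]
  ext <;> simp [a1, Alc.bary, Alc.refl1] <;> ring

lemma Alc.reflE_a2_bary (a : Alc) (k : ℤ) : reflE a2 k a.bary = (a.refl2 k).bary := by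
  rw [reflE, a.B2_a2_bary]
  ext <;> simp [a2, Alc.bary, Alc.refl2] <;> ring

lemma Alc.reflE_rho2_bary (a : Alc) (k : ℤ) : reflE rho2 k a.bary = (a.refl3 k).bary := by
  rw [reflE, a.B2_rho2_bary]
  ext <;> simp [rho2, Alc.bary, Alc.refl3] <;> ring

lemma Alc.refl1_valid {a : Alc} (ha : a.Valid) (k : ℤ) : (a.refl1 k).Valid := by
  simp only [Alc.Valid, Alc.refl1] at *
  omega

lemma Alc.refl2_valid {a : Alc} (ha : a.Valid) (k : ℤ) : (a.refl2 k).Valid := by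
  simp only [Alc.Valid, Alc.refl2] at *
  omega

lemma Alc.refl3_valid {a : Alc} (ha : a.Valid) (k : ℤ) : (a.refl3 k).Valid := by
  simp only [Alc.Valid, Alc.refl3] at *
  omega

/-- `f` is the reflection of the plane in one of the lines `H_{α,k}`. -/
def IsAffineReflection (f : E2 → E2) : Prop :=
  ∃ k : ℤ, f = reflE a1 k ∨ f = reflE a2 k ∨ f = reflE rho2 k

lemma IsAffineReflection.conj_a1 {f : E2 → E2} (h : IsAffineReflection f) :
    IsAffineReflection (reflE a1 0 ∘ f ∘ reflE a1 0) := by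
  obtain ⟨k, rfl | rfl | rfl⟩ := h
  · refine ⟨-k, .inl ?_⟩
    ext v <;> simp [reflE, B2, a1]
    ring
  · refine ⟨k, .inr (.inr ?_)⟩
    ext v <;> simp [reflE, B2, a1, a2, rho2]
    ring
  · refine ⟨k, .inr (.inl ?_)⟩
    ext v <;> simp [reflE, B2, a1, a2, rho2] <;> ring

lemma IsAffineReflection.conj_a2 {f : E2 → E2} (h : IsAffineReflection f) :
    IsAffineReflection (reflE a2 0 ∘ f ∘ reflE a2 0) := by
  obtain ⟨k, rfl | rfl | rfl⟩ := h
  · refine ⟨k, .inr (.inr ?_)⟩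
    ext v <;> simp [reflE, B2, a1, a2, rho2] <;> ring
  · refine ⟨-k, .inr (.inl ?_)⟩
    ext v <;> simp [reflE, B2, a2]
    ring
  · refine ⟨k, .inl ?_⟩
    ext v <;> simp [reflE, B2, a1, a2, rho2] <;> ring

lemma IsAffineReflection.conj_rho2 {f : E2 → E2} (h : IsAffineReflection f) :
    IsAffineReflection (reflE rho2 (-1) ∘ f ∘ reflE rho2 (-1)) := by
  obtain ⟨k, rfl | rfl | rfl⟩ := h
  · refine ⟨-1 - k, .inr (.inl ?_)⟩
    ext v <;> simp [reflE, B2, a1, a2, rho2] <;> ring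
  · refine ⟨-1 - k, .inl ?_⟩
    ext v <;> simp [reflE, B2, a1, a2, rho2] <;> ring
  · refine ⟨-2 - k, .inr (.inr ?_)⟩
    ext v <;> simp [reflE, B2, rho2] <;> ring

/-- The action of `W` on the plane is the standard one on generators. -/
structure IsAffineAction {W : Type*} [Group W] {M : CoxeterMatrix (Fin 3)}
    (cs : CoxeterSystem M W) (act : W →* Equiv.Perm E2) : Prop where
  simple_zero : ⇑(act (cs.simple 0)) = reflE rho2 (-1)
  simple_one : ⇑(act (cs.simple 1)) = reflE a1 0
  simple_two : ⇑(act (cs.simple 2)) = reflE a2 0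

section Action

variable {W : Type*} [Group W] {M : CoxeterMatrix (Fin 3)} {cs : CoxeterSystem M W}
  {act : W →* Equiv.Perm E2}

lemma act_simple_conj (t : W) (i : Fin 3) :
    ⇑(act (cs.simple i * t * (cs.simple i)⁻¹)) =
      act (cs.simple i) ∘ act t ∘ act (cs.simple i) := by
  rw [cs.inv_simple, map_mul, map_mul]
  rfl

lemma IsAffineAction.isAffineReflection (h : IsAffineAction cs act) {t : W}
    (ht : cs.IsReflection t) : IsAffineReflection (act t) := by
  obtain ⟨w, i, rfl⟩ := ht
  induction w using cs.simple_induction_left with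
  | one =>
    simp only [one_mul, inv_one, mul_one]
    fin_cases i
    · exact ⟨-1, .inr (.inr (by simpa using h.simple_zero))⟩
    · exact ⟨0, .inl (by simpa using h.simple_one)⟩
    · exact ⟨0, .inr (.inl (by simpa using h.simple_two))⟩
  | mul_simple_left w j ih =>
    have e : cs.simple j * w * cs.simple i * (cs.simple j * w)⁻¹ =
        cs.simple j * (w * cs.simple i * w⁻¹) * (cs.simple j)⁻¹ := by group
    rw [e, act_simple_conj]
    fin_cases j
    · simpa only [Fin.zero_eta, h.simple_zero] using ih.conj_rho2
    · simpa only [Fin.mk_one, h.simple_one] using ih.conj_a1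
    · simpa only [Fin.reduceFinMk, h.simple_two] using ih.conj_a2

end Action

/-- The alcove of `w`. -/
def alcOf {W : Type*} [Group W] (act : W →* Equiv.Perm E2) (w : W) : Alc :=
  ⟨⌊B2 a1 (cen act w)⌋, ⌊B2 a2 (cen act w)⌋, ⌊B2 rho2 (cen act w)⌋⟩

lemma Alc.floor_bary {a : Alc} (ha : a.Valid) :
    (⟨⌊B2 a1 a.bary⌋, ⌊B2 a2 a.bary⌋, ⌊B2 rho2 a.bary⌋⟩ : Alc) = a := by
  rw [a.B2_a1_bary, a.B2_a2_bary, a.B2_rho2_bary]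
  obtain ⟨p, q, r⟩ := a
  simp only [Alc.Valid] at ha
  simp only [Alc.mk.injEq, Int.floor_eq_iff]
  rcases ha with rfl | rfl <;> push_cast <;> refine ⟨⟨?_, ?_⟩, ⟨?_, ?_⟩, ?_, ?_⟩ <;> linarith

/-- The reflections of alcoves given by the generators of `W`. -/
def Alc.simpleRefl (i : Fin 3) : Alc → Alc := ![refl3 (-1), refl1 0, refl2 0] i

lemma Alc.simpleRefl_valid {a : Alc} (ha : a.Valid) (i : Fin 3) : (a.simpleRefl i).Valid := by
  fin_cases i
  exacts [refl3_valid ha _, refl1_valid ha _, refl2_valid ha _]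

lemma Alc.simpleRefl_simpleRefl (a : Alc) (i : Fin 3) : (a.simpleRefl i).simpleRefl i = a := by
  fin_cases i <;> simp [simpleRefl, refl1, refl2, refl3]

lemma Alc.len_simpleRefl_le (a : Alc) (i : Fin 3) : (a.simpleRefl i).len ≤ a.len + 1 := by
  fin_cases i <;> simp [simpleRefl, refl1, refl2, refl3, len] <;> omega

lemma Alc.exists_len_simpleRefl {a : Alc} (ha : a.Valid) (h : a ≠ ⟨-1, -1, -1⟩) :
    ∃ i, (a.simpleRefl i).len + 1 = a.len := by
  have h' : 0 ≤ a.p ∨ 0 ≤ a.q ∨ a.r ≤ -2 := by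
    simp only [Alc.Valid, Ne, Alc.ext_iff] at *
    omega
  unfold Alc.Valid at ha
  rcases h' with h' | h' | h'
  · exact ⟨1, by simp [simpleRefl, refl1, len]; omega⟩
  · exact ⟨2, by simp [simpleRefl, refl2, len]; omega⟩
  · exact ⟨0, by simp [simpleRefl, refl3, len]; omega⟩

section Action

variable {W : Type*} [Group W] {M : CoxeterMatrix (Fin 3)} {cs : CoxeterSystem M W}
  {act : W →* Equiv.Perm E2}

lemma cen_mul (t w : W) : cen act (t * w) = act t (cen act w) := by
  rw [cen, map_mul]
  rfl

lemma alcOf_eq {a : Alc} {w : W} (ha : a.Valid) (h : cen act w = a.bary) : alcOf act w = a := by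
  rw [alcOf, h, Alc.floor_bary ha]

lemma alcOf_one : alcOf act 1 = ⟨-1, -1, -1⟩ := by
  refine alcOf_eq (.inr rfl) ?_
  rw [cen, map_one]
  ext <;> simp [Alc.bary, rho2] <;> norm_num

namespace IsAffineAction

lemma act_simple_bary (h : IsAffineAction cs act) (i : Fin 3) (a : Alc) :
    act (cs.simple i) a.bary = (a.simpleRefl i).bary := by
  fin_cases i
  · exact (congrFun h.simple_zero _).trans (by exact_mod_cast a.reflE_rho2_bary (-1))
  · exact (congrFun h.simple_one _).trans (by exact_mod_cast a.reflE_a1_bary 0)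
  · exact (congrFun h.simple_two _).trans (by exact_mod_cast a.reflE_a2_bary 0)

lemma exists_cen_eq (h : IsAffineAction cs act) (w : W) :
    ∃ a : Alc, a.Valid ∧ cen act w = a.bary := by
  induction w using cs.simple_induction_left with
  | one =>
    refine ⟨⟨-1, -1, -1⟩, .inr rfl, ?_⟩
    rw [cen, map_one]
    ext <;> simp [Alc.bary, rho2] <;> norm_num
  | mul_simple_left w i ih =>
    obtain ⟨a, ha, haw⟩ := ih
    exact ⟨a.simpleRefl i, Alc.simpleRefl_valid ha i, by rw [cen_mul, haw, h.act_simple_bary]⟩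

lemma alcOf_valid (h : IsAffineAction cs act) (w : W) : (alcOf act w).Valid := by
  obtain ⟨a, ha, haw⟩ := h.exists_cen_eq w
  rwa [alcOf_eq ha haw]

lemma cen_eq (h : IsAffineAction cs act) (w : W) : cen act w = (alcOf act w).bary := by
  obtain ⟨a, ha, haw⟩ := h.exists_cen_eq w
  rwa [alcOf_eq ha haw]

lemma alcOf_simple_mul (h : IsAffineAction cs act) (i : Fin 3) (w : W) :
    alcOf act (cs.simple i * w) = (alcOf act w).simpleRefl i :=
  alcOf_eq (Alc.simpleRefl_valid (h.alcOf_valid w) i) (by rw [cen_mul, h.cen_eq, h.act_simple_bary])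

lemma alcOf_injective (h : IsAffineAction cs act) (hcen : Function.Injective (cen act)) :
    Function.Injective (alcOf act) := fun a b hab =>
  hcen (by rw [h.cen_eq, h.cen_eq, hab])

lemma alcOf_mul_of_a1 (h : IsAffineAction cs act) {t : W} {k : ℤ} (ht : ⇑(act t) = reflE a1 k)
    (w : W) : alcOf act (t * w) = (alcOf act w).refl1 k :=
  alcOf_eq (Alc.refl1_valid (h.alcOf_valid w) k)
    (by rw [cen_mul, ht, h.cen_eq, Alc.reflE_a1_bary])

lemma alcOf_mul_of_a2 (h : IsAffineAction cs act) {t : W} {k : ℤ} (ht : ⇑(act t) = reflE a2 k)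
    (w : W) : alcOf act (t * w) = (alcOf act w).refl2 k :=
  alcOf_eq (Alc.refl2_valid (h.alcOf_valid w) k)
    (by rw [cen_mul, ht, h.cen_eq, Alc.reflE_a2_bary])

lemma alcOf_mul_of_rho2 (h : IsAffineAction cs act) {t : W} {k : ℤ}
    (ht : ⇑(act t) = reflE rho2 k) (w : W) : alcOf act (t * w) = (alcOf act w).refl3 k :=
  alcOf_eq (Alc.refl3_valid (h.alcOf_valid w) k)
    (by rw [cen_mul, ht, h.cen_eq, Alc.reflE_rho2_bary])

lemma exists_alcOf_eq (h : IsAffineAction cs act) {a : Alc} (ha : a.Valid) :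
    ∃ w, alcOf act w = a := by
  induction hn : a.len using Nat.strong_induction_on generalizing a with
  | _ n ih =>
    by_cases h1 : a = ⟨-1, -1, -1⟩
    · exact ⟨1, alcOf_one.trans h1.symm⟩
    obtain ⟨i, hi⟩ := Alc.exists_len_simpleRefl ha h1
    obtain ⟨w, hw⟩ := ih _ (by omega) (Alc.simpleRefl_valid ha i) rfl
    exact ⟨cs.simple i * w, by rw [h.alcOf_simple_mul, hw, Alc.simpleRefl_simpleRefl]⟩

lemma len_alcOf (h : IsAffineAction cs act) (hcen : Function.Injective (cen act)) (w : W) :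
    (alcOf act w).len = cs.length w := by
  refine le_antisymm ?_ ?_
  · induction hn : cs.length w using Nat.strong_induction_on generalizing w with
    | _ n ih =>
      by_cases h1 : w = 1
      · subst h1
        rw [alcOf_one]
        exact Nat.zero_le _
      obtain ⟨i, hi⟩ := cs.exists_leftDescent_of_ne_one h1
      rw [cs.isLeftDescent_iff] at hi
      have h2 := ih _ (by omega) (cs.simple i * w) rfl
      have h3 := ((alcOf act w).simpleRefl i).len_simpleRefl_le i
      rw [Alc.simpleRefl_simpleRefl] at h3
      rw [h.alcOf_simple_mul] at h2
      omega
  · induction hn : (alcOf act w).len using Nat.strong_induction_on generalizing w with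
    | _ n ih =>
      by_cases h1 : alcOf act w = ⟨-1, -1, -1⟩
      · rw [h.alcOf_injective hcen (h1.trans alcOf_one.symm), cs.length_one]
        exact Nat.zero_le _
      obtain ⟨i, hi⟩ := Alc.exists_len_simpleRefl (h.alcOf_valid w) h1
      rw [← h.alcOf_simple_mul] at hi
      have h2 := ih _ (by omega) (cs.simple i * w) rfl
      rcases cs.length_simple_mul w i with h3 | h3 <;> omega

lemma exists_isReflection_conj_simple {t : W} (ht : cs.IsReflection t) (i : Fin 3)
    {f : E2 → E2} (hf : f = act (cs.simple i) ∘ act t ∘ act (cs.simple i)) :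
    ∃ t, cs.IsReflection t ∧ ⇑(act t) = f :=
  ⟨_, ht.conj (cs.simple i), (act_simple_conj t i).trans hf.symm⟩

lemma exists_rho2 (h : IsAffineAction cs act) (k : ℤ) :
    ∃ t, cs.IsReflection t ∧ ⇑(act t) = reflE rho2 k := by
  have neg (k : ℤ) : (∃ t, cs.IsReflection t ∧ ⇑(act t) = reflE rho2 k) →
      ∃ t, cs.IsReflection t ∧ ⇑(act t) = reflE rho2 (-k : ℤ) := by
    rintro ⟨t, ht, hk⟩
    obtain ⟨t, ht, hk⟩ : ∃ t, cs.IsReflection t ∧ ⇑(act t) = reflE a2 k :=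
      exists_isReflection_conj_simple ht 1 <| by
        rw [hk, h.simple_one]
        ext v <;> simp [reflE, B2, a1, a2, rho2] <;> ring
    obtain ⟨t, ht, hk⟩ : ∃ t, cs.IsReflection t ∧ ⇑(act t) = reflE a2 (-k : ℤ) :=
      exists_isReflection_conj_simple ht 2 <| by
        rw [hk, h.simple_two]
        ext v <;> simp [reflE, B2, a2]
        ring
    exact exists_isReflection_conj_simple ht 1 <| by
      rw [hk, h.simple_one]
      ext v <;> simp [reflE, B2, a1, a2, rho2]
      ring
  have sub (k : ℤ) : (∃ t, cs.IsReflection t ∧ ⇑(act t) = reflE rho2 k) →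
      ∃ t, cs.IsReflection t ∧ ⇑(act t) = reflE rho2 (-2 - k : ℤ) := by
    rintro ⟨t, ht, hk⟩
    exact exists_isReflection_conj_simple ht 0 <| by
      rw [hk, h.simple_zero]
      ext v <;> simp [reflE, B2, rho2] <;> ring
  have zero : ∃ t, cs.IsReflection t ∧ ⇑(act t) = reflE rho2 (0 : ℤ) :=
    exists_isReflection_conj_simple (cs.isReflection_simple 2) 1 <| by
      rw [h.simple_one, h.simple_two]
      ext v <;> simp [reflE, B2, a1, a2, rho2]
      ring
  have negOne : ∃ t, cs.IsReflection t ∧ ⇑(act t) = reflE rho2 (-1 : ℤ) :=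
    ⟨_, cs.isReflection_simple 0, by exact_mod_cast h.simple_zero⟩
  have key (n : ℕ) : ∃ t, cs.IsReflection t ∧ ⇑(act t) = reflE rho2 (n : ℤ) := by
    induction n using Nat.twoStepInduction with
    | zero => exact zero
    | one => exact neg _ negOne
    | more n ih _ =>
      have := neg _ (sub _ ih)
      rwa [show -(-2 - (n : ℤ)) = ((n + 2 : ℕ) : ℤ) by push_cast; ring] at this
  obtain ⟨n, rfl | rfl⟩ := k.eq_nat_or_neg
  · exact key n
  · exact neg _ (key n)

lemma exists_a1 (h : IsAffineAction cs act) (k : ℤ) :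
    ∃ t, cs.IsReflection t ∧ ⇑(act t) = reflE a1 k := by
  obtain ⟨t, ht, hk⟩ := h.exists_rho2 k
  exact exists_isReflection_conj_simple ht 2 <| by
    rw [hk, h.simple_two]
    ext v <;> simp [reflE, B2, a1, a2, rho2] <;> ring

lemma exists_a2 (h : IsAffineAction cs act) (k : ℤ) :
    ∃ t, cs.IsReflection t ∧ ⇑(act t) = reflE a2 k := by
  obtain ⟨t, ht, hk⟩ := h.exists_rho2 k
  exact exists_isReflection_conj_simple ht 1 <| by
    rw [hk, h.simple_one]
    ext v <;> simp [reflE, B2, a1, a2, rho2] <;> ring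

lemma edge_iff (h : IsAffineAction cs act) (hcen : Function.Injective (cen act)) {a b : W} :
    Alc.Edge (alcOf act a) (alcOf act b) ↔
      (∃ t, cs.IsReflection t ∧ b = t * a) ∧ cs.length a < cs.length b := by
  have hv := h.alcOf_valid a
  constructor
  · intro he
    refine ⟨?_, by simpa only [h.len_alcOf hcen] using he.len_lt hv⟩
    obtain ⟨k, ⟨hk, -⟩ | ⟨hk, -⟩ | ⟨hk, -⟩⟩ := Alc.edge_iff.1 he
    · obtain ⟨t, ht, htk⟩ := h.exists_a1 k
      exact ⟨t, ht, h.alcOf_injective hcen (hk.trans (h.alcOf_mul_of_a1 htk a).symm)⟩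
    · obtain ⟨t, ht, htk⟩ := h.exists_a2 k
      exact ⟨t, ht, h.alcOf_injective hcen (hk.trans (h.alcOf_mul_of_a2 htk a).symm)⟩
    · obtain ⟨t, ht, htk⟩ := h.exists_rho2 k
      exact ⟨t, ht, h.alcOf_injective hcen (hk.trans (h.alcOf_mul_of_rho2 htk a).symm)⟩
  · rintro ⟨⟨t, ht, rfl⟩, hl⟩
    rw [← h.len_alcOf hcen, ← h.len_alcOf hcen] at hl
    obtain ⟨k, hk | hk | hk⟩ := h.isAffineReflection ht
    · rw [h.alcOf_mul_of_a1 hk] at hl ⊢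
      exact Alc.edge_iff.2 ⟨k, .inl ⟨rfl, (Alc.len_refl1_lt_iff hv k).1 hl⟩⟩
    · rw [h.alcOf_mul_of_a2 hk] at hl ⊢
      exact Alc.edge_iff.2 ⟨k, .inr (.inl ⟨rfl, (Alc.len_refl2_lt_iff hv k).1 hl⟩)⟩
    · rw [h.alcOf_mul_of_rho2 hk] at hl ⊢
      exact Alc.edge_iff.2 ⟨k, .inr (.inr ⟨rfl, (Alc.len_refl3_lt_iff hv k).1 hl⟩)⟩

lemma le_iff_bruhatLE (h : IsAffineAction cs act) (hcen : Function.Injective (cen act)) {a b : W} :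
    Alc.Le (alcOf act a) (alcOf act b) ↔ bruhatLE cs a b := by
  have e : bruhatLE cs a b ↔ Relation.ReflTransGen
      (fun a b => (∃ t, cs.IsReflection t ∧ b = t * a) ∧ cs.length a < cs.length b) a b := by
    rw [Relation.reflTransGen_iff_eq_or_transGen, eq_comm]
    rfl
  rw [e]
  refine ⟨fun hab => ?_, fun hab =>
    Relation.ReflTransGen.lift (alcOf act) (fun _ _ => (h.edge_iff hcen).2) _ _ hab⟩
  clear e
  generalize hc : alcOf act b = c at hab
  induction hab generalizing b with
  | refl => rw [h.alcOf_injective hcen hc]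
  | tail hd he ih =>
    obtain ⟨d, rfl⟩ := h.exists_alcOf_eq (Alc.Le.valid hd (h.alcOf_valid a))
    subst hc
    exact (ih rfl).tail ((h.edge_iff hcen).1 he)

end IsAffineAction

end Action

lemma bruhatLE.trans {B W : Type*} [Group W] {M : CoxeterMatrix B} {cs : CoxeterSystem M W}
    {a b c : W} (hab : bruhatLE cs a b) (hbc : bruhatLE cs b c) : bruhatLE cs a c := by
  rcases hab with rfl | hab
  · exact hbc
  rcases hbc with rfl | hbc
  exacts [.inr hab, .inr (Relation.TransGen.trans hab hbc)]

section Geometry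

variable {W : Type*} [Group W] {M : CoxeterMatrix (Fin 3)} {cs : CoxeterSystem M W}
  {act : W →* Equiv.Perm E2} {a b : Alc} {w : W} {wi : E2}

lemma Alc.zone_of_zoneOf (ha : a.Valid) (hz : zoneOf cs w a.bary) :
    (w = 1 ∧ -1 ≤ a.p ∧ -1 ≤ a.q ∧ -1 ≤ a.r) ∨
    (w = cs.simple 1 ∧ a.p ≤ -2 ∧ -1 ≤ a.r) ∨
    (w = cs.simple 2 ∧ a.q ≤ -2 ∧ -1 ≤ a.r) ∨
    (w = cs.simple 1 * cs.simple 2 ∧ a.r ≤ -2 ∧ 0 ≤ a.q) ∨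
    (w = cs.simple 2 * cs.simple 1 ∧ a.r ≤ -2 ∧ 0 ≤ a.p) ∨
    (w = cs.simple 1 * cs.simple 2 * cs.simple 1 ∧ a.p ≤ -1 ∧ a.q ≤ -1) := by
  have cast_le {m n : ℤ} : (m : ℝ) / 3 ≤ n ↔ m ≤ 3 * n := by
    rw [div_le_iff₀' (by norm_num)]
    exact_mod_cast Iff.rfl
  have le_cast {m n : ℤ} : (n : ℝ) ≤ m / 3 ↔ 3 * n ≤ m := by
    rw [le_div_iff₀' (by norm_num)]
    exact_mod_cast Iff.rfl
  have e1 : B2 a1 a.bary = ((2 * a.p - a.q + a.r + 1 : ℤ) : ℝ) / 3 := by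
    rw [a.B2_a1_bary]
    push_cast
    rfl
  have e2 : B2 a2 a.bary = ((2 * a.q - a.p + a.r + 1 : ℤ) : ℝ) / 3 := by
    rw [a.B2_a2_bary]
    push_cast
    rfl
  have e3 : B2 rho2 a.bary = ((a.p + a.q + 2 * a.r + 2 : ℤ) : ℝ) / 3 := by
    rw [a.B2_rho2_bary]
    push_cast
    rfl
  have z0 : (0 : ℝ) = (0 : ℤ) := by norm_num
  have z1 : (-1 : ℝ) = (-1 : ℤ) := by norm_num
  simp only [zoneOf, Fid, Set.mem_ofPred_eq, e1, e2, e3, z0, z1, cast_le, le_cast] at hz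
  unfold Alc.Valid at ha
  refine hz.imp (And.imp_right fun h => ?_) <| Or.imp (And.imp_right fun h => ?_) <|
    Or.imp (And.imp_right fun h => ?_) <| Or.imp (And.imp_right fun h => ?_) <|
    Or.imp (And.imp_right fun h => ?_) (And.imp_right fun h => ?_) <;> omega

lemma Alc.of_bary_eq_add {m n : ℤ} (h : b.bary = a.bary + wi) (hm : wi.1 = m / 3)
    (hn : wi.2 = n / 3) : b.p + b.r = a.p + a.r + m ∧ b.q + b.r = a.q + a.r + n := by
  have h1 := congrArg Prod.fst h
  have h2 := congrArg Prod.snd h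
  simp only [Alc.bary, Prod.fst_add, Prod.snd_add, hm, hn] at h1 h2
  constructor
  · have : ((b.p + b.r : ℤ) : ℝ) = (a.p + a.r + m : ℤ) := by push_cast; linarith
    exact_mod_cast this
  · have : ((b.q + b.r : ℤ) : ℝ) = (a.q + a.r + n : ℤ) := by push_cast; linarith
    exact_mod_cast this

lemma IsAffineAction.shift1_of_zoneOf (h : IsAffineAction cs act) (ha : a.Valid) (hb : b.Valid)
    (hz : zoneOf cs w a.bary) (hw : b.bary = a.bary + act w fw1) : Alc.Shift1 a b := by
  unfold Alc.Shift1
  rcases Alc.zone_of_zoneOf ha hz with hz | hz | hz | hz | hz | hz <;> obtain ⟨rfl, hz⟩ := hz <;>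
    simp only [map_mul, map_one, Equiv.Perm.coe_mul, Equiv.Perm.coe_one, Function.comp_apply, id,
      h.simple_one, h.simple_two] at hw <;> unfold Alc.Valid at ha hb
  · have := Alc.of_bary_eq_add (m := 2) (n := 1) hw (by norm_num [fw1]) (by norm_num [fw1])
    exact .inl (by omega)
  · have := Alc.of_bary_eq_add (m := -1) (n := 1) hw (by norm_num [fw1, reflE, B2, a1])
      (by norm_num [fw1, reflE, B2, a1])
    exact .inr (.inl (by omega))
  · have := Alc.of_bary_eq_add (m := 2) (n := 1) hw (by norm_num [fw1, reflE, B2, a2])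
      (by norm_num [fw1, reflE, B2, a2])
    exact .inr (.inr (.inl (by omega)))
  · have := Alc.of_bary_eq_add (m := -1) (n := 1) hw (by norm_num [fw1, reflE, B2, a1, a2])
      (by norm_num [fw1, reflE, B2, a1, a2])
    exact .inr (.inr (.inr (.inl (by omega))))
  · have := Alc.of_bary_eq_add (m := -1) (n := -2) hw (by norm_num [fw1, reflE, B2, a1, a2])
      (by norm_num [fw1, reflE, B2, a1, a2])
    exact .inr (.inr (.inr (.inr (.inl (by omega)))))
  · have := Alc.of_bary_eq_add (m := -1) (n := -2) hw (by norm_num [fw1, reflE, B2, a1, a2])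
      (by norm_num [fw1, reflE, B2, a1, a2])
    exact .inr (.inr (.inr (.inr (.inr (by omega)))))

lemma IsAffineAction.shift1_swap_of_zoneOf (h : IsAffineAction cs act) (ha : a.Valid)
    (hb : b.Valid) (hz : zoneOf cs w a.bary) (hw : b.bary = a.bary + act w fw2) :
    Alc.Shift1 a.swap b.swap := by
  simp only [Alc.Shift1, Alc.swap]
  rcases Alc.zone_of_zoneOf ha hz with hz | hz | hz | hz | hz | hz <;> obtain ⟨rfl, hz⟩ := hz <;>
    simp only [map_mul, map_one, Equiv.Perm.coe_mul, Equiv.Perm.coe_one, Function.comp_apply, id,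
      h.simple_one, h.simple_two] at hw <;> unfold Alc.Valid at ha hb
  · have := Alc.of_bary_eq_add (m := 1) (n := 2) hw (by norm_num [fw2]) (by norm_num [fw2])
    exact .inl (by omega)
  · have := Alc.of_bary_eq_add (m := 1) (n := 2) hw (by norm_num [fw2, reflE, B2, a1])
      (by norm_num [fw2, reflE, B2, a1])
    exact .inr (.inr (.inl (by omega)))
  · have := Alc.of_bary_eq_add (m := 1) (n := -1) hw (by norm_num [fw2, reflE, B2, a2])
      (by norm_num [fw2, reflE, B2, a2])
    exact .inr (.inl (by omega))
  · have := Alc.of_bary_eq_add (m := -2) (n := -1) hw (by norm_num [fw2, reflE, B2, a1, a2])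
      (by norm_num [fw2, reflE, B2, a1, a2])
    exact .inr (.inr (.inr (.inr (.inl (by omega)))))
  · have := Alc.of_bary_eq_add (m := 1) (n := -1) hw (by norm_num [fw2, reflE, B2, a1, a2])
      (by norm_num [fw2, reflE, B2, a1, a2])
    exact .inr (.inr (.inr (.inl (by omega))))
  · have := Alc.of_bary_eq_add (m := -2) (n := -1) hw (by norm_num [fw2, reflE, B2, a1, a2])
      (by norm_num [fw2, reflE, B2, a1, a2])
    exact .inr (.inr (.inr (.inr (.inr (by omega)))))

lemma Alc.eq_one_of_zoneOf (ha : a.Valid) (hd : a.Dom) (hz : zoneOf cs w a.bary) : w = 1 := by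
  have := Alc.zone_of_zoneOf ha hz
  simp only [Alc.Valid, Alc.Dom] at ha hd
  rcases this with h | h | h | h | h | h
  · exact h.1
  all_goals omega

lemma IsAffineAction.alcOf_dom (h : IsAffineAction cs act) {th ths : ℕ → ℕ → W}
    (hth : ∀ m n : ℕ, cen act (th m n) =
      cen act (cs.simple 1 * cs.simple 2 * cs.simple 1) + (m : ℝ) • fw1 + (n : ℝ) • fw2)
    (hths : ∀ m n : ℕ, cen act (ths m n) =
      cen act 1 + ((m : ℝ) + 1) • fw1 + ((n : ℝ) + 1) • fw2)
    (hw : w ∈ Dset th ths) : (alcOf act w).Dom := by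
  rcases hw with ⟨m, n, rfl⟩ | ⟨m, n, rfl⟩
  · rw [alcOf_eq (a := ⟨m, n, m + n⟩) (.inl rfl)]
    · exact ⟨m.cast_nonneg, n.cast_nonneg⟩
    rw [hth, cen, map_mul, map_mul, Equiv.Perm.mul_apply, Equiv.Perm.mul_apply, h.simple_one,
      h.simple_two]
    ext <;> simp [reflE, B2, a1, a2, rho2, fw1, fw2, Alc.bary] <;> ring
  · rw [alcOf_eq (a := ⟨m, n, m + n + 1⟩) (.inr rfl)]
    · exact ⟨m.cast_nonneg, n.cast_nonneg⟩
    rw [hths, cen, map_one]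
    ext <;> simp [rho2, fw1, fw2, Alc.bary] <;> ring

end Geometry

section Shift

variable {W : Type*} [Group W] {M : CoxeterMatrix (Fin 3)} {cs : CoxeterSystem M W}
  {act : W →* Equiv.Perm E2} {T : Alc → Alc → Prop} {tau : W → W} {x y a b : W}

lemma Alc.IsShift.injective_of (hT : IsShift T) (h : IsAffineAction cs act)
    (hcen : Function.Injective (cen act)) (hτ : ∀ z, T (alcOf act z) (alcOf act (tau z))) :
    Function.Injective tau := fun a b hab =>
  h.alcOf_injective hcen <| hT.injective (h.alcOf_valid a) (h.alcOf_valid b) (hτ a) (hab ▸ hτ b)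

lemma Alc.IsShift.bruhatLE_left (hT : IsShift T) (h : IsAffineAction cs act)
    (hcen : Function.Injective (cen act)) (hτ : ∀ z, T (alcOf act z) (alcOf act (tau z)))
    (hx : (alcOf act x).Dom) (hxa : bruhatLE cs x a) : bruhatLE cs (tau x) (tau a) := by
  have hv := h.alcOf_valid x
  have hva := h.alcOf_valid a
  rw [← h.le_iff_bruhatLE hcen] at hxa ⊢
  rw [Alc.le_iff_upper hv hx hva] at hxa
  rw [Alc.le_iff_upper (hT.valid hv (hτ x)) (hT.dom hv hx (hτ x)) (hT.valid hva (hτ a))]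
  exact hT.upper hv hx hva (hτ x) (hτ a) hxa

lemma Alc.IsShift.bruhatLE_right (hT : IsShift T) (h : IsAffineAction cs act)
    (hcen : Function.Injective (cen act)) (hτ : ∀ z, T (alcOf act z) (alcOf act (tau z)))
    (hy : (alcOf act y).Dom) (hay : bruhatLE cs a y) : bruhatLE cs (tau a) (tau y) := by
  have hv := h.alcOf_valid y
  have hva := h.alcOf_valid a
  rw [← h.le_iff_bruhatLE hcen] at hay ⊢
  rw [Alc.le_iff_lower hv hy hva] at hay
  rw [Alc.le_iff_lower (hT.valid hv (hτ y)) (hT.dom hv hy (hτ y)) (hT.valid hva (hτ a))]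
  exact hT.lower hv hy hva (hτ y) (hτ a) hay

lemma Alc.IsShift.image_subset (hT : IsShift T) (h : IsAffineAction cs act)
    (hcen : Function.Injective (cen act)) (hτ : ∀ z, T (alcOf act z) (alcOf act (tau z)))
    (hx : (alcOf act x).Dom) (hy : (alcOf act y).Dom) :
    tau '' Iset cs x y ⊆ Iset cs (tau x) (tau y) := by
  rintro _ ⟨a, ⟨hxa, hay⟩, rfl⟩
  exact ⟨hT.bruhatLE_left h hcen hτ hx hxa, hT.bruhatLE_right h hcen hτ hy hay⟩

lemma IsAffineAction.alcOf_ne_of_le (h : IsAffineAction cs act)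
    (hcen : Function.Injective (cen act)) (hx : (alcOf act x).Dom) (hxa : bruhatLE cs x a) :
    alcOf act a ≠ ⟨-1, -1, -1⟩ := by
  intro ha
  have hv := h.alcOf_valid x
  rw [← h.le_iff_bruhatLE hcen, ha, Alc.le_iff_upper hv hx (.inr rfl)] at hxa
  simp only [Alc.Upper, Alc.Dom, Alc.Valid] at *
  omega

lemma Alc.IsShift.edge_iff_of_image_eq (hT : IsShift T) (h : IsAffineAction cs act)
    (hcen : Function.Injective (cen act)) (hτ : ∀ z, T (alcOf act z) (alcOf act (tau z)))
    (hx : (alcOf act x).Dom) (hy : (alcOf act y).Dom)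
    (him : tau '' Iset cs x y = Iset cs (tau x) (tau y)) (ha : a ∈ Iset cs x y)
    (hb : b ∈ Iset cs x y) :
    Edge (alcOf act a) (alcOf act b) ↔ Edge (alcOf act (tau a)) (alcOf act (tau b)) := by
  have hv := h.alcOf_valid
  refine (hT.edge_iff_or_gap (hv a) (hv b) (h.alcOf_ne_of_le hcen hx ha.1)
    (h.alcOf_ne_of_le hcen hx hb.1) (hτ a) (hτ b)).resolve_right ?_
  rintro ⟨c, hc, hrange, hupper, hlower⟩
  obtain ⟨w, rfl⟩ := h.exists_alcOf_eq hc
  have h1 := hT.bruhatLE_left h hcen hτ hx ha.1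
  have h2 := hT.bruhatLE_right h hcen hτ hy hb.2
  have hdx := hT.dom (hv x) hx (hτ x)
  have hdy := hT.dom (hv y) hy (hτ y)
  rw [← h.le_iff_bruhatLE hcen, Alc.le_iff_upper (hv _) hdx (hv _)] at h1
  rw [← h.le_iff_bruhatLE hcen, Alc.le_iff_lower (hv _) hdy (hv _)] at h2
  have hw : w ∈ Iset cs (tau x) (tau y) :=
    ⟨(h.le_iff_bruhatLE hcen).1 ((Alc.le_iff_upper (hv _) hdx hc).2 (hupper _ _ h1)),
      (h.le_iff_bruhatLE hcen).1 ((Alc.le_iff_lower (hv _) hdy hc).2 (hlower _ _ h2))⟩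
  rw [← him] at hw
  obtain ⟨z, -, rfl⟩ := hw
  exact hrange _ _ (hv z) (hτ z) rfl

lemma Alc.IsShift.bruhatLE_iff_of_image_eq (hT : IsShift T) (h : IsAffineAction cs act)
    (hcen : Function.Injective (cen act)) (hτ : ∀ z, T (alcOf act z) (alcOf act (tau z)))
    (hx : (alcOf act x).Dom) (hy : (alcOf act y).Dom)
    (him : tau '' Iset cs x y = Iset cs (tau x) (tau y)) (ha : a ∈ Iset cs x y)
    (hb : b ∈ Iset cs x y) : bruhatLE cs a b ↔ bruhatLE cs (tau a) (tau b) := by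
  have hle {u v : W} := h.le_iff_bruhatLE hcen (a := u) (b := v)
  rw [← hle, ← hle]
  constructor
  · intro hab
    generalize hc : alcOf act b = c at hab
    induction hab generalizing b with
    | refl => rw [h.alcOf_injective hcen hc]
    | tail hd he ih =>
      obtain ⟨d, rfl⟩ := h.exists_alcOf_eq (Le.valid hd (h.alcOf_valid a))
      subst hc
      have hdm : d ∈ Iset cs x y :=
        ⟨ha.1.trans (hle.1 hd), (hle.1 (.single he)).trans hb.2⟩
      exact (ih hdm rfl).tail ((hT.edge_iff_of_image_eq h hcen hτ hx hy him hdm hb).1 he)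
  · intro hab
    generalize hc : alcOf act (tau b) = c at hab
    have ha' := him ▸ Set.mem_image_of_mem tau ha
    induction hab generalizing b with
    | refl => rw [hT.injective_of h hcen hτ (h.alcOf_injective hcen hc)]
    | tail hd he ih =>
      obtain ⟨d, rfl⟩ := h.exists_alcOf_eq (Le.valid hd (h.alcOf_valid _))
      subst hc
      have hb' := him ▸ Set.mem_image_of_mem tau hb
      have hdm : d ∈ Iset cs (tau x) (tau y) :=
        ⟨ha'.1.trans (hle.1 hd), (hle.1 (.single he)).trans hb'.2⟩
      rw [← him] at hdm
      obtain ⟨d, hdm, rfl⟩ := hdm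
      exact (ih hdm rfl).tail ((hT.edge_iff_of_image_eq h hcen hτ hx hy him hdm hb).2 he)

end Shift

/-- the piecewise translation `τᵢ` is injective, maps `[x,y]` into
`[x + ϖᵢ, y + ϖᵢ]`, and is a poset isomorphism whenever it is onto. -/
theorem statement8
    {W : Type*} [Group W] {M : CoxeterMatrix (Fin 3)} (cs : CoxeterSystem M W)
    (hM : ∀ i j : Fin 3, M i j = if i = j then 1 else 3)
    (act : W →* Equiv.Perm E2)
    (h0 : ∀ v, act (cs.simple 0) v = reflE rho2 (-1) v)
    (h1 : ∀ v, act (cs.simple 1) v = reflE a1 0 v)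
    (h2 : ∀ v, act (cs.simple 2) v = reflE a2 0 v)
    (hcen : Function.Injective (cen act))
    (th ths : ℕ → ℕ → W)
    (hth : ∀ m n : ℕ, cen act (th m n) =
      cen act (cs.simple 1 * cs.simple 2 * cs.simple 1) + (m : ℝ) • fw1 + (n : ℝ) • fw2)
    (hths : ∀ m n : ℕ, cen act (ths m n) =
      cen act 1 + ((m : ℝ) + 1) • fw1 + ((n : ℝ) + 1) • fw2)
    (x y : W) (hx : x ∈ Dset th ths) (hy : y ∈ Dset th ths) (hxy : bruhatLE cs x y)
    (tau : W → W) (wi : E2) (hwi : wi = fw1 ∨ wi = fw2)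
    (htau : ∀ z : W, ∃ w : W, zoneOf cs w (cen act z) ∧
      cen act (tau z) = cen act z + act w wi) :
    Function.Injective tau ∧
    cen act (tau x) = cen act x + wi ∧ cen act (tau y) = cen act y + wi ∧
    tau '' Iset cs x y ⊆ Iset cs (tau x) (tau y) ∧
    (tau '' Iset cs x y = Iset cs (tau x) (tau y) →
      ∀ a ∈ Iset cs x y, ∀ b ∈ Iset cs x y,
        (bruhatLE cs a b ↔ bruhatLE cs (tau a) (tau b))) := by
  have h : IsAffineAction cs act := ⟨funext h0, funext h1, funext h2⟩
  have hxd := h.alcOf_dom hth hths hx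
  have hyd := h.alcOf_dom hth hths hy
  have cen_tau {z : W} (hz : (alcOf act z).Dom) : cen act (tau z) = cen act z + wi := by
    obtain ⟨w, hw, hwz⟩ := htau z
    rw [h.cen_eq z] at hw
    rw [hwz, Alc.eq_one_of_zoneOf (h.alcOf_valid z) hz hw, map_one, Equiv.Perm.one_apply]
  obtain ⟨T, hT, hτ⟩ : ∃ T, Alc.IsShift T ∧ ∀ z, T (alcOf act z) (alcOf act (tau z)) := by
    simp only [h.cen_eq] at htau
    rcases hwi with rfl | rfl
    · refine ⟨_, Alc.isShift_shift1, fun z => ?_⟩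
      obtain ⟨w, hw, hwz⟩ := htau z
      exact h.shift1_of_zoneOf (h.alcOf_valid _) (h.alcOf_valid _) hw hwz
    · refine ⟨_, Alc.isShift_shift1.swap, fun z => ?_⟩
      obtain ⟨w, hw, hwz⟩ := htau z
      exact h.shift1_swap_of_zoneOf (h.alcOf_valid _) (h.alcOf_valid _) hw hwz
  exact ⟨hT.injective_of h hcen hτ, cen_tau hxd, cen_tau hyd,
    hT.image_subset h hcen hτ hxd hyd, fun him a ha b hb =>
      hT.bruhatLE_iff_of_image_eq h hcen hτ hxd hyd him ha hb⟩
end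
end

section
/- Let x ≤ y be dominant elements of W. (1) If [x,y] is a parallelogram interval, then for every dominant weight λ ∈ Λ the piecewise translation τ_λ : [x,y] → [x+λ, y+λ] is an isomorphism of posets. (2) If [x,y] is a pentagon interval, then there is i0 ∈ {1,2} (with j0 the other index) such that Pgn_{x,y} has two adjacent vertices on the line {v ∈ E : (α_{j0}, v) = −1} (equivalently, on the ray α_{i0} + ℝ≥0·ϖ_{i0}); for every a ∈ ℤ≥0 the map τ_{aϖ_{i0}} : [x,y] → [x+aϖ_{i0}, y+aϖ_{i0}] is an isomorphism of posets, while for every dominant weight λ ∈ Λ not of the form aϖ_{i0}, the posets [x,y] and [x+λ, y+λ] are not isomorphic. (3) If [x,y] is a hexagon interval, then for every nonzero dominant weight λ ∈ Λ, the posets [x,y] and [x+λ, y+λ] are not isomorphic. -/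
noncomputable section

open scoped RealInnerProductSpace

/-- The numerical criterion for the Bruhat order, in terms of three times the root coordinates of
the barycenters of two alcoves. -/
def BruhatCrit (a b : ℤ × ℤ) : Prop :=
  (max (max a.1 (a.2 - a.1)) (-a.2) ≤ max (max b.1 (b.2 - b.1)) (-b.2)) ∧
  (max (max a.1 (a.2 - a.1)) (-a.2 - 3) ≤ max (max b.1 (b.2 - b.1)) (-b.2 - 3)) ∧
  (max (max a.1 (a.2 - a.1 - 3)) (-a.2 - 3) ≤ max (max b.1 (b.2 - b.1 - 3)) (-b.2 - 3)) ∧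
  (min (min b.1 (b.2 - b.1)) (-b.2) ≤ min (min a.1 (a.2 - a.1)) (-a.2)) ∧
  (min (min b.1 (b.2 - b.1)) (-b.2 - 3) ≤ min (min a.1 (a.2 - a.1)) (-a.2 - 3)) ∧
  (min (min b.1 (b.2 - b.1 - 3)) (-b.2 - 3) ≤ min (min a.1 (a.2 - a.1 - 3)) (-a.2 - 3))

/-- The integer points that are three times the barycenter of an alcove. -/
def IsAlc (a : ℤ × ℤ) : Prop := (a.1 + a.2) % 3 ≠ 0

/-- The number of hyperplanes separating an alcove from the fundamental one. -/
def alcLen (a : ℤ × ℤ) : ℕ :=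
  ((2 * a.1 - a.2) / 3 + 1).natAbs + ((2 * a.2 - a.1) / 3 + 1).natAbs +
    ((a.1 + a.2) / 3 + 1).natAbs

/-- Three times the pairing with the positive roots `ρ`, `α₁`, `α₂` respectively. -/
def rootVal : Fin 3 → ℤ × ℤ → ℤ
  | 0, a => a.1 + a.2
  | 1, a => 2 * a.1 - a.2
  | 2, a => 2 * a.2 - a.1

/-- The affine reflections attached to the positive roots `ρ`, `α₁`, `α₂`. -/
def refZ : Fin 3 → ℤ → ℤ × ℤ → ℤ × ℤ
  | 0, k, a => (3 * k - a.2, 3 * k - a.1)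
  | 1, k, a => (a.2 - a.1 + 3 * k, a.2)
  | 2, k, a => (a.1, a.1 - a.2 + 3 * k)

/-- The level of the wall of the fundamental alcove orthogonal to the given positive root. -/
def wallLevel (i : Fin 3) : ℤ := if i = 0 then -1 else 0

/-- The simple affine reflections. -/
def simZ (i : Fin 3) (a : ℤ × ℤ) : ℤ × ℤ := refZ i (wallLevel i) a

/-- An alcove with pairing `r` lies on the same side of the line of level `k` as the fundamental
alcove. -/
def SameSide (r k : ℤ) : Prop := (0 ≤ k ∧ r < 3 * k) ∨ (k < 0 ∧ 3 * k < r)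

/-- The elementary length-increasing reflections of alcoves. -/
def Edge (a b : ℤ × ℤ) : Prop := ∃ i k, SameSide (rootVal i a) k ∧ b = refZ i k a

/-- The coordinates of a dominant alcove. -/
def IsDom (a : ℤ × ℤ) : Prop := 0 < 2 * a.1 - a.2 ∧ 0 < 2 * a.2 - a.1

/-- The piecewise translation attached to the first fundamental weight, in coordinates. -/
def tauZ (a : ℤ × ℤ) : ℤ × ℤ :=
  if a.1 + a.2 < -3 then
    if 0 < 2 * a.2 - a.1 then (a.1 - 1, a.2 + 1) else (a.1 - 1, a.2 - 2)
  else if 2 * a.1 - a.2 < -3 then (a.1 - 1, a.2 + 1) else (a.1 + 2, a.2 + 1)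

theorem fin_three_cases (i : Fin 3) : i = 0 ∨ i = 1 ∨ i = 2 := by
  decide +revert

theorem IsAlc.exists_eq {x y : ℤ} (h : IsAlc (x, y)) :
    ∃ m, x = 3 * m + 1 - y ∨ x = 3 * m + 2 - y := by
  refine ⟨(x + y) / 3, ?_⟩
  simp only [IsAlc] at h
  omega

theorem BruhatCrit.refl (a : ℤ × ℤ) : BruhatCrit a a :=
  ⟨le_rfl, le_rfl, le_rfl, le_rfl, le_rfl, le_rfl⟩

theorem BruhatCrit.trans {a b c : ℤ × ℤ} (h : BruhatCrit a b) (h' : BruhatCrit b c) :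
    BruhatCrit a c :=
  ⟨h.1.trans h'.1, h.2.1.trans h'.2.1, h.2.2.1.trans h'.2.2.1, h'.2.2.2.1.trans h.2.2.2.1,
    h'.2.2.2.2.1.trans h.2.2.2.2.1, h'.2.2.2.2.2.trans h.2.2.2.2.2⟩

theorem BruhatCrit.swap {a b : ℤ × ℤ} (h : BruhatCrit a b) : BruhatCrit a.swap b.swap := by
  obtain ⟨x, y⟩ := a
  obtain ⟨z, w⟩ := b
  obtain ⟨h1, h2, h3, h4, h5, h6⟩ := h
  simp only [Prod.swap, BruhatCrit] at *
  refine ⟨?_, ?_, ?_, ?_, ?_, ?_⟩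
  · clear h1 h2 h3 h5 h6; omega
  · clear h1 h2 h3 h5 h4; omega
  · clear h1 h2 h3 h4 h6; omega
  · clear h6 h2 h3 h5 h4; omega
  · clear h1 h2 h6 h5 h4; omega
  · clear h1 h6 h3 h5 h4; omega

theorem bruhatCrit_swap {a b : ℤ × ℤ} : BruhatCrit a.swap b.swap ↔ BruhatCrit a b :=
  ⟨fun h => by simpa using h.swap, BruhatCrit.swap⟩

/-- The rotation of order three fixing the barycenter of the fundamental alcove. -/
def rotZ (a : ℤ × ℤ) : ℤ × ℤ := (-a.2 - 2, a.1 - a.2 - 1)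

theorem bruhatCrit_rotZ {a b : ℤ × ℤ} : BruhatCrit (rotZ a) (rotZ b) ↔ BruhatCrit a b := by
  obtain ⟨x, y⟩ := a
  obtain ⟨z, w⟩ := b
  constructor
  all_goals
    rintro ⟨h1, h2, h3, h4, h5, h6⟩
    simp only [rotZ, BruhatCrit] at *
  · refine ⟨?_, ?_, ?_, ?_, ?_, ?_⟩
    · clear h1 h2 h5 h4 h6; omega
    · clear h3 h2 h5 h4 h6; omega
    · clear h1 h3 h5 h4 h6; omega
    · clear h1 h2 h5 h4 h3; omega
    · clear h1 h2 h5 h3 h6; omega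
    · clear h1 h2 h3 h4 h6; omega
  · refine ⟨?_, ?_, ?_, ?_, ?_, ?_⟩
    · clear h1 h3 h5 h4 h6; omega
    · clear h1 h2 h5 h4 h6; omega
    · clear h2 h3 h5 h4 h6; omega
    · clear h1 h2 h3 h4 h6; omega
    · clear h1 h2 h5 h4 h3; omega
    · clear h1 h2 h3 h5 h6; omega

theorem IsAlc.swap {a : ℤ × ℤ} (h : IsAlc a) : IsAlc a.swap := by
  simp only [IsAlc, Prod.swap] at *; omega

theorem IsAlc.rotZ {a : ℤ × ℤ} (h : IsAlc a) : IsAlc (rotZ a) := by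
  simp only [IsAlc, _root_.rotZ] at *; omega

theorem IsAlc.refZ {a : ℤ × ℤ} (h : IsAlc a) (i : Fin 3) (k : ℤ) : IsAlc (refZ i k a) := by
  obtain rfl | rfl | rfl := fin_three_cases i <;> simp only [IsAlc, _root_.refZ] at * <;> omega

theorem refZ_refZ (i : Fin 3) (k : ℤ) (a : ℤ × ℤ) : refZ i k (refZ i k a) = a := by
  obtain rfl | rfl | rfl := fin_three_cases i <;> simp only [refZ] <;> ext <;> dsimp only <;> ring

theorem rootVal_refZ (i : Fin 3) (k : ℤ) (a : ℤ × ℤ) :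
    rootVal i (refZ i k a) = 6 * k - rootVal i a := by
  obtain rfl | rfl | rfl := fin_three_cases i <;> simp only [refZ, rootVal] <;> ring

theorem IsAlc.rootVal_ne {a : ℤ × ℤ} (h : IsAlc a) (i : Fin 3) (k : ℤ) :
    rootVal i a ≠ 3 * k := by
  obtain rfl | rfl | rfl := fin_three_cases i <;> simp only [IsAlc, rootVal] at * <;> omega

theorem simZ_simZ (i : Fin 3) (a : ℤ × ℤ) : simZ i (simZ i a) = a := refZ_refZ _ _ _

theorem IsAlc.simZ {a : ℤ × ℤ} (h : IsAlc a) (i : Fin 3) : IsAlc (simZ i a) := h.refZ _ _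

theorem not_sameSide_iff {a : ℤ × ℤ} (h : IsAlc a) (i : Fin 3) (k : ℤ) :
    ¬ SameSide (rootVal i a) k ↔ SameSide (rootVal i (refZ i k a)) k := by
  have := h.rootVal_ne i k
  rw [rootVal_refZ]
  unfold SameSide
  omega

theorem natAbs_lt_aux {p q s k : ℤ} (hs : s = p + q ∨ s = p + q + 1)
    (hk : (0 ≤ k ∧ p < k) ∨ (k < 0 ∧ k ≤ p)) :
    (p + 1).natAbs + (q + 1).natAbs + (s + 1).natAbs <
      (2 * k - p).natAbs + (s - k + 1).natAbs + (q + k + 1).natAbs := by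
  omega

theorem alcLen_lt_refZ {a : ℤ × ℤ} (h : IsAlc a) {i : Fin 3} {k : ℤ}
    (hk : SameSide (rootVal i a) k) : alcLen a < alcLen (refZ i k a) := by
  obtain ⟨x, y⟩ := a
  obtain ⟨p, q, hp, hq, r, hr, hxy⟩ : ∃ p q : ℤ, (2 * x - y) / 3 = p ∧ (2 * y - x) / 3 = q ∧
      ∃ r, (r = 1 ∨ r = 2) ∧ ((x = 2 * p + q + r ∧ y = p + 2 * q + r)) := by
    obtain ⟨m, rfl | rfl⟩ := h.exists_eq
    · exact ⟨2 * m - y, y - m - 1, by omega, by omega, 2, by omega, by omega⟩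
    · exact ⟨2 * m + 1 - y, y - m - 1, by omega, by omega, 1, by omega, by omega⟩
  obtain ⟨rfl, rfl⟩ := hxy
  clear hp hq h
  obtain ⟨s, hs, hpq⟩ : ∃ s, 3 * p + 3 * q + 2 * r = 3 * s + (3 - r) ∧
      (s = p + q ∨ s = p + q + 1) := by
    rcases hr with rfl | rfl
    · exact ⟨p + q, by omega, by omega⟩
    · exact ⟨p + q + 1, by omega, by omega⟩
  have e : ∀ u v w : ℤ, 0 ≤ v → v ≤ 2 → w = 3 * u + v → w / 3 = u := by intros; omega
  have f1 : (2 * (2 * p + q + r) - (p + 2 * q + r)) / 3 = p :=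
    e _ r _ (by omega) (by omega) (by omega)
  have f2 : (2 * (p + 2 * q + r) - (2 * p + q + r)) / 3 = q :=
    e _ r _ (by omega) (by omega) (by omega)
  have f3 : (2 * p + q + r + (p + 2 * q + r)) / 3 = s :=
    e _ (3 - r) _ (by omega) (by omega) (by omega)
  obtain rfl | rfl | rfl := fin_three_cases i <;> simp only [refZ, rootVal, SameSide, alcLen] at *
  · rw [f1, f2, f3, e (k - q - 1) (3 - r) (2 * _ - _) (by omega) (by omega) (by omega),
      e (k - p - 1) (3 - r) (2 * _ - _) (by omega) (by omega) (by omega),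
      e (2 * k - s - 1) r _ (by omega) (by omega) (by omega)]
    have hk' : (0 ≤ k ∧ s < k) ∨ (k < 0 ∧ k ≤ s) := by omega
    clear f1 f2 f3 e hk hs
    omega
  · rw [f1, f2, f3, e (2 * k - p - 1) (3 - r) (2 * _ - _) (by omega) (by omega) (by omega),
      e (s - k) (3 - r) (2 * _ - _) (by omega) (by omega) (by omega),
      e (q + k) r _ (by omega) (by omega) (by omega)]
    have := natAbs_lt_aux hpq (k := k) (by omega)
    rwa [show 2 * k - p - 1 + 1 = 2 * k - p by ring]
  · rw [f1, f2, f3, e (s - k) (3 - r) (2 * _ - _) (by omega) (by omega) (by omega),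
      e (2 * k - q - 1) (3 - r) (2 * _ - _) (by omega) (by omega) (by omega),
      e (p + k) r _ (by omega) (by omega) (by omega)]
    have := natAbs_lt_aux (p := q) (q := p) (s := s) (k := k) (by omega) (by omega)
    rw [show 2 * k - q - 1 + 1 = 2 * k - q by ring]
    omega

theorem sameSide_of_alcLen_lt {a : ℤ × ℤ} (h : IsAlc a) {i : Fin 3} {k : ℤ}
    (hk : alcLen a < alcLen (refZ i k a)) : SameSide (rootVal i a) k := by
  by_contra hc
  rw [not_sameSide_iff h] at hc
  have := alcLen_lt_refZ (h.refZ i k) hc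
  rw [refZ_refZ] at this
  omega

theorem alcLen_of_mod_one (m y : ℤ) : alcLen (3 * m + 1 - y, y) =
    (2 * m - y + 1).natAbs + (y - m).natAbs + (m + 1).natAbs := by
  simp only [alcLen]
  congr 3 <;> omega

theorem alcLen_of_mod_two (m y : ℤ) : alcLen (3 * m + 2 - y, y) =
    (2 * m - y + 2).natAbs + (y - m).natAbs + (m + 1).natAbs := by
  simp only [alcLen]
  congr 3 <;> omega

theorem alcLen_simZ {a : ℤ × ℤ} (h : IsAlc a) {i : Fin 3}
    (hk : SameSide (rootVal i a) (wallLevel i)) : alcLen (simZ i a) = alcLen a + 1 := by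
  obtain ⟨x, y⟩ := a
  have hk' : (i = 0 ∧ -3 < x + y) ∨ (i = 1 ∧ 2 * x - y < 0) ∨ (i = 2 ∧ 2 * y - x < 0) := by
    obtain rfl | rfl | rfl := fin_three_cases i <;>
    · simp [SameSide, rootVal, wallLevel] at hk ⊢
      omega
  obtain ⟨m, rfl | rfl⟩ := h.exists_eq <;> obtain ⟨rfl, hk'⟩ | ⟨rfl, hk'⟩ | ⟨rfl, hk'⟩ := hk'
  · rw [show simZ 0 (3 * m + 1 - y, y) = (3 * (-3 - m) + 2 - (y - 3 * m - 4), y - 3 * m - 4) by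
      simp [simZ, wallLevel, refZ]; omega, alcLen_of_mod_one, alcLen_of_mod_two]
    omega
  · rw [show simZ 1 (3 * m + 1 - y, y) = (3 * (y - m - 1) + 2 - y, y) by
      simp [simZ, wallLevel, refZ]; omega, alcLen_of_mod_one, alcLen_of_mod_two]
    omega
  · rw [show simZ 2 (3 * m + 1 - y, y) =
      (3 * (2 * m - y) + 2 - (3 * m + 1 - 2 * y), 3 * m + 1 - 2 * y) by
      simp [simZ, wallLevel, refZ]; omega, alcLen_of_mod_one, alcLen_of_mod_two]
    omega
  · rw [show simZ 0 (3 * m + 2 - y, y) = (3 * (-3 - m) + 1 - (y - 3 * m - 5), y - 3 * m - 5) by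
      simp [simZ, wallLevel, refZ]; omega, alcLen_of_mod_one, alcLen_of_mod_two]
    omega
  · rw [show simZ 1 (3 * m + 2 - y, y) = (3 * (y - m - 1) + 1 - y, y) by
      simp [simZ, wallLevel, refZ]; omega, alcLen_of_mod_one, alcLen_of_mod_two]
    omega
  · rw [show simZ 2 (3 * m + 2 - y, y) =
      (3 * (2 * m + 1 - y) + 1 - (3 * m + 2 - 2 * y), 3 * m + 2 - 2 * y) by
      simp [simZ, wallLevel, refZ]; omega, alcLen_of_mod_one, alcLen_of_mod_two]
    omega

theorem exists_not_sameSide {a : ℤ × ℤ} (h : IsAlc a) (ha : a ≠ (-1, -1)) :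
    ∃ i, ¬ SameSide (rootVal i a) (wallLevel i) := by
  by_contra! hc
  have h0 := hc 0
  have h1 := hc 1
  have h2 := hc 2
  apply ha
  obtain ⟨x, y⟩ := a
  simp [IsAlc, wallLevel, rootVal, SameSide] at *
  omega

theorem alcLen_base : alcLen (-1, -1) = 0 := by decide

theorem isAlc_base : IsAlc (-1, -1) := by unfold IsAlc; decide

theorem eq_base_of_bruhatCrit {a : ℤ × ℤ} (h : IsAlc a) (hc : BruhatCrit a (-1, -1)) :
    a = (-1, -1) := by
  obtain ⟨x, y⟩ := a
  simp [IsAlc, BruhatCrit] at *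
  omega

theorem bruhatCrit_refZ {a : ℤ × ℤ} (h : IsAlc a) {i : Fin 3} {k : ℤ}
    (hk : SameSide (rootVal i a) k) : BruhatCrit a (refZ i k a) := by
  obtain ⟨x, y⟩ := a
  obtain rfl | rfl | rfl := fin_three_cases i <;>
    simp only [IsAlc, SameSide, BruhatCrit, refZ, rootVal] at *
  · omega
  · omega
  · omega

theorem Edge.alcLen_lt {a b : ℤ × ℤ} (h : IsAlc a) (he : Edge a b) : alcLen a < alcLen b := by
  obtain ⟨i, k, hk, rfl⟩ := he
  exact alcLen_lt_refZ h hk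

theorem Edge.bruhatCrit {a b : ℤ × ℤ} (h : IsAlc a) (he : Edge a b) : BruhatCrit a b := by
  obtain ⟨i, k, hk, rfl⟩ := he
  exact bruhatCrit_refZ h hk

theorem Edge.simZ {a b : ℤ × ℤ} (he : Edge a b) (j : Fin 3) :
    b = simZ j a ∨ Edge (simZ j a) (simZ j b) := by
  obtain ⟨x, y⟩ := a
  obtain ⟨i, k, hk, rfl⟩ := he
  obtain rfl | rfl | rfl := fin_three_cases j <;> obtain rfl | rfl | rfl := fin_three_cases i
  · by_cases h : k = -1
    · left; subst h; rfl
    · refine Or.inr ⟨0, -2 - k, ?_, ?_⟩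
      · simp [_root_.simZ, wallLevel, refZ, rootVal, SameSide] at *; omega
      · simp [_root_.simZ, wallLevel, refZ]; omega
  · refine Or.inr ⟨2, -k - 1, ?_, ?_⟩
    · simp [_root_.simZ, wallLevel, refZ, rootVal, SameSide] at *; omega
    · simp [_root_.simZ, wallLevel, refZ]; omega
  · refine Or.inr ⟨1, -k - 1, ?_, ?_⟩
    · simp [_root_.simZ, wallLevel, refZ, rootVal, SameSide] at *; omega
    · simp [_root_.simZ, wallLevel, refZ]; omega
  · refine Or.inr ⟨2, k, ?_, ?_⟩
    · simp [_root_.simZ, wallLevel, refZ, rootVal, SameSide] at *; omega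
    · simp [_root_.simZ, wallLevel, refZ]; omega
  · by_cases h : k = 0
    · left; subst h; rfl
    · refine Or.inr ⟨1, -k, ?_, ?_⟩
      · simp [_root_.simZ, wallLevel, refZ, rootVal, SameSide] at *; omega
      · simp [_root_.simZ, wallLevel, refZ]; omega
  · refine Or.inr ⟨0, k, ?_, ?_⟩
    · simp [_root_.simZ, wallLevel, refZ, rootVal, SameSide] at *; omega
    · simp [_root_.simZ, wallLevel, refZ]; omega
  · refine Or.inr ⟨1, k, ?_, ?_⟩
    · simp [_root_.simZ, wallLevel, refZ, rootVal, SameSide] at *; omega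
    · simp [_root_.simZ, wallLevel, refZ]; omega
  · refine Or.inr ⟨0, k, ?_, ?_⟩
    · simp [_root_.simZ, wallLevel, refZ, rootVal, SameSide] at *; omega
    · simp [_root_.simZ, wallLevel, refZ]; omega
  · by_cases h : k = 0
    · left; subst h; rfl
    · refine Or.inr ⟨2, -k, ?_, ?_⟩
      · simp [_root_.simZ, wallLevel, refZ, rootVal, SameSide] at *; omega
      · simp [_root_.simZ, wallLevel, refZ]; omega

theorem refZ_comp_simZ (i j : Fin 3) (k : ℤ) :
    ∃ i' k', ∀ a, simZ j (refZ i k (simZ j a)) = refZ i' k' a := by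
  obtain rfl | rfl | rfl := fin_three_cases j <;> obtain rfl | rfl | rfl := fin_three_cases i
  · exact ⟨0, -2 - k, fun a => by simp [simZ, wallLevel, refZ]; omega⟩
  · exact ⟨2, -k - 1, fun a => by simp [simZ, wallLevel, refZ]; omega⟩
  · exact ⟨1, -k - 1, fun a => by simp [simZ, wallLevel, refZ]; omega⟩
  · exact ⟨2, k, fun a => by simp [simZ, wallLevel, refZ]; omega⟩
  · exact ⟨1, -k, fun a => by simp [simZ, wallLevel, refZ]; omega⟩
  · exact ⟨0, k, fun a => by simp [simZ, wallLevel, refZ]; omega⟩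
  · exact ⟨1, k, fun a => by simp [simZ, wallLevel, refZ]; omega⟩
  · exact ⟨0, k, fun a => by simp [simZ, wallLevel, refZ]; omega⟩
  · exact ⟨2, -k, fun a => by simp [simZ, wallLevel, refZ]; omega⟩

theorem BruhatCrit.reflect_both_one {a b : ℤ × ℤ} (hb : IsAlc b) (h : 0 < 2 * b.1 - b.2)
    (h' : 0 < 2 * a.1 - a.2) (hR : BruhatCrit a b) : BruhatCrit (simZ 1 a) (simZ 1 b) := by
  obtain ⟨x, y⟩ := a
  obtain ⟨z, w⟩ := b
  obtain ⟨h1, h2, h3, h4, h5, h6⟩ := hR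
  simp only [IsAlc, simZ, refZ, wallLevel, one_ne_zero, if_false, mul_zero, add_zero] at *
  refine ⟨by clear h2 h3 h4 h5 h6; omega, by clear h1 h3 h4 h5 h6; omega, ?_,
    by clear h1 h2 h3 h5 h6; omega, by clear h1 h2 h3 h4 h6; omega, ?_⟩
  · clear h2 h3 h4 h6
    dsimp only
    simp only [max_le_iff]
    refine ⟨⟨?_, ?_⟩, ?_⟩
    · clear h1; omega
    · clear h5; omega
    · clear h5; omega
  · clear h2 h3 h4 h6
    dsimp only
    simp only [le_min_iff]
    refine ⟨⟨?_, ?_⟩, ?_⟩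
    · clear h1; omega
    · clear h5; omega
    · clear h1; omega

theorem BruhatCrit.reflect_right_one {a b : ℤ × ℤ} (ha : IsAlc a) (hb : IsAlc b)
    (h : 0 < 2 * b.1 - b.2) (h' : ¬ 0 < 2 * a.1 - a.2) (hR : BruhatCrit a b) :
    BruhatCrit a (simZ 1 b) := by
  obtain ⟨x, y⟩ := a
  obtain ⟨z, w⟩ := b
  obtain ⟨h1, h2, h3, h4, h5, h6⟩ := hR
  simp only [IsAlc, simZ, refZ, wallLevel, one_ne_zero, if_false, mul_zero, add_zero] at *
  refine ⟨by clear h2 h3 h4 h5 h6; omega, by clear h1 h3 h4 h5 h6; omega, ?_,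
    by clear h1 h2 h3 h5 h6; omega, by clear h1 h2 h3 h4 h6; omega, ?_⟩
  · clear h2 h3 h4 h6
    dsimp only
    simp only [max_le_iff]
    refine ⟨⟨?_, ?_⟩, ?_⟩
    · clear h1; omega
    · clear h5; omega
    · clear h5; omega
  · clear h2 h3 h4 h6
    dsimp only
    simp only [le_min_iff]
    refine ⟨⟨?_, ?_⟩, ?_⟩
    · clear h1; omega
    · clear h5
      by_contra hn
      simp only [min_le_iff, not_or, not_le] at hn
      have e1 : z - 2 * w = 3 := by
        rcases le_total z (-w) with H | H <;> omega
      omega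
    · clear h1; omega

theorem swap_simZ (a : ℤ × ℤ) : simZ 1 a.swap = (simZ 2 a).swap := by
  simp [simZ, refZ, wallLevel]

theorem rotZ_simZ (a : ℤ × ℤ) : simZ 1 (rotZ a) = rotZ (simZ 0 a) := by
  simp [simZ, refZ, wallLevel, rotZ]; ring

theorem BruhatCrit.simZ_simZ {a b : ℤ × ℤ} (hb : IsAlc b) {i : Fin 3}
    (h : ¬ SameSide (rootVal i b) (wallLevel i)) (h' : ¬ SameSide (rootVal i a) (wallLevel i))
    (ha : IsAlc a) (hR : BruhatCrit a b) : BruhatCrit (simZ i a) (simZ i b) := by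
  have r1 := ha.rootVal_ne i (wallLevel i)
  have r2 := hb.rootVal_ne i (wallLevel i)
  obtain rfl | rfl | rfl := fin_three_cases i
  · rw [← bruhatCrit_rotZ, ← rotZ_simZ, ← rotZ_simZ]
    refine BruhatCrit.reflect_both_one hb.rotZ ?_ ?_ (bruhatCrit_rotZ.2 hR) <;>
    · simp [rotZ, SameSide, rootVal, wallLevel] at *; omega
  · refine hR.reflect_both_one hb ?_ ?_ <;>
    · simp [SameSide, rootVal, wallLevel] at *; omega
  · rw [← bruhatCrit_swap]
    rw [← swap_simZ, ← swap_simZ]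
    refine BruhatCrit.reflect_both_one hb.swap ?_ ?_ hR.swap <;>
    · simp [SameSide, rootVal, wallLevel] at *; omega

theorem BruhatCrit.simZ_right {a b : ℤ × ℤ} (hb : IsAlc b) {i : Fin 3}
    (h : ¬ SameSide (rootVal i b) (wallLevel i)) (h' : SameSide (rootVal i a) (wallLevel i))
    (ha : IsAlc a) (hR : BruhatCrit a b) : BruhatCrit a (simZ i b) := by
  have r2 := hb.rootVal_ne i (wallLevel i)
  obtain rfl | rfl | rfl := fin_three_cases i
  · rw [← bruhatCrit_rotZ, ← rotZ_simZ]
    refine BruhatCrit.reflect_right_one ha.rotZ hb.rotZ ?_ ?_ (bruhatCrit_rotZ.2 hR) <;>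
    · simp [rotZ, SameSide, rootVal, wallLevel] at *; omega
  · refine hR.reflect_right_one ha hb ?_ ?_ <;>
    · simp [SameSide, rootVal, wallLevel] at *; omega
  · rw [← bruhatCrit_swap]
    rw [← swap_simZ]
    refine BruhatCrit.reflect_right_one ha.swap hb.swap ?_ ?_ hR.swap <;>
    · simp [SameSide, rootVal, wallLevel] at *; omega

theorem bruhatCrit_of_isDom_left {a b : ℤ × ℤ} (ha : IsDom a) : BruhatCrit a b ↔
    (a.1 ≤ b.1 ∨ a.1 ≤ b.2 - b.1 - 3 ∨ a.1 ≤ -b.2 - 3) ∧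
      (b.1 ≤ -a.2 - 3 ∨ b.2 - b.1 ≤ -a.2 - 3 ∨ a.2 ≤ b.2) := by
  obtain ⟨x, y⟩ := a
  obtain ⟨z, w⟩ := b
  simp only [IsDom, BruhatCrit] at *
  have e1 : max (max x (y - x)) (-y) = x := by omega
  have e2 : max (max x (y - x)) (-y - 3) = x := by omega
  have e3 : max (max x (y - x - 3)) (-y - 3) = x := by omega
  have e4 : min (min x (y - x)) (-y) = -y := by omega
  have e5 : min (min x (y - x)) (-y - 3) = -y - 3 := by omega
  have e6 : min (min x (y - x - 3)) (-y - 3) = -y - 3 := by omega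
  rw [e1, e2, e3, e4, e5, e6]
  simp only [le_max_iff, min_le_iff]
  omega

theorem bruhatCrit_of_isDom_right {a b : ℤ × ℤ} (hb : IsDom b) : BruhatCrit a b ↔
    (a.1 ≤ b.1 ∧ a.2 - a.1 ≤ b.1 ∧ -a.2 ≤ b.1) ∧
      (-b.2 ≤ a.1 ∧ -b.2 ≤ a.2 - a.1 ∧ a.2 ≤ b.2) := by
  obtain ⟨z, w⟩ := a
  obtain ⟨x, y⟩ := b
  simp only [IsDom, BruhatCrit] at *
  have e1 : max (max x (y - x)) (-y) = x := by omega
  have e2 : max (max x (y - x)) (-y - 3) = x := by omega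
  have e3 : max (max x (y - x - 3)) (-y - 3) = x := by omega
  have e4 : min (min x (y - x)) (-y) = -y := by omega
  have e5 : min (min x (y - x)) (-y - 3) = -y - 3 := by omega
  have e6 : min (min x (y - x - 3)) (-y - 3) = -y - 3 := by omega
  rw [e1, e2, e3, e4, e5, e6]
  simp only [max_le_iff, le_min_iff]
  omega

theorem tauZ_mem_interval {x y z : ℤ × ℤ} (hx : IsDom x) (hy : IsDom y) (hz : IsAlc z)
    (h1 : BruhatCrit x z) (h2 : BruhatCrit z y) :
    BruhatCrit (x.1 + 2, x.2 + 1) (tauZ z) ∧ BruhatCrit (tauZ z) (y.1 + 2, y.2 + 1) := by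
  have hx' : IsDom (x.1 + 2, x.2 + 1) := by simp only [IsDom] at *; omega
  have hy' : IsDom (y.1 + 2, y.2 + 1) := by simp only [IsDom] at *; omega
  rw [bruhatCrit_of_isDom_left hx']
  rw [bruhatCrit_of_isDom_left hx] at h1
  rw [bruhatCrit_of_isDom_right hy']
  rw [bruhatCrit_of_isDom_right hy] at h2
  obtain ⟨x1, x2⟩ := x
  obtain ⟨y1, y2⟩ := y
  obtain ⟨z1, z2⟩ := z
  simp only [IsDom, IsAlc, tauZ] at *
  split_ifs <;> dsimp only <;> omega

theorem tauZ_injOn {z w : ℤ × ℤ} (hz : IsAlc z) (hw : IsAlc w) (h : tauZ z = tauZ w)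
    (hz' : z ≠ (-1, -1)) (hw' : w ≠ (-1, -1)) : z = w := by
  obtain ⟨x1, x2⟩ := w
  obtain ⟨z1, z2⟩ := z
  simp only [IsAlc, tauZ] at *
  split_ifs at h <;> simp at * <;> omega

theorem exists_tauZ_eq {x y w : ℤ × ℤ} (hx : IsDom x) (hy : IsDom y) (hw : IsAlc w)
    (h1 : BruhatCrit (x.1 + 2, x.2 + 1) w) (h2 : BruhatCrit w (y.1 + 2, y.2 + 1))
    (hc : -3 ≤ 2 * x.1 - y.2) : ∃ z, IsAlc z ∧ BruhatCrit x z ∧ BruhatCrit z y ∧ tauZ z = w := by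
  have hx' : IsDom (x.1 + 2, x.2 + 1) := by simp only [IsDom] at *; omega
  have hy' : IsDom (y.1 + 2, y.2 + 1) := by simp only [IsDom] at *; omega
  rw [bruhatCrit_of_isDom_left hx'] at h1
  simp only [bruhatCrit_of_isDom_left hx, bruhatCrit_of_isDom_right hy]
  rw [bruhatCrit_of_isDom_right hy'] at h2
  obtain ⟨x1, x2⟩ := x
  obtain ⟨y1, y2⟩ := y
  obtain ⟨z1, z2⟩ := w
  simp only [IsDom, IsAlc, tauZ] at *
  by_cases c1 : 2 * z1 - z2 < 0 ∧ 0 < 2 * z2 - z1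
  · refine ⟨(z1 + 1, z2 - 1), ?_⟩
    split_ifs <;> simp <;> omega
  · by_cases c2 : 0 < z1 + z2 ∧ 0 < 2 * z1 - z2
    · refine ⟨(z1 - 2, z2 - 1), ?_⟩
      split_ifs <;> simp <;> omega
    · refine ⟨(z1 + 1, z2 + 2), ?_⟩
      split_ifs <;> simp <;> omega

theorem exists_forall_tauZ_ne {x y : ℤ × ℤ} (hx : IsDom x) (hy : IsDom y) (hxa : IsAlc x)
    (hya : IsAlc y) (hc : 2 * x.1 - y.2 < -3) :
    ∃ w, IsAlc w ∧ BruhatCrit (x.1 + 2, x.2 + 1) w ∧ BruhatCrit w (y.1 + 2, y.2 + 1) ∧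
      ∀ z, IsAlc z → z ≠ (-1, -1) → tauZ z ≠ w := by
  have hx' : IsDom (x.1 + 2, x.2 + 1) := by simp only [IsDom] at *; omega
  have hy' : IsDom (y.1 + 2, y.2 + 1) := by simp only [IsDom] at *; omega
  simp only [bruhatCrit_of_isDom_left hx', bruhatCrit_of_isDom_right hy']
  obtain ⟨x1, x2⟩ := x
  obtain ⟨y1, y2⟩ := y
  refine ⟨(x1 + 2, 2 * (x1 + 2) + 1), ?_, ?_, ?_, ?_⟩
  · simp only [IsDom, IsAlc] at *; omega
  · simp only [IsDom, IsAlc] at *; omega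
  · simp only [IsDom, IsAlc] at *; omega
  · rintro ⟨z1, z2⟩ hz hze
    simp only [IsDom, IsAlc, tauZ] at *
    split_ifs <;> simp at * <;> omega

theorem tauZ_min_shift {x y z : ℤ × ℤ} (hx : IsDom x) (hy : IsDom y) (hc : -3 ≤ 2 * x.1 - y.2)
    (hz : IsAlc z) (h1 : BruhatCrit x z) (h2 : BruhatCrit z y) :
    max (max (tauZ z).1 ((tauZ z).2 - (tauZ z).1 - 3)) (-(tauZ z).2 - 3) =
      max (max z.1 (z.2 - z.1 - 3)) (-z.2 - 3) + 2 ∧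
    min (min (tauZ z).1 ((tauZ z).2 - (tauZ z).1)) (-(tauZ z).2) =
      min (min z.1 (z.2 - z.1)) (-z.2) - 1 ∧
    min (min (tauZ z).1 ((tauZ z).2 - (tauZ z).1)) (-(tauZ z).2 - 3) =
      min (min z.1 (z.2 - z.1)) (-z.2 - 3) - 1 ∧
    min (min (tauZ z).1 ((tauZ z).2 - (tauZ z).1 - 3)) (-(tauZ z).2 - 3) =
      min (min z.1 (z.2 - z.1 - 3)) (-z.2 - 3) - 1 := by
  rw [bruhatCrit_of_isDom_left hx] at h1
  rw [bruhatCrit_of_isDom_right hy] at h2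
  obtain ⟨x1, x2⟩ := x
  obtain ⟨y1, y2⟩ := y
  obtain ⟨z1, z2⟩ := z
  simp only [IsDom, IsAlc, tauZ] at *
  split_ifs <;> dsimp only <;> refine ⟨?_, ?_, ?_, ?_⟩ <;> omega

theorem tauZ_max_shift {x y z : ℤ × ℤ} (hx : IsDom x) (hy : IsDom y) (hc : -3 ≤ 2 * x.1 - y.2)
    (hz : IsAlc z) (h1 : BruhatCrit x z) (h2 : BruhatCrit z y) :
    ((tauZ z).1 = z.1 + 2 ∧ (tauZ z).2 = z.2 + 1 ∧ -3 < z.1 + z.2 ∧ -3 ≤ 2 * z.1 - z.2) ∨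
    (max (max (tauZ z).1 ((tauZ z).2 - (tauZ z).1)) (-(tauZ z).2) =
        max (max z.1 (z.2 - z.1)) (-z.2) + 2 ∧
      max (max (tauZ z).1 ((tauZ z).2 - (tauZ z).1)) (-(tauZ z).2 - 3) =
        max (max z.1 (z.2 - z.1)) (-z.2 - 3) + 2 ∧ (2 * z.1 - z.2 < -3 ∨ z.1 + z.2 < -3)) := by
  rw [bruhatCrit_of_isDom_left hx] at h1
  rw [bruhatCrit_of_isDom_right hy] at h2
  obtain ⟨x1, x2⟩ := x
  obtain ⟨y1, y2⟩ := y
  obtain ⟨z1, z2⟩ := z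
  simp only [IsDom, IsAlc, tauZ] at *
  split_ifs <;> dsimp only <;> omega

set_option maxHeartbeats 2000000 in
theorem bruhatCrit_tauZ_iff {x y z w : ℤ × ℤ} (hx : IsDom x) (hy : IsDom y)
    (hc : -3 ≤ 2 * x.1 - y.2) (hz : IsAlc z) (hw : IsAlc w)
    (h1 : BruhatCrit x z) (h2 : BruhatCrit z y) (h3 : BruhatCrit x w) (h4 : BruhatCrit w y) :
    BruhatCrit (tauZ z) (tauZ w) ↔ BruhatCrit z w := by
  obtain ⟨s1, s2, s3, s4⟩ := tauZ_min_shift hx hy hc hz h1 h2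
  obtain ⟨t1, t2, t3, t4⟩ := tauZ_min_shift hx hy hc hw h3 h4
  have S := tauZ_max_shift hx hy hc hz h1 h2
  have T := tauZ_max_shift hx hy hc hw h3 h4
  rw [bruhatCrit_of_isDom_left hx] at h1 h3
  rw [bruhatCrit_of_isDom_right hy] at h2 h4
  unfold BruhatCrit
  rw [s1, s2, s3, s4, t1, t2, t3, t4]
  simp only [add_le_add_iff_right, sub_le_sub_iff_right]
  clear s1 s2 s3 s4 t1 t2 t3 t4
  generalize tauZ z = z' at *
  generalize tauZ w = w' at *
  obtain ⟨x1, x2⟩ := x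
  obtain ⟨y1, y2⟩ := y
  obtain ⟨z1, z2⟩ := z
  obtain ⟨w1, w2⟩ := w
  obtain ⟨z1', z2'⟩ := z'
  obtain ⟨w1', w2'⟩ := w'
  simp only [IsDom, IsAlc] at *
  rcases S with ⟨rfl, rfl, S1, S2⟩ | ⟨S1, S2, S3⟩ <;>
    rcases T with ⟨rfl, rfl, T1, T2⟩ | ⟨T1, T2, T3⟩
  · constructor
    · rintro ⟨g1, g2, g3, g4, g5, g6⟩
      refine ⟨?_, ?_, g3, g4, g5, g6⟩
      · clear g2 g3 g5 g6; omega
      · clear g1 g3 g4 g6; omega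
    · rintro ⟨g1, g2, g3, g4, g5, g6⟩
      refine ⟨?_, ?_, g3, g4, g5, g6⟩
      · clear g2 g4 g5 g6; omega
      · clear g1 g4 g5 g6; omega
  · rw [T1, T2]
    constructor
    · rintro ⟨g1, g2, g3, g4, g5, g6⟩
      refine ⟨?_, ?_, g3, g4, g5, g6⟩
      · clear T1 T2 g2 g3 g5 g6; omega
      · clear T1 T2 g1 g3 g4 g6; omega
    · rintro ⟨g1, g2, g3, g4, g5, g6⟩
      refine ⟨?_, ?_, g3, g4, g5, g6⟩
      · clear T1 T2 g2 g4 g5 g6; omega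
      · clear T1 T2 g1 g4 g5 g6; omega
  · rw [S1, S2]
    constructor
    · rintro ⟨g1, g2, g3, g4, g5, g6⟩
      refine ⟨?_, ?_, g3, g4, g5, g6⟩
      · clear S1 S2 g2 g3 g5 g6; omega
      · clear S1 S2 g1 g3 g4 g6; omega
    · rintro ⟨g1, g2, g3, g4, g5, g6⟩
      refine ⟨?_, ?_, g3, g4, g5, g6⟩
      · clear S1 S2 g2 g4 g5 g6; omega
      · clear S1 S2 g1 g4 g5 g6; omega
  · rw [S1, S2, T1, T2]
    simp only [add_le_add_iff_right]

/-- A relation on `W` modelled on the Bruhat order of alcoves through the coordinates `U`. -/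
structure AlcoveModel {W : Type*} (le : W → W → Prop) (U : W → ℤ × ℤ) : Prop where
  inj : Function.Injective U
  isAlc : ∀ z, IsAlc (U z)
  surj : ∀ a, IsAlc a → ∃ z, U z = a
  le_iff : ∀ z w, le z w ↔ BruhatCrit (U z) (U w)

/-- The map `f` is an isomorphism between the intervals `[x, y]` and `[x', y']`. -/
def IsoOn {W : Type*} (le : W → W → Prop) (f : W → W) (x y x' y' : W) : Prop :=
  Set.BijOn f {z | le x z ∧ le z y} {z | le x' z ∧ le z y'} ∧
    ∀ u ∈ {z | le x z ∧ le z y}, ∀ v ∈ {z | le x z ∧ le z y}, (le u v ↔ le (f u) (f v))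

theorem IsoOn.comp {W : Type*} {le : W → W → Prop} {f g : W → W} {x y x' y' x'' y'' : W}
    (hg : IsoOn le g x' y' x'' y'') (hf : IsoOn le f x y x' y') :
    IsoOn le (g ∘ f) x y x'' y'' :=
  ⟨hg.1.comp hf.1, fun u hu v hv => (hf.2 u hu v hv).trans
    (hg.2 _ (hf.1.mapsTo hu) _ (hf.1.mapsTo hv))⟩

theorem IsoOn.id {W : Type*} (le : W → W → Prop) (x y : W) : IsoOn le id x y x y :=
  ⟨Set.bijOn_id _, fun _ _ _ _ => Iff.rfl⟩

theorem IsDom.swap {a : ℤ × ℤ} (h : IsDom a) : IsDom a.swap := ⟨h.2, h.1⟩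

theorem IsDom.add {a : ℤ × ℤ} (h : IsDom a) (m n : ℕ) :
    IsDom (a.1 + (2 * m + n), a.2 + (m + 2 * n)) := by
  simp only [IsDom] at *
  omega

theorem IsAlc.add {a : ℤ × ℤ} (h : IsAlc a) (m n : ℕ) :
    IsAlc (a.1 + (2 * m + n), a.2 + (m + 2 * n)) := by
  simp only [IsAlc] at *
  omega

namespace AlcoveModel

variable {W : Type*} {le : W → W → Prop} {U : W → ℤ × ℤ}

theorem swap (h : AlcoveModel le U) : AlcoveModel le (fun z => (U z).swap) where
  inj := Prod.swap_injective.comp h.inj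
  isAlc z := (h.isAlc z).swap
  surj a ha := by
    obtain ⟨z, hz⟩ := h.surj _ ha.swap
    exact ⟨z, by rw [hz, Prod.swap_swap]⟩
  le_iff z w := by rw [h.le_iff, bruhatCrit_swap]

theorem finite_interval (h : AlcoveModel le U) {x y : W} (hy : IsDom (U y)) :
    {z | le x z ∧ le z y}.Finite := by
  refine Set.Finite.of_finite_image (f := U) ?_ h.inj.injOn
  refine (Set.finite_Icc ((-(U y).2, -(U y).1) : ℤ × ℤ) ((U y).1, (U y).2)).subset ?_
  rintro _ ⟨z, ⟨-, hz⟩, rfl⟩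
  rw [h.le_iff, bruhatCrit_of_isDom_right hy] at hz
  simp only [Set.mem_Icc, Prod.le_def]
  omega

theorem ne_base (h : AlcoveModel le U) {x z : W} (hx : IsDom (U x)) (hz : le x z) :
    U z ≠ (-1, -1) := by
  intro hc
  rw [h.le_iff, hc] at hz
  rw [eq_base_of_bruhatCrit (h.isAlc x) hz] at hx
  simp [IsDom] at hx

variable {t : W → W} {x y x' y' : W}

theorem mapsTo (h : AlcoveModel le U) (ht : ∀ z, U z ≠ (-1, -1) → U (t z) = tauZ (U z))
    (hx : IsDom (U x)) (hy : IsDom (U y)) (hx' : U x' = ((U x).1 + 2, (U x).2 + 1))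
    (hy' : U y' = ((U y).1 + 2, (U y).2 + 1)) :
    Set.MapsTo t {z | le x z ∧ le z y} {z | le x' z ∧ le z y'} := by
  rintro z ⟨hz1, hz2⟩
  have := h.ne_base hx hz1
  simp only [Set.mem_ofPred_eq, h.le_iff, ht z this, hx', hy'] at *
  exact tauZ_mem_interval hx hy (h.isAlc z) hz1 hz2

theorem injOn (h : AlcoveModel le U) (ht : ∀ z, U z ≠ (-1, -1) → U (t z) = tauZ (U z))
    (hx : IsDom (U x)) : Set.InjOn t {z | le x z ∧ le z y} := by
  rintro z hz w hw hzw
  have hz' := h.ne_base hx hz.1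
  have hw' := h.ne_base hx hw.1
  refine h.inj (tauZ_injOn (h.isAlc z) (h.isAlc w) ?_ hz' hw')
  rw [← ht z hz', ← ht w hw', hzw]

theorem isoOn (h : AlcoveModel le U) (ht : ∀ z, U z ≠ (-1, -1) → U (t z) = tauZ (U z))
    (hx : IsDom (U x)) (hy : IsDom (U y)) (hx' : U x' = ((U x).1 + 2, (U x).2 + 1))
    (hy' : U y' = ((U y).1 + 2, (U y).2 + 1)) (hc : -3 ≤ 2 * (U x).1 - (U y).2) :
    IsoOn le t x y x' y' := by
  refine ⟨⟨h.mapsTo ht hx hy hx' hy', h.injOn ht hx, ?_⟩, ?_⟩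
  · rintro w ⟨hw1, hw2⟩
    rw [h.le_iff, hx'] at hw1
    rw [h.le_iff, hy'] at hw2
    obtain ⟨c, hca, hc1, hc2, hcw⟩ := exists_tauZ_eq hx hy (h.isAlc w) hw1 hw2 hc
    obtain ⟨z, rfl⟩ := h.surj c hca
    rw [← h.le_iff] at hc1 hc2
    exact ⟨z, ⟨hc1, hc2⟩, h.inj (by rw [ht z (h.ne_base hx hc1), hcw])⟩
  · rintro u ⟨hu1, hu2⟩ v ⟨hv1, hv2⟩
    have hu := h.ne_base hx hu1
    have hv := h.ne_base hx hv1
    rw [h.le_iff] at hu1 hu2 hv1 hv2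
    rw [h.le_iff, h.le_iff, ht u hu, ht v hv,
      bruhatCrit_tauZ_iff hx hy hc (h.isAlc u) (h.isAlc v) hu1 hu2 hv1 hv2]

theorem ncard_le_step (h : AlcoveModel le U)
    (ht : ∀ z, U z ≠ (-1, -1) → U (t z) = tauZ (U z))
    (hx : IsDom (U x)) (hy : IsDom (U y)) (hx' : U x' = ((U x).1 + 2, (U x).2 + 1))
    (hy' : U y' = ((U y).1 + 2, (U y).2 + 1)) :
    {z | le x z ∧ le z y}.ncard ≤ {z | le x' z ∧ le z y'}.ncard := by
  refine Set.ncard_le_ncard_of_injOn t (h.mapsTo ht hx hy hx' hy') (h.injOn ht hx) ?_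
  refine h.finite_interval ?_
  rw [hy']
  simpa using hy.add 1 0

theorem ncard_lt_step (h : AlcoveModel le U)
    (ht : ∀ z, U z ≠ (-1, -1) → U (t z) = tauZ (U z))
    (hx : IsDom (U x)) (hy : IsDom (U y)) (hx' : U x' = ((U x).1 + 2, (U x).2 + 1))
    (hy' : U y' = ((U y).1 + 2, (U y).2 + 1)) (hc : 2 * (U x).1 - (U y).2 < -3) :
    {z | le x z ∧ le z y}.ncard < {z | le x' z ∧ le z y'}.ncard := by
  rw [← Set.InjOn.ncard_image (h.injOn ht hx)]
  refine Set.ncard_lt_ncard ⟨(h.mapsTo ht hx hy hx' hy').image_subset, fun hs => ?_⟩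
    (h.finite_interval ?_)
  · obtain ⟨c, hca, hc1, hc2, hcw⟩ :=
      exists_forall_tauZ_ne hx hy (h.isAlc x) (h.isAlc y) hc
    obtain ⟨w, rfl⟩ := h.surj c hca
    rw [← hx', ← h.le_iff] at hc1
    rw [← hy', ← h.le_iff] at hc2
    obtain ⟨z, hz, rfl⟩ := hs ⟨hc1, hc2⟩
    have := h.ne_base hx hz.1
    exact hcw _ (h.isAlc z) this (ht z this).symm
  · rw [hy']
    simpa using hy.add 1 0

theorem iterate_isoOn (h : AlcoveModel le U)
    (ht : ∀ z, U z ≠ (-1, -1) → U (t z) = tauZ (U z)) (n : ℕ) :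
    ∀ {x y x' y' : W}, IsDom (U x) → IsDom (U y) → U x' = ((U x).1 + 2 * n, (U x).2 + n) →
    U y' = ((U y).1 + 2 * n, (U y).2 + n) → -3 ≤ 2 * (U x).1 - (U y).2 →
    IsoOn le t^[n] x y x' y' := by
  induction n with
  | zero =>
    intro x y x' y' _ _ hx' hy' _
    obtain rfl : x' = x := h.inj (by simpa using hx')
    obtain rfl : y' = y := h.inj (by simpa using hy')
    exact IsoOn.id _ _ _
  | succ n ih =>
    intro x y x' y' hx hy hx' hy' hc
    obtain ⟨x₁, hx₁⟩ := h.surj _ ((h.isAlc x).add 1 0)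
    obtain ⟨y₁, hy₁⟩ := h.surj _ ((h.isAlc y).add 1 0)
    have hdx := hx.add 1 0
    have hdy := hy.add 1 0
    rw [← hx₁] at hdx
    rw [← hy₁] at hdy
    push_cast at hx' hy' hx₁ hy₁
    rw [Function.iterate_succ]
    refine (ih hdx hdy ?_ ?_ ?_).comp (h.isoOn ht hx hy (by simpa using hx₁)
      (by simpa using hy₁) hc)
    · rw [hx', hx₁]; ext <;> dsimp only <;> ring
    · rw [hy', hy₁]; ext <;> dsimp only <;> ring
    · rw [hx₁, hy₁]; dsimp only; omega

theorem ncard_le_iterate (h : AlcoveModel le U)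
    (ht : ∀ z, U z ≠ (-1, -1) → U (t z) = tauZ (U z)) (n : ℕ) :
    ∀ {x y x' y' : W}, IsDom (U x) → IsDom (U y) → U x' = ((U x).1 + 2 * n, (U x).2 + n) →
    U y' = ((U y).1 + 2 * n, (U y).2 + n) →
    {z | le x z ∧ le z y}.ncard ≤ {z | le x' z ∧ le z y'}.ncard := by
  induction n with
  | zero =>
    intro x y x' y' _ _ hx' hy'
    obtain rfl : x' = x := h.inj (by simpa using hx')
    obtain rfl : y' = y := h.inj (by simpa using hy')
    rfl
  | succ n ih =>
    intro x y x' y' hx hy hx' hy'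
    obtain ⟨x₁, hx₁⟩ := h.surj _ ((h.isAlc x).add 1 0)
    obtain ⟨y₁, hy₁⟩ := h.surj _ ((h.isAlc y).add 1 0)
    have hdx := hx.add 1 0
    have hdy := hy.add 1 0
    rw [← hx₁] at hdx
    rw [← hy₁] at hdy
    push_cast at hx' hy' hx₁ hy₁
    refine (h.ncard_le_step ht hx hy (by simpa using hx₁) (by simpa using hy₁)).trans
      (ih hdx hdy ?_ ?_)
    · rw [hx', hx₁]; ext <;> dsimp only <;> ring
    · rw [hy', hy₁]; ext <;> dsimp only <;> ring

variable {t₁ t₂ : W → W}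

theorem isoOn_iterate_comp (h : AlcoveModel le U)
    (ht₁ : ∀ z, U z ≠ (-1, -1) → U (t₁ z) = tauZ (U z))
    (ht₂ : ∀ z, U z ≠ (-1, -1) → U (t₂ z) = (tauZ (U z).swap).swap) {a b : ℕ}
    (hx : IsDom (U x)) (hy : IsDom (U y))
    (hx' : U x' = ((U x).1 + (2 * a + b), (U x).2 + (a + 2 * b)))
    (hy' : U y' = ((U y).1 + (2 * a + b), (U y).2 + (a + 2 * b)))
    (ha : a = 0 ∨ -3 ≤ 2 * (U x).1 - (U y).2) (hb : b = 0 ∨ -3 ≤ 2 * (U x).2 - (U y).1) :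
    IsoOn le (t₁^[a] ∘ t₂^[b]) x y x' y' := by
  obtain ⟨x₁, hx₁⟩ := h.surj _ ((h.isAlc x).add 0 b)
  obtain ⟨y₁, hy₁⟩ := h.surj _ ((h.isAlc y).add 0 b)
  have hdx := hx.add 0 b
  have hdy := hy.add 0 b
  rw [← hx₁] at hdx
  rw [← hy₁] at hdy
  push_cast at hx₁ hy₁
  refine IsoOn.comp (x' := x₁) (y' := y₁) ?_ ?_
  · rcases ha with rfl | ha
    · obtain rfl : x' = x₁ := h.inj (by rw [hx', hx₁]; simp)
      obtain rfl : y' = y₁ := h.inj (by rw [hy', hy₁]; simp)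
      exact IsoOn.id _ _ _
    · refine h.iterate_isoOn ht₁ a hdx hdy ?_ ?_ ?_
      · rw [hx', hx₁]; ext <;> dsimp only <;> ring
      · rw [hy', hy₁]; ext <;> dsimp only <;> ring
      · rw [hx₁, hy₁]; dsimp only; omega
  · rcases hb with rfl | hb
    · obtain rfl : x₁ = x := h.inj (by rw [hx₁]; simp)
      obtain rfl : y₁ = y := h.inj (by rw [hy₁]; simp)
      exact IsoOn.id _ _ _
    · refine h.swap.iterate_isoOn (t := t₂) ?_ b hx.swap hy.swap ?_ ?_ hb
      · intro z hz
        rw [ht₂ z (fun h => hz (by rw [h]; rfl)), Prod.swap_swap]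
      · rw [hx₁]; ext <;> dsimp only [Prod.swap] <;> ring
      · rw [hy₁]; ext <;> dsimp only [Prod.swap] <;> ring

theorem ncard_le (h : AlcoveModel le U)
    (ht₁ : ∀ z, U z ≠ (-1, -1) → U (t₁ z) = tauZ (U z))
    (ht₂ : ∀ z, U z ≠ (-1, -1) → U (t₂ z) = (tauZ (U z).swap).swap) {a b : ℕ}
    (hx : IsDom (U x)) (hy : IsDom (U y))
    (hx' : U x' = ((U x).1 + (2 * a + b), (U x).2 + (a + 2 * b)))
    (hy' : U y' = ((U y).1 + (2 * a + b), (U y).2 + (a + 2 * b))) :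
    {z | le x z ∧ le z y}.ncard ≤ {z | le x' z ∧ le z y'}.ncard := by
  obtain ⟨x₁, hx₁⟩ := h.surj _ ((h.isAlc x).add 0 b)
  obtain ⟨y₁, hy₁⟩ := h.surj _ ((h.isAlc y).add 0 b)
  have hdx := hx.add 0 b
  have hdy := hy.add 0 b
  rw [← hx₁] at hdx
  rw [← hy₁] at hdy
  push_cast at hx₁ hy₁
  refine le_trans (b := {z | le x₁ z ∧ le z y₁}.ncard) ?_ ?_
  · refine h.swap.ncard_le_iterate (t := t₂) ?_ b hx.swap hy.swap ?_ ?_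
    · intro z hz
      rw [ht₂ z (fun h => hz (by rw [h]; rfl)), Prod.swap_swap]
    · rw [hx₁]; ext <;> dsimp only [Prod.swap] <;> ring
    · rw [hy₁]; ext <;> dsimp only [Prod.swap] <;> ring
  · refine h.ncard_le_iterate ht₁ a hdx hdy ?_ ?_
    · rw [hx', hx₁]; ext <;> dsimp only <;> ring
    · rw [hy', hy₁]; ext <;> dsimp only <;> ring

theorem ncard_lt_of_cut (h : AlcoveModel le U)
    (ht₁ : ∀ z, U z ≠ (-1, -1) → U (t₁ z) = tauZ (U z))
    (ht₂ : ∀ z, U z ≠ (-1, -1) → U (t₂ z) = (tauZ (U z).swap).swap) {a b : ℕ}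
    (hx : IsDom (U x)) (hy : IsDom (U y))
    (hx' : U x' = ((U x).1 + (2 * a + b), (U x).2 + (a + 2 * b)))
    (hy' : U y' = ((U y).1 + (2 * a + b), (U y).2 + (a + 2 * b)))
    (ha : a ≠ 0) (hc : 2 * (U x).1 - (U y).2 < -3) :
    {z | le x z ∧ le z y}.ncard < {z | le x' z ∧ le z y'}.ncard := by
  obtain ⟨c, rfl⟩ := Nat.exists_eq_succ_of_ne_zero ha
  obtain ⟨x₁, hx₁⟩ := h.surj _ ((h.isAlc x).add 1 0)
  obtain ⟨y₁, hy₁⟩ := h.surj _ ((h.isAlc y).add 1 0)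
  have hdx := hx.add 1 0
  have hdy := hy.add 1 0
  rw [← hx₁] at hdx
  rw [← hy₁] at hdy
  push_cast at hx₁ hy₁ hx' hy'
  refine (h.ncard_lt_step ht₁ hx hy (by simpa using hx₁) (by simpa using hy₁) hc).trans_le
    (h.ncard_le ht₁ ht₂ (a := c) (b := b) hdx hdy ?_ ?_)
  · rw [hx', hx₁]; ext <;> dsimp only <;> ring
  · rw [hy', hy₁]; ext <;> dsimp only <;> ring

theorem ncard_lt_of_cut' (h : AlcoveModel le U)
    (ht₁ : ∀ z, U z ≠ (-1, -1) → U (t₁ z) = tauZ (U z))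
    (ht₂ : ∀ z, U z ≠ (-1, -1) → U (t₂ z) = (tauZ (U z).swap).swap) {a b : ℕ}
    (hx : IsDom (U x)) (hy : IsDom (U y))
    (hx' : U x' = ((U x).1 + (2 * a + b), (U x).2 + (a + 2 * b)))
    (hy' : U y' = ((U y).1 + (2 * a + b), (U y).2 + (a + 2 * b)))
    (hb : b ≠ 0) (hc : 2 * (U x).2 - (U y).1 < -3) :
    {z | le x z ∧ le z y}.ncard < {z | le x' z ∧ le z y'}.ncard := by
  refine h.swap.ncard_lt_of_cut (t₁ := t₂) (t₂ := t₁) (a := b) (b := a) ?_ ?_ hx.swap hy.swap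
    ?_ ?_ hb hc
  · intro z hz
    rw [ht₂ z (fun h => hz (by rw [h]; rfl)), Prod.swap_swap]
  · intro z hz
    rw [ht₁ z (fun h => hz (by rw [h]; rfl)), Prod.swap_swap]
  · rw [hx']; ext <;> dsimp only [Prod.swap] <;> ring
  · rw [hy']; ext <;> dsimp only [Prod.swap] <;> ring

end AlcoveModel

section BruhatModel

variable {W : Type*} [Group W] {M : CoxeterMatrix (Fin 3)} {cs : CoxeterSystem M W}
  {U : W → ℤ × ℤ}

theorem isAlc_of_simple (h1 : U 1 = (-1, -1)) (hs : ∀ i z, U (cs.simple i * z) = simZ i (U z))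
    (z : W) : IsAlc (U z) := by
  induction z using cs.simple_induction_left with
  | one => rw [h1]; exact isAlc_base
  | mul_simple_left w i ih => rw [hs]; exact ih.simZ i

theorem exists_alcLen_simZ_lt {a : ℤ × ℤ} (h : IsAlc a) (ha : a ≠ (-1, -1)) :
    ∃ i, ¬ SameSide (rootVal i a) (wallLevel i) ∧ alcLen a = alcLen (simZ i a) + 1 := by
  obtain ⟨i, hi⟩ := exists_not_sameSide h ha
  refine ⟨i, hi, ?_⟩
  have := alcLen_simZ (h.simZ i) ((not_sameSide_iff h i _).1 hi)
  rwa [simZ_simZ] at this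

theorem surj_of_simple (h1 : U 1 = (-1, -1)) (hs : ∀ i z, U (cs.simple i * z) = simZ i (U z))
    (a : ℤ × ℤ) (ha : IsAlc a) : ∃ z, U z = a := by
  obtain ⟨n, hn⟩ : ∃ n, alcLen a = n := ⟨_, rfl⟩
  induction n using Nat.strong_induction_on generalizing a with
  | _ n ih =>
    by_cases hb : a = (-1, -1)
    · exact ⟨1, by rw [h1, hb]⟩
    · obtain ⟨i, -, hi⟩ := exists_alcLen_simZ_lt ha hb
      obtain ⟨z, hz⟩ := ih _ (by omega) (simZ i a) (ha.simZ i) rfl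
      exact ⟨cs.simple i * z, by rw [hs, hz, simZ_simZ]⟩

theorem alcLen_simZ_le {a : ℤ × ℤ} (ha : IsAlc a) (i : Fin 3) :
    alcLen (simZ i a) ≤ alcLen a + 1 := by
  by_cases h : SameSide (rootVal i a) (wallLevel i)
  · exact (alcLen_simZ ha h).le
  · have := alcLen_simZ (ha.simZ i) ((not_sameSide_iff ha i _).1 h)
    rw [simZ_simZ] at this
    omega

theorem length_eq_alcLen (hinj : Function.Injective U) (h1 : U 1 = (-1, -1))
    (hs : ∀ i z, U (cs.simple i * z) = simZ i (U z)) (z : W) :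
    cs.length z = alcLen (U z) := by
  apply le_antisymm
  · obtain ⟨n, hn⟩ : ∃ n, alcLen (U z) = n := ⟨_, rfl⟩
    induction n using Nat.strong_induction_on generalizing z with
    | _ n ih =>
      by_cases hb : U z = (-1, -1)
      · obtain rfl : z = 1 := hinj (hb.trans h1.symm)
        simp
      · obtain ⟨i, -, hi⟩ := exists_alcLen_simZ_lt (isAlc_of_simple h1 hs z) hb
        rw [← hs] at hi
        have h := ih _ (by omega) (cs.simple i * z) rfl
        have := cs.length_mul_le (cs.simple i) (cs.simple i * z)
        rw [cs.simple_mul_simple_cancel_left, cs.length_simple] at this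
        omega
  · obtain ⟨ω, hω, rfl⟩ := cs.exists_isReduced z
    rw [hω]
    clear hω
    induction ω with
    | nil => simp [h1, alcLen_base]
    | cons i ω ih =>
      rw [cs.wordProd_cons, hs, List.length_cons]
      exact (alcLen_simZ_le (isAlc_of_simple h1 hs _) i).trans (by omega)

theorem exists_refZ_of_isReflection (hs : ∀ i z, U (cs.simple i * z) = simZ i (U z)) {t : W}
    (ht : cs.IsReflection t) : ∃ j k, ∀ z, U (t * z) = refZ j k (U z) := by
  obtain ⟨w, i, rfl⟩ := ht
  induction w using cs.simple_induction_left with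
  | one => exact ⟨i, wallLevel i, fun z => by rw [one_mul, inv_one, mul_one]; exact hs i z⟩
  | mul_simple_left w j ih =>
    obtain ⟨i', k', h⟩ := ih
    obtain ⟨i'', k'', h'⟩ := refZ_comp_simZ i' j k'
    refine ⟨i'', k'', fun z => ?_⟩
    rw [← h', ← hs j z, ← h, ← hs]
    congr 1
    simp [mul_assoc]

theorem edge_iff_lt (hinj : Function.Injective U) (h1 : U 1 = (-1, -1))
    (hs : ∀ i z, U (cs.simple i * z) = simZ i (U z)) {a b t : W} (ht : cs.IsReflection t)
    (hb : b = t * a) : Edge (U a) (U b) ↔ cs.length a < cs.length b := by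
  rw [length_eq_alcLen hinj h1 hs, length_eq_alcLen hinj h1 hs]
  refine ⟨Edge.alcLen_lt (isAlc_of_simple h1 hs a), fun h => ?_⟩
  obtain ⟨j, k, hjk⟩ := exists_refZ_of_isReflection hs ht
  rw [hb, hjk] at h ⊢
  exact ⟨j, k, sameSide_of_alcLen_lt (isAlc_of_simple h1 hs a) h, rfl⟩

theorem bruhatLE_iff_reflTransGen {a b : W} : bruhatLE cs a b ↔ Relation.ReflTransGen
    (fun a b => (∃ t, cs.IsReflection t ∧ b = t * a) ∧ cs.length a < cs.length b) a b := by
  rw [Relation.reflTransGen_iff_eq_or_transGen, eq_comm]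
  rfl

theorem bruhatLE_trans {a b c : W} (h : bruhatLE cs a b) (h' : bruhatLE cs b c) :
    bruhatLE cs a c := by
  rw [bruhatLE_iff_reflTransGen] at *
  exact h.trans h'

theorem bruhatLE_simple_mul (hinj : Function.Injective U) (h1 : U 1 = (-1, -1))
    (hs : ∀ i z, U (cs.simple i * z) = simZ i (U z)) {x y : W} (h : bruhatLE cs x y)
    (i : Fin 3) : bruhatLE cs (cs.simple i * x) y ∨
      bruhatLE cs (cs.simple i * x) (cs.simple i * y) := by
  simp only [bruhatLE_iff_reflTransGen] at *
  induction h using Relation.ReflTransGen.head_induction_on with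
  | refl => exact Or.inr Relation.ReflTransGen.refl
  | head hac hcy ih =>
    rename_i a c
    obtain ⟨⟨t, ht, hc⟩, hlt⟩ := hac
    rcases ((edge_iff_lt hinj h1 hs ht hc).2 hlt).simZ i with h | h
    · rw [← hs] at h
      rw [← hinj h]
      exact Or.inl hcy
    · have hr : cs.IsReflection (cs.simple i * t * (cs.simple i)⁻¹) := ht.conj _
      have he : cs.simple i * c = (cs.simple i * t * (cs.simple i)⁻¹) * (cs.simple i * a) := by
        rw [hc]; group
      rw [← hs, ← hs, edge_iff_lt hinj h1 hs hr he] at h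
      exact ih.imp (Relation.ReflTransGen.head ⟨⟨_, hr, he⟩, h⟩)
        (Relation.ReflTransGen.head ⟨⟨_, hr, he⟩, h⟩)

theorem bruhatCrit_of_bruhatLE (hinj : Function.Injective U) (h1 : U 1 = (-1, -1))
    (hs : ∀ i z, U (cs.simple i * z) = simZ i (U z)) {x y : W} (h : bruhatLE cs x y) :
    BruhatCrit (U x) (U y) := by
  rw [bruhatLE_iff_reflTransGen] at h
  induction h with
  | refl => exact .refl _
  | tail _ hbc ih =>
    obtain ⟨⟨t, ht, hc⟩, hlt⟩ := hbc
    exact ih.trans (((edge_iff_lt hinj h1 hs ht hc).2 hlt).bruhatCrit (isAlc_of_simple h1 hs _))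

theorem bruhatLE_of_bruhatCrit (hinj : Function.Injective U) (h1 : U 1 = (-1, -1))
    (hs : ∀ i z, U (cs.simple i * z) = simZ i (U z)) {x y : W}
    (h : BruhatCrit (U x) (U y)) : bruhatLE cs x y := by
  obtain ⟨n, hn⟩ : ∃ n, alcLen (U y) = n := ⟨_, rfl⟩
  induction n using Nat.strong_induction_on generalizing x y with
  | _ n ih =>
    have hx := isAlc_of_simple h1 hs x
    have hy := isAlc_of_simple h1 hs y
    by_cases hb : U y = (-1, -1)
    · rw [hb] at h
      exact Or.inl (hinj ((eq_base_of_bruhatCrit hx h).trans hb.symm))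
    · obtain ⟨i, hi, hl⟩ := exists_alcLen_simZ_lt hy hb
      have hlt : cs.length (cs.simple i * y) < cs.length y := by
        rw [length_eq_alcLen hinj h1 hs, length_eq_alcLen hinj h1 hs, hs]
        omega
      have hle : bruhatLE cs (cs.simple i * y) y :=
        Or.inr (.single ⟨⟨cs.simple i, cs.isReflection_simple i, by simp⟩, hlt⟩)
      by_cases hxi : SameSide (rootVal i (U x)) (wallLevel i)
      · refine bruhatLE_trans (ih (alcLen (simZ i (U y))) (by omega) ?_ (by rw [hs])) hle
        rw [hs]
        exact h.simZ_right hy hi hxi hx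
      · have h' : bruhatLE cs (cs.simple i * x) (cs.simple i * y) := by
          refine ih (alcLen (simZ i (U y))) (by omega) ?_ (by rw [hs])
          rw [hs, hs]
          exact h.simZ_simZ hy hi hxi hx
        have := bruhatLE_simple_mul hinj h1 hs h' i
        rw [cs.simple_mul_simple_cancel_left, cs.simple_mul_simple_cancel_left] at this
        exact this.elim (fun h => bruhatLE_trans h hle) _root_.id

theorem alcoveModel_of_simple (hinj : Function.Injective U) (h1 : U 1 = (-1, -1))
    (hs : ∀ i z, U (cs.simple i * z) = simZ i (U z)) : AlcoveModel (bruhatLE cs) U where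
  inj := hinj
  isAlc := isAlc_of_simple h1 hs
  surj := surj_of_simple h1 hs
  le_iff _ _ := ⟨bruhatCrit_of_bruhatLE hinj h1 hs, bruhatLE_of_bruhatCrit hinj h1 hs⟩

end BruhatModel

section Geometry

/-- The point of the plane with three times the given root coordinates. -/
noncomputable def planePt (a : ℤ × ℤ) : E2 := ((a.1 : ℝ) / 3, (a.2 : ℝ) / 3)

theorem planePt_injective : Function.Injective planePt := by
  rintro ⟨a, b⟩ ⟨c, d⟩ h
  simp only [planePt, Prod.mk.injEq] at h ⊢
  constructor
  · have : (a : ℝ) = c := by linarith [h.1]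
    exact_mod_cast this
  · have : (b : ℝ) = d := by linarith [h.2]
    exact_mod_cast this

theorem planePt_add_weight (p : ℤ × ℤ) (a b : ℕ) :
    planePt p + ((a : ℝ) • fw1 + (b : ℝ) • fw2) =
      planePt (p.1 + (2 * a + b), p.2 + (a + 2 * b)) := by
  ext <;> simp [planePt, fw1, fw2] <;> ring

variable {W : Type*} [Group W] {M : CoxeterMatrix (Fin 3)} {cs : CoxeterSystem M W}
  {act : W →* Equiv.Perm E2} {U : W → ℤ × ℤ} {th ths : ℕ → ℕ → W} {tau : W → W}

theorem act_simple_planePt (h0 : ∀ v, act (cs.simple 0) v = reflE rho2 (-1) v)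
    (h1 : ∀ v, act (cs.simple 1) v = reflE a1 0 v) (h2 : ∀ v, act (cs.simple 2) v = reflE a2 0 v)
    (i : Fin 3) (a : ℤ × ℤ) : act (cs.simple i) (planePt a) = planePt (simZ i a) := by
  obtain rfl | rfl | rfl := fin_three_cases i
  · rw [h0]
    ext <;> simp [planePt, reflE, B2, rho2, simZ, refZ, wallLevel] <;> ring
  · rw [h1]
    ext <;> simp [planePt, reflE, B2, a1, simZ, refZ, wallLevel]; ring
  · rw [h2]
    ext <;> simp [planePt, reflE, B2, a2, simZ, refZ, wallLevel]; ring

theorem cen_one : cen act 1 = planePt (-1, -1) := by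
  rw [cen, map_one, Equiv.Perm.one_apply]
  ext <;> simp [planePt, rho2] <;> norm_num

theorem cen_simple_mul (h0 : ∀ v, act (cs.simple 0) v = reflE rho2 (-1) v)
    (h1 : ∀ v, act (cs.simple 1) v = reflE a1 0 v) (h2 : ∀ v, act (cs.simple 2) v = reflE a2 0 v)
    {z : W} {a : ℤ × ℤ} (hz : cen act z = planePt a) (i : Fin 3) :
    cen act (cs.simple i * z) = planePt (simZ i a) := by
  rw [← act_simple_planePt h0 h1 h2, ← hz, cen, cen, map_mul, Equiv.Perm.mul_apply]

theorem exists_planePt (h0 : ∀ v, act (cs.simple 0) v = reflE rho2 (-1) v)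
    (h1 : ∀ v, act (cs.simple 1) v = reflE a1 0 v) (h2 : ∀ v, act (cs.simple 2) v = reflE a2 0 v)
    (z : W) : ∃ a, cen act z = planePt a := by
  induction z using cs.simple_induction_left with
  | one => exact ⟨_, cen_one⟩
  | mul_simple_left w i ih =>
    obtain ⟨a, ha⟩ := ih
    exact ⟨_, cen_simple_mul h0 h1 h2 ha i⟩

theorem alcoveModel_of_cen (h0 : ∀ v, act (cs.simple 0) v = reflE rho2 (-1) v)
    (h1 : ∀ v, act (cs.simple 1) v = reflE a1 0 v) (h2 : ∀ v, act (cs.simple 2) v = reflE a2 0 v)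
    (hcen : Function.Injective (cen act)) (hU : ∀ z, cen act z = planePt (U z)) :
    AlcoveModel (bruhatLE cs) U := by
  refine alcoveModel_of_simple (fun a b h => hcen (by rw [hU, hU, h])) ?_ fun i z => ?_
  · exact planePt_injective (by rw [← hU, cen_one])
  · exact planePt_injective (by rw [← hU, cen_simple_mul h0 h1 h2 (hU z)])

theorem isDom_of_mem_Dset (h0 : ∀ v, act (cs.simple 0) v = reflE rho2 (-1) v)
    (h1 : ∀ v, act (cs.simple 1) v = reflE a1 0 v) (h2 : ∀ v, act (cs.simple 2) v = reflE a2 0 v)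
    (hU : ∀ z, cen act z = planePt (U z))
    (hth : ∀ m n : ℕ, cen act (th m n) =
      cen act (cs.simple 1 * cs.simple 2 * cs.simple 1) + (m : ℝ) • fw1 + (n : ℝ) • fw2)
    (hths : ∀ m n : ℕ, cen act (ths m n) =
      cen act 1 + ((m : ℝ) + 1) • fw1 + ((n : ℝ) + 1) • fw2)
    {x : W} (hx : x ∈ Dset th ths) : IsDom (U x) := by
  obtain ⟨m, n, rfl⟩ | ⟨m, n, rfl⟩ := hx
  · have hw : cen act (cs.simple 1 * cs.simple 2 * cs.simple 1) = planePt (1, 1) := by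
      have := cen_simple_mul h0 h1 h2
        (cen_simple_mul h0 h1 h2 (cen_simple_mul h0 h1 h2 (cen_one (act := act)) 1) 2) 1
      rw [← mul_assoc, ← mul_assoc, mul_one] at this
      rw [this]
      rfl
    have h := hth m n
    rw [hw, add_assoc, planePt_add_weight, hU] at h
    rw [planePt_injective h]
    constructor <;> dsimp only <;> omega
  · have h := hths m n
    rw [cen_one, add_assoc, ← Nat.cast_succ, ← Nat.cast_succ, planePt_add_weight, hU] at h
    rw [planePt_injective h]
    constructor <;> dsimp only <;> omega

theorem B2_planePt (a : ℤ × ℤ) : B2 a1 (planePt a) = ((2 * a.1 - a.2 : ℤ) : ℝ) / 3 ∧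
    B2 a2 (planePt a) = ((2 * a.2 - a.1 : ℤ) : ℝ) / 3 ∧
    B2 rho2 (planePt a) = ((a.1 + a.2 : ℤ) : ℝ) / 3 := by
  refine ⟨?_, ?_, ?_⟩ <;> simp [B2, planePt, a1, a2, rho2] <;> ring

theorem neg_one_le_div_three {n : ℤ} : (-1 : ℝ) ≤ (n : ℝ) / 3 ↔ -3 ≤ n := by
  rw [le_div_iff₀ (by norm_num)]
  exact_mod_cast Iff.rfl

theorem div_three_le_neg_one {n : ℤ} : (n : ℝ) / 3 ≤ -1 ↔ n ≤ -3 := by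
  rw [div_le_iff₀ (by norm_num)]
  exact_mod_cast Iff.rfl

theorem zero_le_div_three {n : ℤ} : (0 : ℝ) ≤ (n : ℝ) / 3 ↔ 0 ≤ n := by
  rw [le_div_iff₀ (by norm_num)]
  exact_mod_cast Iff.rfl

theorem div_three_le_zero {n : ℤ} : (n : ℝ) / 3 ≤ 0 ↔ n ≤ 0 := by
  rw [div_le_iff₀ (by norm_num)]
  exact_mod_cast Iff.rfl

theorem zoneOf_planePt_iff (w : W) (a : ℤ × ℤ) : zoneOf cs w (planePt a) ↔
    (w = 1 ∧ -3 ≤ 2 * a.1 - a.2 ∧ -3 ≤ 2 * a.2 - a.1 ∧ -3 ≤ a.1 + a.2) ∨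
    (w = cs.simple 1 ∧ 2 * a.1 - a.2 ≤ -3 ∧ -3 ≤ a.1 + a.2) ∨
    (w = cs.simple 2 ∧ 2 * a.2 - a.1 ≤ -3 ∧ -3 ≤ a.1 + a.2) ∨
    (w = cs.simple 1 * cs.simple 2 ∧ a.1 + a.2 ≤ -3 ∧ 0 ≤ 2 * a.2 - a.1) ∨
    (w = cs.simple 2 * cs.simple 1 ∧ a.1 + a.2 ≤ -3 ∧ 0 ≤ 2 * a.1 - a.2) ∨
    (w = cs.simple 1 * cs.simple 2 * cs.simple 1 ∧ 2 * a.1 - a.2 ≤ 0 ∧ 2 * a.2 - a.1 ≤ 0) := by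
  obtain ⟨e1, e2, e3⟩ := B2_planePt a
  simp only [zoneOf, Fid, Set.mem_ofPred_eq, e1, e2, e3, neg_one_le_div_three,
    div_three_le_neg_one, zero_le_div_three, div_three_le_zero]

theorem tauZ_of_zone (h1 : ∀ v, act (cs.simple 1) v = reflE a1 0 v)
    (h2 : ∀ v, act (cs.simple 2) v = reflE a2 0 v) {w : W} {a : ℤ × ℤ} (hA : IsAlc a)
    (ha : a ≠ (-1, -1)) (hw : zoneOf cs w (planePt a)) :
    planePt a + act w fw1 = planePt (tauZ a) ∧
      planePt a + act w fw2 = planePt (tauZ a.swap).swap := by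
  obtain ⟨x, y⟩ := a
  have hxy : ¬ (x = -1 ∧ y = -1) := fun h => ha (by rw [h.1, h.2])
  unfold IsAlc at hA
  rw [zoneOf_planePt_iff] at hw
  dsimp only at hA hw
  simp only [tauZ, Prod.swap]
  obtain ⟨rfl, hw⟩ | ⟨rfl, hw⟩ | ⟨rfl, hw⟩ | ⟨rfl, hw⟩ | ⟨rfl, hw⟩ | ⟨rfl, hw⟩ := hw <;>
  constructor <;> split_ifs <;> first
    | (exfalso; omega)
    | (simp only [map_mul, map_one, Equiv.Perm.mul_apply, Equiv.Perm.one_apply, h1, h2]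
       ext <;> simp [planePt, reflE, B2, fw1, fw2, a1, a2] <;> ring)

theorem coord_add_weight {Wadd : W → E2 → W} (hU : ∀ z, cen act z = planePt (U z))
    (hWadd : ∀ (z : W), ∀ v ∈ wLat, cen act (Wadd z v) = cen act z + v) (z : W) (a b : ℕ) :
    U (Wadd z ((a : ℝ) • fw1 + (b : ℝ) • fw2)) =
      ((U z).1 + (2 * a + b), (U z).2 + (a + 2 * b)) := by
  refine planePt_injective ?_
  rw [← hU, hWadd z _ ⟨a, b, by simp⟩, hU, planePt_add_weight]

end Geometry

section Polygon

/-- The part of the rectangle with opposite corners `l`, `h` that is cut out by the two lines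
bounding the dominant zone. -/
def cutRect (l h : E2) : Set E2 :=
  {v | (l.1 ≤ v.1 ∧ v.1 ≤ h.1) ∧ (l.2 ≤ v.2 ∧ v.2 ≤ h.2) ∧
    -1 ≤ 2 * v.1 - v.2 ∧ -1 ≤ 2 * v.2 - v.1}

/-- Points in the open dominant chamber. -/
def InChamber (v : E2) : Prop := 0 < 2 * v.1 - v.2 ∧ 0 < 2 * v.2 - v.1

theorem mem_extremePoints_of_linear {A : Set E2} {v : E2} (hv : v ∈ A) {p q r s : ℝ}
    (hdet : p * s - q * r ≠ 0) (h1 : ∀ u ∈ A, p * v.1 + q * v.2 ≤ p * u.1 + q * u.2)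
    (h2 : ∀ u ∈ A, r * v.1 + s * v.2 ≤ r * u.1 + s * u.2) : v ∈ Set.extremePoints ℝ A := by
  have key : ∀ {a b s t : ℝ}, 0 < a → 0 < b → 0 ≤ s → 0 ≤ t → a * s + b * t = 0 → s = 0 := by
    intro a b s t ha hb hs ht h
    have h1 := mul_nonneg ha.le hs
    have h2 := mul_nonneg hb.le ht
    exact (mul_eq_zero.1 (by linarith : a * s = 0)).resolve_left ha.ne'
  rw [mem_extremePoints_iff_left]
  refine ⟨hv, ?_⟩
  rintro u hu w hw ⟨a, b, ha, hb, hab, rfl⟩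
  obtain rfl : b = 1 - a := by linarith
  simp only [Prod.fst_add, Prod.snd_add, Prod.smul_fst, Prod.smul_snd, smul_eq_mul] at h1 h2
  set c := a * u.1 + (1 - a) * w.1 with hc
  set d := a * u.2 + (1 - a) * w.2 with hd
  have e1 := key ha hb (sub_nonneg.2 (h1 u hu)) (sub_nonneg.2 (h1 w hw)) (by rw [hc, hd]; ring)
  have e2 := key ha hb (sub_nonneg.2 (h2 u hu)) (sub_nonneg.2 (h2 w hw)) (by rw [hc, hd]; ring)
  have f1 : (p * s - q * r) * (u.1 - c) = 0 := by linear_combination s * e1 - q * e2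
  have f2 : (p * s - q * r) * (u.2 - d) = 0 := by linear_combination p * e2 - r * e1
  have g1 := (mul_eq_zero.1 f1).resolve_left hdet
  have g2 := (mul_eq_zero.1 f2).resolve_left hdet
  ext
  · simp only [Prod.fst_add, Prod.smul_fst, smul_eq_mul]; linarith
  · simp only [Prod.snd_add, Prod.smul_snd, smul_eq_mul]; linarith

theorem eq_zero_of_mem_extremePoints {A : Set E2} {v d : E2} (hv : v ∈ Set.extremePoints ℝ A)
    (h1 : v + d ∈ A) (h2 : v - d ∈ A) : d = 0 := by
  have h : v ∈ openSegment ℝ (v + d) (v - d) :=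
    ⟨1 / 2, 1 / 2, by norm_num, by norm_num, by norm_num, by module⟩
  simpa using (mem_extremePoints_iff_left.1 hv).2 _ h1 _ h2 h

theorem exists_pos_three_mul_lt {a b c d e : ℝ} (ha : 0 < a) (hb : 0 < b) (hc : 0 < c)
    (hd : 0 < d) (he : 0 < e) :
    ∃ ε, 0 < ε ∧ 3 * ε ≤ a ∧ 3 * ε ≤ b ∧ 3 * ε ≤ c ∧ 3 * ε ≤ d ∧ 3 * ε ≤ e := by
  refine ⟨min (min (min a b) (min c d)) e / 3, by positivity, ?_⟩
  rw [mul_div_cancel₀ _ (by norm_num)]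
  simp

theorem extremePoints_cutRect_tight {l h v : E2} (hv : v ∈ Set.extremePoints ℝ (cutRect l h)) :
    (v.1 = l.1 ∨ v.1 = h.1 ∨ 2 * v.1 - v.2 = -1 ∨ 2 * v.2 - v.1 = -1) ∧
    (v.2 = l.2 ∨ v.2 = h.2 ∨ 2 * v.1 - v.2 = -1 ∨ 2 * v.2 - v.1 = -1) ∧
    (v.1 = l.1 ∨ v.1 = h.1 ∨ v.2 = l.2 ∨ v.2 = h.2 ∨ 2 * v.2 - v.1 = -1) ∧
    (v.1 = l.1 ∨ v.1 = h.1 ∨ v.2 = l.2 ∨ v.2 = h.2 ∨ 2 * v.1 - v.2 = -1) := by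
  obtain ⟨⟨a1, a2⟩, ⟨a3, a4⟩, a5, a6⟩ := hv.1
  refine ⟨?_, ?_, ?_, ?_⟩ <;> by_contra! hne
  · obtain ⟨ε, h0, h1, h2, h3, h4, -⟩ := exists_pos_three_mul_lt
      (sub_pos.2 (lt_of_le_of_ne a1 hne.1.symm)) (sub_pos.2 (lt_of_le_of_ne a2 hne.2.1))
      (sub_pos.2 (lt_of_le_of_ne a5 hne.2.2.1.symm)) (sub_pos.2 (lt_of_le_of_ne a6 hne.2.2.2.symm))
      one_pos
    have := eq_zero_of_mem_extremePoints (d := (ε, 0)) hv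
      (by simp [cutRect]; refine ⟨⟨?_, ?_⟩, ⟨?_, ?_⟩, ?_, ?_⟩ <;> linarith)
      (by simp [cutRect]; refine ⟨⟨?_, ?_⟩, ⟨?_, ?_⟩, ?_, ?_⟩ <;> linarith)
    exact h0.ne' (congrArg Prod.fst this)
  · obtain ⟨ε, h0, h1, h2, h3, h4, -⟩ := exists_pos_three_mul_lt
      (sub_pos.2 (lt_of_le_of_ne a3 hne.1.symm)) (sub_pos.2 (lt_of_le_of_ne a4 hne.2.1))
      (sub_pos.2 (lt_of_le_of_ne a5 hne.2.2.1.symm)) (sub_pos.2 (lt_of_le_of_ne a6 hne.2.2.2.symm))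
      one_pos
    have := eq_zero_of_mem_extremePoints (d := (0, ε)) hv
      (by simp [cutRect]; refine ⟨⟨?_, ?_⟩, ⟨?_, ?_⟩, ?_, ?_⟩ <;> linarith)
      (by simp [cutRect]; refine ⟨⟨?_, ?_⟩, ⟨?_, ?_⟩, ?_, ?_⟩ <;> linarith)
    exact h0.ne' (congrArg Prod.snd this)
  · obtain ⟨ε, h0, h1, h2, h3, h4, h5⟩ := exists_pos_three_mul_lt
      (sub_pos.2 (lt_of_le_of_ne a1 hne.1.symm)) (sub_pos.2 (lt_of_le_of_ne a2 hne.2.1))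
      (sub_pos.2 (lt_of_le_of_ne a3 hne.2.2.1.symm)) (sub_pos.2 (lt_of_le_of_ne a4 hne.2.2.2.1))
      (sub_pos.2 (lt_of_le_of_ne a6 hne.2.2.2.2.symm))
    have := eq_zero_of_mem_extremePoints (d := (ε, 2 * ε)) hv
      (by simp [cutRect]; refine ⟨⟨?_, ?_⟩, ⟨?_, ?_⟩, ?_, ?_⟩ <;> linarith)
      (by simp [cutRect]; refine ⟨⟨?_, ?_⟩, ⟨?_, ?_⟩, ?_, ?_⟩ <;> linarith)
    exact h0.ne' (congrArg Prod.fst this)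
  · obtain ⟨ε, h0, h1, h2, h3, h4, h5⟩ := exists_pos_three_mul_lt
      (sub_pos.2 (lt_of_le_of_ne a1 hne.1.symm)) (sub_pos.2 (lt_of_le_of_ne a2 hne.2.1))
      (sub_pos.2 (lt_of_le_of_ne a3 hne.2.2.1.symm)) (sub_pos.2 (lt_of_le_of_ne a4 hne.2.2.2.1))
      (sub_pos.2 (lt_of_le_of_ne a5 hne.2.2.2.2.symm))
    have := eq_zero_of_mem_extremePoints (d := (2 * ε, ε)) hv
      (by simp [cutRect]; refine ⟨⟨?_, ?_⟩, ⟨?_, ?_⟩, ?_, ?_⟩ <;> linarith)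
      (by simp [cutRect]; refine ⟨⟨?_, ?_⟩, ⟨?_, ?_⟩, ?_, ?_⟩ <;> linarith)
    exact h0.ne' (congrArg Prod.snd this)

theorem mem_extremePoints_cutRect {l h : E2} (hl : InChamber l) (hh : InChamber h)
    (h1 : l.1 ≤ h.1) (h2 : l.2 ≤ h.2) (v : E2) :
    v ∈ Set.extremePoints ℝ (cutRect l h) ↔
      v = l ∨ v = h ∨ (-1 ≤ 2 * l.1 - h.2 ∧ v = (l.1, h.2)) ∨
      (-1 ≤ 2 * l.2 - h.1 ∧ v = (h.1, l.2)) ∨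
      (2 * l.1 - h.2 < -1 ∧ (v = (l.1, 2 * l.1 + 1) ∨ v = ((h.2 - 1) / 2, h.2))) ∨
      (2 * l.2 - h.1 < -1 ∧ (v = (2 * l.2 + 1, l.2) ∨ v = (h.1, (h.1 - 1) / 2))) := by
  obtain ⟨l1, l2⟩ := l
  obtain ⟨r1, r2⟩ := h
  obtain ⟨d1, d2⟩ := hl
  obtain ⟨d3, d4⟩ := hh
  dsimp only at d1 d2 d3 d4 h1 h2 ⊢
  constructor
  · intro hv
    have hA := hv.1
    have ht := extremePoints_cutRect_tight hv
    obtain ⟨x, y⟩ := v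
    obtain ⟨⟨b1, b2⟩, ⟨b3, b4⟩, b5, b6⟩ := hA
    simp only [Prod.mk.injEq] at *
    obtain ⟨t1, t2, t3, t4⟩ := ht
    by_cases hp : 2 * x - y = -1
    · have e : x = l1 ∨ y = r2 := by grind
      grind
    by_cases hq : 2 * y - x = -1
    · have e : y = l2 ∨ x = r1 := by grind
      grind
    have e1 : x = l1 ∨ x = r1 := by grind
    have e2 : y = l2 ∨ y = r2 := by grind
    obtain rfl | rfl := e1 <;> obtain rfl | rfl := e2 <;> simp [b5, b6]
  · have mem : ∀ {v : E2}, (l1 ≤ v.1 ∧ v.1 ≤ r1) ∧ (l2 ≤ v.2 ∧ v.2 ≤ r2) ∧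
      -1 ≤ 2 * v.1 - v.2 ∧ -1 ≤ 2 * v.2 - v.1 → v ∈ cutRect (l1, l2) (r1, r2) := id
    rintro (rfl | rfl | ⟨hc, rfl⟩ | ⟨hc, rfl⟩ | ⟨hc, rfl | rfl⟩ | ⟨hc, rfl | rfl⟩)
    · refine mem_extremePoints_of_linear (mem ?_) (p := 1) (q := 0) (r := 0) (s := 1)
        (by norm_num) (fun u hu => ?_) (fun u hu => ?_)
      · dsimp only; refine ⟨⟨?_, ?_⟩, ⟨?_, ?_⟩, ?_, ?_⟩ <;> linarith
      all_goals obtain ⟨⟨b1, b2⟩, ⟨b3, b4⟩, b5, b6⟩ := hu; dsimp only at *; linarith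
    · refine mem_extremePoints_of_linear (mem ?_) (p := -1) (q := 0) (r := 0) (s := -1)
        (by norm_num) (fun u hu => ?_) (fun u hu => ?_)
      · dsimp only; refine ⟨⟨?_, ?_⟩, ⟨?_, ?_⟩, ?_, ?_⟩ <;> linarith
      all_goals obtain ⟨⟨b1, b2⟩, ⟨b3, b4⟩, b5, b6⟩ := hu; dsimp only at *; linarith
    · refine mem_extremePoints_of_linear (mem ?_) (p := 1) (q := 0) (r := 0) (s := -1)
        (by norm_num) (fun u hu => ?_) (fun u hu => ?_)
      · dsimp only; refine ⟨⟨?_, ?_⟩, ⟨?_, ?_⟩, ?_, ?_⟩ <;> linarith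
      all_goals obtain ⟨⟨b1, b2⟩, ⟨b3, b4⟩, b5, b6⟩ := hu; dsimp only at *; linarith
    · refine mem_extremePoints_of_linear (mem ?_) (p := -1) (q := 0) (r := 0) (s := 1)
        (by norm_num) (fun u hu => ?_) (fun u hu => ?_)
      · dsimp only; refine ⟨⟨?_, ?_⟩, ⟨?_, ?_⟩, ?_, ?_⟩ <;> linarith
      all_goals obtain ⟨⟨b1, b2⟩, ⟨b3, b4⟩, b5, b6⟩ := hu; dsimp only at *; linarith
    · refine mem_extremePoints_of_linear (mem ?_) (p := 1) (q := 0) (r := 2) (s := -1)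
        (by norm_num) (fun u hu => ?_) (fun u hu => ?_)
      · dsimp only; refine ⟨⟨?_, ?_⟩, ⟨?_, ?_⟩, ?_, ?_⟩ <;> linarith
      all_goals obtain ⟨⟨b1, b2⟩, ⟨b3, b4⟩, b5, b6⟩ := hu; dsimp only at *; linarith
    · refine mem_extremePoints_of_linear (mem ?_) (p := 0) (q := -1) (r := 2) (s := -1)
        (by norm_num) (fun u hu => ?_) (fun u hu => ?_)
      · dsimp only; refine ⟨⟨?_, ?_⟩, ⟨?_, ?_⟩, ?_, ?_⟩ <;> linarith
      all_goals obtain ⟨⟨b1, b2⟩, ⟨b3, b4⟩, b5, b6⟩ := hu; dsimp only at *; linarith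
    · refine mem_extremePoints_of_linear (mem ?_) (p := 0) (q := 1) (r := -1) (s := 2)
        (by norm_num) (fun u hu => ?_) (fun u hu => ?_)
      · dsimp only; refine ⟨⟨?_, ?_⟩, ⟨?_, ?_⟩, ?_, ?_⟩ <;> linarith
      all_goals obtain ⟨⟨b1, b2⟩, ⟨b3, b4⟩, b5, b6⟩ := hu; dsimp only at *; linarith
    · refine mem_extremePoints_of_linear (mem ?_) (p := -1) (q := 0) (r := -1) (s := 2)
        (by norm_num) (fun u hu => ?_) (fun u hu => ?_)
      · dsimp only; refine ⟨⟨?_, ?_⟩, ⟨?_, ?_⟩, ?_, ?_⟩ <;> linarith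
      all_goals obtain ⟨⟨b1, b2⟩, ⟨b3, b4⟩, b5, b6⟩ := hu; dsimp only at *; linarith

theorem ncard_extremePoints_cutRect_le {l h : E2} (hl : InChamber l) (hh : InChamber h)
    (h1 : l.1 ≤ h.1) (h2 : l.2 ≤ h.2) (hp : -1 ≤ 2 * l.1 - h.2) (hq : -1 ≤ 2 * l.2 - h.1) :
    (Set.extremePoints ℝ (cutRect l h)).ncard ≤ 4 := by
  have : Set.extremePoints ℝ (cutRect l h) = {l, h, (l.1, h.2), (h.1, l.2)} := by
    ext v
    simp [mem_extremePoints_cutRect hl hh h1 h2, hp, hq, hp.not_gt, hq.not_gt]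
  rw [this]
  have e := Set.ncard_insert_le l {h, (l.1, h.2), (h.1, l.2)}
  have e' := Set.ncard_insert_le h {(l.1, h.2), (h.1, l.2)}
  have e'' := Set.ncard_insert_le (l.1, h.2) {(h.1, l.2)}
  rw [Set.ncard_singleton] at e''
  omega

theorem ncard_extremePoints_cutRect_of_left {l h : E2} (hl : InChamber l) (hh : InChamber h)
    (h1 : l.1 ≤ h.1) (h2 : l.2 ≤ h.2) (hp : 2 * l.1 - h.2 < -1)
    (hq : -1 ≤ 2 * l.2 - h.1) : (Set.extremePoints ℝ (cutRect l h)).ncard = 5 := by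
  have : Set.extremePoints ℝ (cutRect l h) =
      {l, h, (h.1, l.2), (l.1, 2 * l.1 + 1), ((h.2 - 1) / 2, h.2)} := by
    ext v
    simp [mem_extremePoints_cutRect hl hh h1 h2, hp, hq, hp.not_ge, hq.not_gt]
  obtain ⟨d1, d2⟩ := hl
  obtain ⟨d3, d4⟩ := hh
  rw [this, Set.ncard_insert_of_notMem, Set.ncard_insert_of_notMem, Set.ncard_insert_of_notMem,
    Set.ncard_pair]
  all_goals
    simp only [ne_eq, Set.mem_insert_iff, Set.mem_singleton_iff, Prod.ext_iff]
    grind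

theorem ncard_extremePoints_cutRect_of_right {l h : E2} (hl : InChamber l) (hh : InChamber h)
    (h1 : l.1 ≤ h.1) (h2 : l.2 ≤ h.2) (hp : -1 ≤ 2 * l.1 - h.2)
    (hq : 2 * l.2 - h.1 < -1) : (Set.extremePoints ℝ (cutRect l h)).ncard = 5 := by
  have : Set.extremePoints ℝ (cutRect l h) =
      {l, h, (l.1, h.2), (2 * l.2 + 1, l.2), (h.1, (h.1 - 1) / 2)} := by
    ext v
    simp [mem_extremePoints_cutRect hl hh h1 h2, hp, hq, hq.not_ge, hp.not_gt]
  obtain ⟨d1, d2⟩ := hl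
  obtain ⟨d3, d4⟩ := hh
  rw [this, Set.ncard_insert_of_notMem, Set.ncard_insert_of_notMem, Set.ncard_insert_of_notMem,
    Set.ncard_pair]
  all_goals
    simp only [ne_eq, Set.mem_insert_iff, Set.mem_singleton_iff, Prod.ext_iff]
    grind

theorem ncard_extremePoints_cutRect_of_both {l h : E2} (hl : InChamber l) (hh : InChamber h)
    (h1 : l.1 ≤ h.1) (h2 : l.2 ≤ h.2) (hp : 2 * l.1 - h.2 < -1)
    (hq : 2 * l.2 - h.1 < -1) : (Set.extremePoints ℝ (cutRect l h)).ncard = 6 := by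
  have : Set.extremePoints ℝ (cutRect l h) =
      {l, h, (l.1, 2 * l.1 + 1), ((h.2 - 1) / 2, h.2), (2 * l.2 + 1, l.2),
        (h.1, (h.1 - 1) / 2)} := by
    ext v
    simp [mem_extremePoints_cutRect hl hh h1 h2, hp, hq, hq.not_ge, hp.not_ge, or_assoc]
  obtain ⟨d1, d2⟩ := hl
  obtain ⟨d3, d4⟩ := hh
  rw [this, Set.ncard_insert_of_notMem, Set.ncard_insert_of_notMem, Set.ncard_insert_of_notMem,
    Set.ncard_insert_of_notMem, Set.ncard_pair]
  all_goals
    simp only [ne_eq, Set.mem_insert_iff, Set.mem_singleton_iff, Prod.ext_iff]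
    grind

theorem Pgn_eq_cutRect {W : Type*} [Group W] {act : W →* Equiv.Perm E2} {x y : W}
    (hx : InChamber (cen act x)) : Pgn act x y = cutRect (cen act x) (cen act y) := by
  ext v
  constructor
  · rintro ⟨⟨f1, f2, -⟩, ⟨k, ⟨a, b, ha, hb, rfl⟩, hk⟩, ⟨k', ⟨a', b', ha', hb', rfl⟩, hk'⟩⟩
    have e1 := congrArg Prod.fst hk
    have e2 := congrArg Prod.snd hk
    have e3 := congrArg Prod.fst hk'
    have e4 := congrArg Prod.snd hk'
    simp [B2, a1, a2] at e1 e2 e3 e4 f1 f2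
    refine ⟨⟨?_, ?_⟩, ⟨?_, ?_⟩, ?_, ?_⟩ <;> linarith
  · rintro ⟨⟨b1, b2⟩, ⟨b3, b4⟩, b5, b6⟩
    refine ⟨⟨?_, ?_, ?_⟩,
      ⟨_, ⟨v.1 - (cen act x).1, v.2 - (cen act x).2, by linarith, by linarith, rfl⟩, ?_⟩,
      ⟨_, ⟨(cen act y).1 - v.1, (cen act y).2 - v.2, by linarith, by linarith, rfl⟩, ?_⟩⟩
    · simp [B2, a1]; linarith
    · simp [B2, a2]; linarith
    · simp [B2, rho2]; linarith [hx.1, hx.2]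
    · ext <;> simp [a1, a2]
    · ext <;> simp [a1, a2]

end Polygon

theorem IsDom.inChamber {a : ℤ × ℤ} (h : IsDom a) : InChamber (planePt a) := by
  have h1 : (0 : ℝ) < 2 * a.1 - a.2 := by exact_mod_cast h.1
  have h2 : (0 : ℝ) < 2 * a.2 - a.1 := by exact_mod_cast h.2
  constructor <;> simp only [planePt] <;> linarith

theorem two_mul_div_three_sub_lt_iff {m n : ℤ} :
    2 * ((m : ℝ) / 3) - (n : ℝ) / 3 < -1 ↔ 2 * m - n < -3 := by
  rw [← Int.cast_lt (R := ℝ)]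
  push_cast
  constructor <;> intro h <;> linarith

theorem BruhatCrit.le_of_isDom {a b : ℤ × ℤ} (hb : IsDom b) (h : BruhatCrit a b) :
    a.1 ≤ b.1 ∧ a.2 ≤ b.2 := by
  rw [bruhatCrit_of_isDom_right hb] at h
  exact ⟨h.1.1, h.2.2.2⟩

theorem IntervalIso.ncard_eq {W : Type*} [Group W] {M : CoxeterMatrix (Fin 3)}
    {cs : CoxeterSystem M W} {x y x' y' : W} (h : IntervalIso cs cs x y x' y') :
    {z | bruhatLE cs x z ∧ bruhatLE cs z y}.ncard =
      {z | bruhatLE cs x' z ∧ bruhatLE cs z y'}.ncard := by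
  obtain ⟨f, -⟩ := h
  exact Nat.card_congr f

/-- behaviour of the piecewise translations `τ_λ` on parallelogram, pentagon
and hexagon intervals. -/
theorem statement9
    {W : Type*} [Group W] {M : CoxeterMatrix (Fin 3)} (cs : CoxeterSystem M W)
    (hM : ∀ i j : Fin 3, M i j = if i = j then 1 else 3)
    (act : W →* Equiv.Perm E2)
    (h0 : ∀ v, act (cs.simple 0) v = reflE rho2 (-1) v)
    (h1 : ∀ v, act (cs.simple 1) v = reflE a1 0 v)
    (h2 : ∀ v, act (cs.simple 2) v = reflE a2 0 v)
    (hcen : Function.Injective (cen act))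
    (th ths : ℕ → ℕ → W)
    (hth : ∀ m n : ℕ, cen act (th m n) =
      cen act (cs.simple 1 * cs.simple 2 * cs.simple 1) + (m : ℝ) • fw1 + (n : ℝ) • fw2)
    (hths : ∀ m n : ℕ, cen act (ths m n) =
      cen act 1 + ((m : ℝ) + 1) • fw1 + ((n : ℝ) + 1) • fw2)
    (Wadd : W → E2 → W)
    (hWadd : ∀ (z : W), ∀ v ∈ wLat, cen act (Wadd z v) = cen act z + v)
    (x y : W) (hx : x ∈ Dset th ths) (hy : y ∈ Dset th ths) (hxy : bruhatLE cs x y)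
    (tau1 tau2 : W → W)
    (htau1 : ∀ z : W, ∃ w : W, zoneOf cs w (cen act z) ∧
      cen act (tau1 z) = cen act z + act w fw1)
    (htau2 : ∀ z : W, ∃ w : W, zoneOf cs w (cen act z) ∧
      cen act (tau2 z) = cen act z + act w fw2) :
    ((Set.extremePoints ℝ (Pgn act x y)).ncard ≤ 4 →
      ∀ a b : ℕ,
        Set.BijOn (tau1^[a] ∘ tau2^[b]) (Iset cs x y)
          (Iset cs (Wadd x ((a : ℝ) • fw1 + (b : ℝ) • fw2))
            (Wadd y ((a : ℝ) • fw1 + (b : ℝ) • fw2))) ∧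
        ∀ u ∈ Iset cs x y, ∀ v ∈ Iset cs x y,
          (bruhatLE cs u v ↔
            bruhatLE cs ((tau1^[a] ∘ tau2^[b]) u) ((tau1^[a] ∘ tau2^[b]) v))) ∧
    ((Set.extremePoints ℝ (Pgn act x y)).ncard = 5 →
      (((∃ v1 ∈ Set.extremePoints ℝ (Pgn act x y), ∃ v2 ∈ Set.extremePoints ℝ (Pgn act x y),
          v1 ≠ v2 ∧ (∃ t : ℝ, 0 ≤ t ∧ v1 = a1 + t • fw1) ∧ (∃ t : ℝ, 0 ≤ t ∧ v2 = a1 + t • fw1)) ∧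
        (∀ a : ℕ,
          Set.BijOn (tau1^[a]) (Iset cs x y)
            (Iset cs (Wadd x ((a : ℝ) • fw1)) (Wadd y ((a : ℝ) • fw1))) ∧
          ∀ u ∈ Iset cs x y, ∀ v ∈ Iset cs x y,
            (bruhatLE cs u v ↔ bruhatLE cs (tau1^[a] u) (tau1^[a] v))) ∧
        (∀ a b : ℕ, b ≠ 0 →
          ¬ IntervalIso cs cs x y (Wadd x ((a : ℝ) • fw1 + (b : ℝ) • fw2))
            (Wadd y ((a : ℝ) • fw1 + (b : ℝ) • fw2)))) ∨
       ((∃ v1 ∈ Set.extremePoints ℝ (Pgn act x y), ∃ v2 ∈ Set.extremePoints ℝ (Pgn act x y),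
          v1 ≠ v2 ∧ (∃ t : ℝ, 0 ≤ t ∧ v1 = a2 + t • fw2) ∧ (∃ t : ℝ, 0 ≤ t ∧ v2 = a2 + t • fw2)) ∧
        (∀ b : ℕ,
          Set.BijOn (tau2^[b]) (Iset cs x y)
            (Iset cs (Wadd x ((b : ℝ) • fw2)) (Wadd y ((b : ℝ) • fw2))) ∧
          ∀ u ∈ Iset cs x y, ∀ v ∈ Iset cs x y,
            (bruhatLE cs u v ↔ bruhatLE cs (tau2^[b] u) (tau2^[b] v))) ∧
        (∀ a b : ℕ, a ≠ 0 →
          ¬ IntervalIso cs cs x y (Wadd x ((a : ℝ) • fw1 + (b : ℝ) • fw2))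
            (Wadd y ((a : ℝ) • fw1 + (b : ℝ) • fw2)))))) ∧
    ((Set.extremePoints ℝ (Pgn act x y)).ncard = 6 →
      ∀ a b : ℕ, ¬(a = 0 ∧ b = 0) →
        ¬ IntervalIso cs cs x y (Wadd x ((a : ℝ) • fw1 + (b : ℝ) • fw2))
          (Wadd y ((a : ℝ) • fw1 + (b : ℝ) • fw2))) := by
  choose U hU using exists_planePt h0 h1 h2
  have hm : AlcoveModel (bruhatLE cs) U := alcoveModel_of_cen h0 h1 h2 hcen hU
  have ht₁ : ∀ z, U z ≠ (-1, -1) → U (tau1 z) = tauZ (U z) := fun z hz => by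
    obtain ⟨w, hw, e⟩ := htau1 z
    rw [hU] at hw
    rw [hU, hU, (tauZ_of_zone h1 h2 (hm.isAlc z) hz hw).1] at e
    exact planePt_injective e
  have ht₂ : ∀ z, U z ≠ (-1, -1) → U (tau2 z) = (tauZ (U z).swap).swap := fun z hz => by
    obtain ⟨w, hw, e⟩ := htau2 z
    rw [hU] at hw
    rw [hU, hU, (tauZ_of_zone h1 h2 (hm.isAlc z) hz hw).2] at e
    exact planePt_injective e
  have hdx := isDom_of_mem_Dset h0 h1 h2 hU hth hths hx
  have hdy := isDom_of_mem_Dset h0 h1 h2 hU hth hths hy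
  have hle := ((hm.le_iff x y).1 hxy).le_of_isDom hdy
  have hW := coord_add_weight hU hWadd
  have hiso : ∀ a b : ℕ, (a = 0 ∨ ¬ 2 * (U x).1 - (U y).2 < -3) →
      (b = 0 ∨ ¬ 2 * (U x).2 - (U y).1 < -3) →
      IsoOn (bruhatLE cs) (tau1^[a] ∘ tau2^[b]) x y
        (Wadd x ((a : ℝ) • fw1 + (b : ℝ) • fw2)) (Wadd y ((a : ℝ) • fw1 + (b : ℝ) • fw2)) :=
    fun a b ha hb => hm.isoOn_iterate_comp ht₁ ht₂ hdx hdy (hW x a b) (hW y a b)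
      (ha.imp_right not_lt.1) (hb.imp_right not_lt.1)
  have hniso₁ : ∀ a b : ℕ, a ≠ 0 → 2 * (U x).1 - (U y).2 < -3 →
      ¬ IntervalIso cs cs x y (Wadd x ((a : ℝ) • fw1 + (b : ℝ) • fw2))
        (Wadd y ((a : ℝ) • fw1 + (b : ℝ) • fw2)) := fun a b ha hc h =>
    (hm.ncard_lt_of_cut ht₁ ht₂ hdx hdy (hW x a b) (hW y a b) ha hc).ne h.ncard_eq
  have hniso₂ : ∀ a b : ℕ, b ≠ 0 → 2 * (U x).2 - (U y).1 < -3 →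
      ¬ IntervalIso cs cs x y (Wadd x ((a : ℝ) • fw1 + (b : ℝ) • fw2))
        (Wadd y ((a : ℝ) • fw1 + (b : ℝ) • fw2)) := fun a b hb hc h =>
    (hm.ncard_lt_of_cut' ht₁ ht₂ hdx hdy (hW x a b) (hW y a b) hb hc).ne h.ncard_eq
  have hcx := hdx.inChamber
  have hcy := hdy.inChamber
  rw [Pgn_eq_cutRect (by rwa [hU]), hU, hU]
  have hle₁ : (planePt (U x)).1 ≤ (planePt (U y)).1 := by
    have : ((U x).1 : ℝ) ≤ (U y).1 := by exact_mod_cast hle.1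
    simp only [planePt]; linarith
  have hle₂ : (planePt (U x)).2 ≤ (planePt (U y)).2 := by
    have : ((U x).2 : ℝ) ≤ (U y).2 := by exact_mod_cast hle.2
    simp only [planePt]; linarith
  have hp : 2 * (planePt (U x)).1 - (planePt (U y)).2 < -1 ↔ 2 * (U x).1 - (U y).2 < -3 :=
    two_mul_div_three_sub_lt_iff
  have hq : 2 * (planePt (U x)).2 - (planePt (U y)).1 < -1 ↔ 2 * (U x).2 - (U y).1 < -3 :=
    two_mul_div_three_sub_lt_iff
  have hmem := mem_extremePoints_cutRect hcx hcy hle₁ hle₂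
  have hcount₀ := ncard_extremePoints_cutRect_le hcx hcy hle₁ hle₂
  have hcount₁ := ncard_extremePoints_cutRect_of_left hcx hcy hle₁ hle₂
  have hcount₂ := ncard_extremePoints_cutRect_of_right hcx hcy hle₁ hle₂
  have hcount₃ := ncard_extremePoints_cutRect_of_both hcx hcy hle₁ hle₂
  rw [← not_lt, ← not_lt, hp, hq] at hcount₀
  rw [← not_lt, hp, hq] at hcount₁ hcount₂
  rw [hp, hq] at hcount₃
  obtain ⟨hx₁, hx₂⟩ := hcx
  obtain ⟨hy₁, hy₂⟩ := hcy
  refine ⟨fun hn a b => ?_, fun hn => ?_, fun hn a b hab => ?_⟩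
  · refine hiso a b (.inr fun hc => ?_) (.inr fun hc => ?_)
    · by_cases hd : 2 * (U x).2 - (U y).1 < -3
      · have := hcount₃ hc hd; omega
      · have := hcount₁ hc hd; omega
    · by_cases hd : 2 * (U x).1 - (U y).2 < -3
      · have := hcount₃ hd hc; omega
      · have := hcount₂ hd hc; omega
  · by_cases hc : 2 * (U x).1 - (U y).2 < -3
    · have hd : ¬ 2 * (U x).2 - (U y).1 < -3 := fun hd => by have := hcount₃ hc hd; omega
      have hc' := hp.2 hc
      refine .inr ⟨⟨_, (hmem _).2 (.inr (.inr (.inr (.inr (.inl ⟨hc', .inl rfl⟩))))), _,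
        (hmem _).2 (.inr (.inr (.inr (.inr (.inl ⟨hc', .inr rfl⟩))))), fun e => ?_,
        ⟨3 * (planePt (U x)).1, by linarith, ?_⟩,
        ⟨3 * (((planePt (U y)).2 - 1) / 2), by linarith, ?_⟩⟩,
        fun b => ?_, fun a b ha => hniso₁ a b ha hc⟩
      · have e' := congrArg Prod.fst e
        dsimp only at e'
        linarith
      · ext <;> simp [a2, fw2] <;> ring
      · ext <;> simp [a2, fw2] <;> ring
      · have := hiso 0 b (.inl rfl) (.inr hd)
        rw [Nat.cast_zero, zero_smul, zero_add] at this
        exact this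
    · have hd : 2 * (U x).2 - (U y).1 < -3 := by
        by_contra hd
        have := hcount₀ hc hd
        omega
      have hd' := hq.2 hd
      refine .inl ⟨⟨_, (hmem _).2 (.inr (.inr (.inr (.inr (.inr ⟨hd', .inl rfl⟩))))), _,
        (hmem _).2 (.inr (.inr (.inr (.inr (.inr ⟨hd', .inr rfl⟩))))), fun e => ?_,
        ⟨3 * (planePt (U x)).2, by linarith, ?_⟩,
        ⟨3 * (((planePt (U y)).1 - 1) / 2), by linarith, ?_⟩⟩,
        fun a => ?_, fun a b hb => hniso₂ a b hb hd⟩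
      · have e' := congrArg Prod.snd e
        dsimp only at e'
        linarith
      · ext <;> simp [a1, fw1] <;> ring
      · ext <;> simp [a1, fw1] <;> ring
      · have := hiso a 0 (.inr hc) (.inl rfl)
        rw [Nat.cast_zero, zero_smul, add_zero] at this
        exact this
  · have hcd : 2 * (U x).1 - (U y).2 < -3 ∧ 2 * (U x).2 - (U y).1 < -3 := by
      by_contra! hcd
      by_cases hc : 2 * (U x).1 - (U y).2 < -3
      · have := hcount₁ hc (not_lt.2 (hcd hc)); omega
      · by_cases hd : 2 * (U x).2 - (U y).1 < -3
        · have := hcount₂ hc hd; omega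
        · have := hcount₀ hc hd; omega
    by_cases ha : a = 0
    · exact hniso₂ a b (fun hb => hab ⟨ha, hb⟩) hcd.2
    · exact hniso₁ a b ha hcd.1
end
end
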